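/- Let X be a geodesic metric space homeomorphic to D̄ with H²(X) < ∞ and with boundary circle ∂X of finite length. Then there exists M > 0 with the following property: for every ε > 0 there is a Lipschitz map v : D̄ → E(X) into the injective hull of X such that Area(v) ≤ M, the restriction v|_{S¹} parametrizes ∂X, and the image of v is contained in the ε-neighborhood of X in E(X). -/

import Mathlib

noncomputable section

/-- The Euclidean plane `ℝ²`. -/
abbrev E2 : Type := EuclideanSpace ℝ (Fin 2)

/-- The open unit disc `D ⊆ ℝ²`. -/
def unitDisc : Set E2 := Metric.ball 0 1

/-- The closed unit disc `D̄ ⊆ ℝ²`. -/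
def unitClosedDisc : Set E2 := Metric.closedBall 0 1

/-- The unit circle `S¹ ⊆ ℝ²`. -/
def unitCircle : Set E2 := Metric.sphere 0 1

/-- A curve in a metric space: a function which is continuous on a compact interval `[a,b]`. -/
structure MCurve (X : Type*) [PseudoEMetricSpace X] where
  a : ℝ
  b : ℝ
  hab : a ≤ b
  toFun : ℝ → X
  cont : ContinuousOn toFun (Set.Icc a b)

/-- The length of a curve, i.e. its total variation. -/
def MCurve.length {X : Type*} [PseudoEMetricSpace X] (γ : MCurve X) : ENNReal :=
  eVariationOn γ.toFun (Set.Icc γ.a γ.b)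

/-- A metric space is geodesic if any two points are joined by a curve whose length equals
their distance. -/
def IsGeodesicSpace (X : Type*) [MetricSpace X] : Prop :=
  ∀ x y : X, ∃ γ : MCurve X, γ.toFun γ.a = x ∧ γ.toFun γ.b = y ∧ γ.length = edist x y

/-- A metric space is locally geodesic if every point has a neighborhood `U` such that any two
points of `U` are joined by a geodesic in `X`. -/
def IsLocallyGeodesicSpace (X : Type*) [MetricSpace X] : Prop :=
  ∀ x : X, ∃ U ∈ nhds x, ∀ y ∈ U, ∀ z ∈ U,
    ∃ γ : MCurve X, γ.toFun γ.a = y ∧ γ.toFun γ.b = z ∧ γ.length = edist y z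

/-- The vertices of the standard equilateral Euclidean simplex of side length `r`. -/
def simplexVertex (r : ℝ) (i : Fin 3) : EuclideanSpace ℝ (Fin 3) :=
  (r / Real.sqrt 2) • EuclideanSpace.single i (1:ℝ)

/-- The standard equilateral Euclidean `k`-simplex of side length `r` (for `k ≤ 2`). -/
def euclideanSimplex (r : ℝ) (k : Fin 3) : Set (EuclideanSpace ℝ (Fin 3)) :=
  convexHull ℝ (simplexVertex r '' {i : Fin 3 | i ≤ k})

/-- A finite metric simplicial complex of dimension at most `2`, equipped with a geodesic
metric in which every simplex is a Euclidean simplex of side length `r`. -/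
structure EuclideanComplex2 (r : ℝ) where
  space : Type
  [metricSpace : MetricSpace space]
  [measurableSpace : MeasurableSpace space]
  [borelSpace : BorelSpace space]
  ι : Type
  [finite : Finite ι]
  dim : ι → Fin 3
  face : ι → Set space
  face_isom : ∀ i, Nonempty (↥(face i) ≃ᵢ ↥(euclideanSimplex r (dim i)))
  covers : ⋃ i, face i = Set.univ
  geodesic : IsGeodesicSpace space

attribute [instance] EuclideanComplex2.metricSpace EuclideanComplex2.measurableSpace
  EuclideanComplex2.borelSpace EuclideanComplex2.finite

/-- The `1`-skeleton of such a complex. -/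
def EuclideanComplex2.oneSkeleton {r : ℝ} (K : EuclideanComplex2 r) : Set K.space :=
  ⋃ i ∈ {i | K.dim i ≤ 1}, K.face i

open Metric MeasureTheory Set Filter Topology ENNReal NNReal



/-- The metric speed `|f'|(t)` of a map `f : ℝ → X`. -/
def metricSpeed {X : Type*} [PseudoEMetricSpace X] (f : ℝ → X) (t : ℝ) : ℝ≥0∞ :=
  Filter.limsup (fun s : ℝ => edist (f s) (f t) / ENNReal.ofReal |s - t|) (𝓝[≠] t)

/-- The path integral `∫_γ ρ` of a Borel density `ρ` along a curve `γ`. -/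
def MCurve.pathIntegral {X : Type*} [PseudoEMetricSpace X] (γ : MCurve X) (ρ : X → ℝ≥0∞) : ℝ≥0∞ :=
  ∫⁻ t in Set.Icc γ.a γ.b, ρ (γ.toFun t) * metricSpeed γ.toFun t

/-- The family of curves whose image is contained in `S`. -/
def CurvesIn {X : Type*} [PseudoEMetricSpace X] (S : Set X) : Set (MCurve X) :=
  {γ | ∀ t ∈ Set.Icc γ.a γ.b, γ.toFun t ∈ S}

/-- The family `u ∘ Γ` of all compositions `u ∘ γ`, `γ ∈ Γ`. -/
def mapFamily {X Y : Type*} [PseudoEMetricSpace X] [PseudoEMetricSpace Y]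
    (u : X → Y) (Γ : Set (MCurve X)) : Set (MCurve Y) :=
  {δ | ∃ γ ∈ Γ, δ.a = γ.a ∧ δ.b = γ.b ∧ δ.toFun = u ∘ γ.toFun}

section Modulus

variable {X : Type*} [EMetricSpace X] [MeasurableSpace X] [BorelSpace X]

/-- A Borel function `ρ` is admissible for the curve family `Γ` if `∫_γ ρ ≥ 1` for every
(locally) rectifiable curve in `Γ`. -/
def Admissible (Γ : Set (MCurve X)) (ρ : X → ℝ≥0∞) : Prop :=
  Measurable ρ ∧ ∀ γ ∈ Γ, γ.length ≠ ⊤ → 1 ≤ γ.pathIntegral ρ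

/-- The conformal modulus of a family of curves, with respect to Hausdorff `2`-measure. -/
def MOD (Γ : Set (MCurve X)) : ℝ≥0∞ :=
  ⨅ (ρ : X → ℝ≥0∞) (_ : Admissible Γ ρ), ∫⁻ x, ρ x ^ 2 ∂(μH[2] : Measure X)

/-- The family of curves joining `E` and `F` within `G`. -/
def joiningCurves (E F G : Set X) : Set (MCurve X) :=
  {γ | (∀ t ∈ Set.Icc γ.a γ.b, γ.toFun t ∈ G) ∧ γ.toFun γ.a ∈ E ∧ γ.toFun γ.b ∈ F}

/-- `MOD(E, F; G)`, the modulus of the family of curves joining `E` and `F` within `G`. -/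
def MODJoin (E F G : Set X) : ℝ≥0∞ := MOD (joiningCurves E F G)

end Modulus


/-- A Jordan curve: a subset homeomorphic to the unit circle. -/
def IsJordanCurve {X : Type*} [TopologicalSpace X] (Γ : Set X) : Prop :=
  Nonempty (↥Γ ≃ₜ ↥unitCircle)

/-- A Jordan domain: a domain whose boundary is a Jordan curve. -/
def IsJordanDomain {X : Type*} [TopologicalSpace X] (Ω : Set X) : Prop :=
  IsOpen Ω ∧ IsConnected Ω ∧ IsJordanCurve (frontier Ω)

/-- A subset has finite length if it is the image of a rectifiable curve. -/
def HasFiniteLength {X : Type*} [MetricSpace X] (Γ : Set X) : Prop :=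
  ∃ γ : MCurve X, γ.toFun '' Set.Icc γ.a γ.b = Γ ∧ γ.length ≠ ⊤

/-- `u` restricted to `S` is a homeomorphism onto `T`. -/
def RestrictsToHomeo {A X : Type*} [TopologicalSpace A] [TopologicalSpace X]
    (u : A → X) (S : Set A) (T : Set X) : Prop :=
  ∃ e : ↥S ≃ₜ ↥T, ∀ z : ↥S, (e z : X) = u (z : A)

/-- Condition (⋆): points have vanishing modulus. -/
def PointsZeroModulus (X : Type*) [MetricSpace X] [MeasurableSpace X] [BorelSpace X] : Prop :=
  ∀ (x : X) (R : ℝ), 0 < R → ((Metric.ball x R)ᶜ).Nonempty →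
    Filter.Tendsto
      (fun r : ℝ => MODJoin (Metric.ball x r) (Metric.ball x R)ᶜ (Metric.closedBall x R))
      (𝓝[>] (0:ℝ)) (𝓝 0)

/-- Condition (⋆⋆): for every closed topological square `Q ⊆ X` with boundary edges
`ζ₁, ζ₂, ζ₃, ζ₄` in cyclic order, `MOD(ζ₁,ζ₃;Q) ⬝ MOD(ζ₂,ζ₄;Q) ≤ κ`. -/
def SquareCondition (X : Type*) [MetricSpace X] [MeasurableSpace X] [BorelSpace X]
    (κ : ℝ≥0∞) : Prop :=
  ∀ (φ : ℝ × ℝ → X) (Q : Set X),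
    RestrictsToHomeo φ (Set.Icc (0:ℝ) 1 ×ˢ Set.Icc (0:ℝ) 1) Q →
    MODJoin (φ '' (Set.Icc (0:ℝ) 1 ×ˢ {(0:ℝ)})) (φ '' (Set.Icc (0:ℝ) 1 ×ˢ {(1:ℝ)})) Q *
      MODJoin (φ '' ({(0:ℝ)} ×ˢ Set.Icc (0:ℝ) 1)) (φ '' ({(1:ℝ)} ×ˢ Set.Icc (0:ℝ) 1)) Q ≤ κ

section Sobolev

variable {X : Type*} [MetricSpace X]

/-- `g` is a weak upper gradient of `u` on `U`: the upper gradient inequality holds along all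
rectifiable curves in `U` outside an exceptional family of modulus zero. -/
def IsWeakUpperGradientOn (u : E2 → X) (U : Set E2) (g : E2 → ℝ≥0∞) : Prop :=
  ∃ Γ₀ : Set (MCurve E2), MOD Γ₀ = 0 ∧
    ∀ γ : MCurve E2, γ ∈ CurvesIn U → γ.length ≠ ⊤ → γ ∉ Γ₀ →
      edist (u (γ.toFun γ.a)) (u (γ.toFun γ.b)) ≤ γ.pathIntegral g

/-- Membership in the Newton–Sobolev space `N^{1,2}(U, X)`. -/
def MemN12 (U : Set E2) (u : E2 → X) : Prop :=
  AEStronglyMeasurable u (volume.restrict U) ∧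
  (∃ x₀ : X, (∫⁻ z in U, edist (u z) x₀ ^ 2) ≠ ⊤) ∧
  ∃ g : E2 → ℝ≥0∞, Measurable g ∧ IsWeakUpperGradientOn u U g ∧ (∫⁻ z in U, g z ^ 2) ≠ ⊤

/-- The Reshetnyak energy `E²₊(u)` of `u` on the unit disc: the infimum of `∫_D g²` over all
weak upper gradients `g` of `u` (attained by the minimal weak upper gradient). -/
def energy (u : E2 → X) : ℝ≥0∞ :=
  ⨅ (g : E2 → ℝ≥0∞) (_ : Measurable g ∧ IsWeakUpperGradientOn u unitDisc g),
    ∫⁻ z in unitDisc, g z ^ 2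

/-- `g` is the minimal weak upper gradient of `u` on the unit disc. -/
def IsMinimalWUG (u : E2 → X) (g : E2 → ℝ≥0∞) : Prop :=
  Measurable g ∧ IsWeakUpperGradientOn u unitDisc g ∧ (∫⁻ z in unitDisc, g z ^ 2) ≠ ⊤ ∧
    ∀ h : E2 → ℝ≥0∞, Measurable h → IsWeakUpperGradientOn u unitDisc h →
      (∫⁻ z in unitDisc, h z ^ 2) ≠ ⊤ → ∀ᵐ z ∂(volume.restrict unitDisc), g z ≤ h z

/-- `c` is a representative of the trace of `u`: for a.e. `v ∈ S¹` the radial limit of `u`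
at `v` is `c v`. -/
def IsTraceRep (u c : E2 → X) : Prop :=
  ∀ᵐ v ∂((μH[1] : Measure E2).restrict unitCircle),
    Filter.Tendsto (fun t : ℝ => u (t • v)) (𝓝[<] (1:ℝ)) (𝓝 (c v))

/-- `c` (restricted to `S¹`) is a weakly monotone parametrization of the Jordan curve `Γ`:
a uniform limit of homeomorphisms `S¹ → Γ`. -/
def IsWeaklyMonotoneParam {Y : Type*} [MetricSpace Y] (c : E2 → Y) (Γ : Set Y) : Prop :=
  ContinuousOn c unitCircle ∧ (∀ v ∈ unitCircle, c v ∈ Γ) ∧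
    ∀ ε : ℝ, 0 < ε → ∃ h : ↥unitCircle ≃ₜ ↥Γ,
      ∀ v : ↥unitCircle, dist (c (v : E2)) ((h v : ↥Γ) : Y) < ε

/-- The family `Λ(Γ, X)` of Sobolev discs spanning the Jordan curve `Γ`. -/
def Lambda (Γ : Set X) : Set (E2 → X) :=
  {u | MemN12 unitDisc u ∧ ∃ c : E2 → X, IsWeaklyMonotoneParam c Γ ∧ IsTraceRep u c}

/-- The seminorm `s` is the approximate metric derivative of `u` at `z`:
`ap lim_{y → z} (d(u y, u z) - s(y-z)) / |y-z| = 0`. -/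
def HasApproxMetricDeriv (u : E2 → X) (z : E2) (s : Seminorm ℝ E2) : Prop :=
  ∀ ε : ℝ, 0 < ε →
    Filter.Tendsto
      (fun r : ℝ =>
        volume {y : E2 | y ∈ Metric.ball z r ∧
            ε * ‖y - z‖ ≤ |dist (u y) (u z) - s (y - z)|} / volume (Metric.ball z r))
      (𝓝[>] (0:ℝ)) (𝓝 0)

end Sobolev

open Classical in
/-- The Jacobian `J(s)` of a seminorm `s` on `ℝ²`: the Hausdorff 2-measure of the unit square
in `(ℝ², s)` when `s` is a norm (which equals `π / |{s ≤ 1}|`), and `0` otherwise. -/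
def seminormJacobian (s : Seminorm ℝ E2) : ℝ≥0∞ :=
  if ∃ v : E2, v ≠ 0 ∧ s v = 0 then 0
  else ENNReal.ofReal Real.pi / volume {v : E2 | s v ≤ 1}

/-- `u` is infinitesimally `K`-quasiconformal: `g_u(z)² ≤ K ⬝ J(md u_z)` for a.e. `z ∈ D`. -/
def InfinitesimallyQC {X : Type*} [MetricSpace X] (u : E2 → X) (K : ℝ≥0∞) : Prop :=
  ∃ g : E2 → ℝ≥0∞, IsMinimalWUG u g ∧
    ∀ᵐ z ∂(volume.restrict unitDisc),
      ∃ s : Seminorm ℝ E2, HasApproxMetricDeriv u z s ∧ g z ^ 2 ≤ K * seminormJacobian s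

/-- The parametrized (Hausdorff) area `Area(u) = ∫_D J(md u_z) dz`. -/
def parametrizedArea {X : Type*} [MetricSpace X] (u : E2 → X) : ℝ≥0∞ :=
  ∫⁻ z in unitDisc, ⨆ (s : Seminorm ℝ E2) (_ : HasApproxMetricDeriv u z s), seminormJacobian s

/-- The essential oscillation of `u` in the `δ`-ball around `z` (within the unit disc). -/
def essOsc {X : Type*} [MetricSpace X] (u : E2 → X) (z : E2) (δ : ℝ) : ℝ≥0∞ :=
  ⨅ (A : Set E2)
    (_ : A ⊆ unitDisc ∩ Metric.ball z δ ∧ volume ((unitDisc ∩ Metric.ball z δ) \ A) = 0),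
    EMetric.diam (u '' A)

/-- A quasisymmetric map between metric spaces. -/
def IsQuasisymmetric {M X : Type*} [MetricSpace M] [MetricSpace X] (u : M → X) : Prop :=
  ∃ η : ℝ≥0 ≃ₜ ℝ≥0, ∀ z a b : M, ∀ t : ℝ≥0,
    dist z a ≤ (t : ℝ) * dist z b → dist (u z) (u a) ≤ (η t : ℝ) * dist (u z) (u b)

/-- A map `u` is quasisymmetric on a subset `S` of its domain. -/
def IsQuasisymmetricOn {M X : Type*} [MetricSpace M] [MetricSpace X] (u : M → X)
    (S : Set M) : Prop :=
  ∃ η : ℝ≥0 ≃ₜ ℝ≥0, ∀ z ∈ S, ∀ a ∈ S, ∀ b ∈ S, ∀ t : ℝ≥0,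
    dist z a ≤ (t : ℝ) * dist z b → dist (u z) (u a) ≤ (η t : ℝ) * dist (u z) (u b)

/-- A metric space is linearly locally connected. -/
def LinearlyLocallyConnected (X : Type*) [MetricSpace X] : Prop :=
  ∃ lam : ℝ, 1 ≤ lam ∧ ∀ (x : X) (r : ℝ), 0 < r →
    (∀ y ∈ Metric.ball x r, ∀ z ∈ Metric.ball x r, ∃ C : Set X, IsCompact C ∧ IsConnected C ∧
      y ∈ C ∧ z ∈ C ∧ C ⊆ Metric.ball x (lam * r)) ∧
    (∀ y ∉ Metric.ball x r, ∀ z ∉ Metric.ball x r, ∃ C : Set X, IsCompact C ∧ IsConnected C ∧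
      y ∈ C ∧ z ∈ C ∧ C ⊆ (Metric.ball x (r / lam))ᶜ)

/-- A subset `S` is `2`-rectifiable: up to an `H²`-null set, `S` is covered by countably many
Lipschitz images of subsets of `ℝ²`. -/
def Is2Rectifiable {X : Type*} [MetricSpace X] [MeasurableSpace X] [BorelSpace X]
    (S : Set X) : Prop :=
  ∃ (A : ℕ → Set E2) (f : ℕ → E2 → X), (∀ n, ∃ K : ℝ≥0, LipschitzOnWith K (f n) (A n)) ∧
    μH[2] (S \ ⋃ n, f n '' A n) = 0

/-- The boundary circle `∂X` of a space homeomorphic to the closed disc. -/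
def discBoundary {X : Type*} [TopologicalSpace X] (φ : ↥unitClosedDisc ≃ₜ X) : Set X :=
  {x : X | ((φ.symm x : ↥unitClosedDisc) : E2) ∈ unitCircle}

/-- `f` is biLipschitz on `S`. -/
def BiLipschitzOn {A X : Type*} [PseudoMetricSpace A] [PseudoMetricSpace X]
    (f : A → X) (S : Set A) : Prop :=
  ∃ K : ℝ≥0, 0 < K ∧ ∀ v ∈ S, ∀ w ∈ S,
    (K : ℝ)⁻¹ * dist v w ≤ dist (f v) (f w) ∧ dist (f v) (f w) ≤ (K : ℝ) * dist v w

/-- A biLipschitz curve: the image of a biLipschitz embedding of `S¹` or of an interval. -/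
def IsBiLipschitzCurve {X : Type*} [MetricSpace X] (T : Set X) : Prop :=
  (∃ f : E2 → X, BiLipschitzOn f unitCircle ∧ f '' unitCircle = T) ∨
  (∃ f : ℝ → X, BiLipschitzOn f (Set.Icc 0 1) ∧ f '' Set.Icc 0 1 = T)

/-- `T` is a Jordan arc intersecting the set `B` exactly at its two endpoints. -/
def IsJordanArcMeetingBoundaryAtEndpoints {X : Type*} [TopologicalSpace X] (T B : Set X) : Prop :=
  ∃ h : ↥(Set.Icc (0:ℝ) 1) ≃ₜ ↥T,
    T ∩ B = {((h ⟨0, Set.mem_Icc.mpr (by norm_num)⟩ : ↥T) : X),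
             ((h ⟨1, Set.mem_Icc.mpr (by norm_num)⟩ : ↥T) : X)}

/-- `c` is a continuous-representative-of-trace of `u` on the convex domain `W`, with respect to
radial approach from an interior point `p`. -/
def IsTraceRepOn {X : Type*} [MetricSpace X] (u c : E2 → X) (W : Set E2) (p : E2) : Prop :=
  ∀ᵐ w ∂((μH[1] : Measure E2).restrict (frontier W)),
    Filter.Tendsto (fun t : ℝ => u ((1 - t) • p + t • w)) (𝓝[<] (1:ℝ)) (𝓝 (c w))

/-- The induced length (inner) distance of a metric space. -/
def lengthDist {X : Type*} [MetricSpace X] (x y : X) : ℝ≥0∞ :=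
  ⨅ (γ : MCurve X) (_ : γ.toFun γ.a = x ∧ γ.toFun γ.b = y), γ.length

/-- An injective metric space: `1`-Lipschitz maps into it extend from subsets. -/
def IsInjectiveMetricSpace (E : Type*) [MetricSpace E] : Prop :=
  ∀ (Z : Type) [MetricSpace Z], ∀ (Y : Set Z) (f : ↥Y → E), LipschitzWith 1 f →
    ∃ F : Z → E, LipschitzWith 1 F ∧ ∀ y : ↥Y, F (y : Z) = f y

section Construction

open Metric MeasureTheory Set Filter Topology ENNReal NNReal

theorem seminorm_e2_continuous (s : Seminorm ℝ E2) : Continuous s := by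
  set C : ℝ := s (EuclideanSpace.single 0 1) + s (EuclideanSpace.single 1 1) with hC
  have hC0 : 0 ≤ C := add_nonneg (apply_nonneg s _) (apply_nonneg s _)
  have hb : ∀ v : E2, s v ≤ C * ‖v‖ := by
    intro v
    have hv : v = v 0 • EuclideanSpace.single (0 : Fin 2) (1 : ℝ)
        + v 1 • EuclideanSpace.single (1 : Fin 2) (1 : ℝ) := by
      ext i; fin_cases i <;> simp
    have h0 : |v 0| ≤ ‖v‖ := by simpa using PiLp.norm_apply_le v 0
    have h1 : |v 1| ≤ ‖v‖ := by simpa using PiLp.norm_apply_le v 1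
    calc s v ≤ s (v 0 • EuclideanSpace.single (0 : Fin 2) (1 : ℝ))
          + s (v 1 • EuclideanSpace.single (1 : Fin 2) (1 : ℝ)) := by
            conv_lhs => rw [hv]
            exact map_add_le_add s _ _
      _ = |v 0| * s (EuclideanSpace.single 0 1) + |v 1| * s (EuclideanSpace.single 1 1) := by
            rw [map_smul_eq_mul, map_smul_eq_mul]; simp
      _ ≤ ‖v‖ * s (EuclideanSpace.single 0 1) + ‖v‖ * s (EuclideanSpace.single 1 1) := by
            gcongr
      _ = C * ‖v‖ := by rw [hC]; ring
  apply Seminorm.continuous (r := 1)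
  refine Filter.mem_of_superset
    (Metric.ball_mem_nhds (0 : E2) (inv_pos.2 (by linarith : 0 < C + 1))) ?_
  intro v hv
  rw [Seminorm.mem_ball_zero]
  rw [mem_ball_zero_iff] at hv
  have : (C + 1) * ‖v‖ < 1 := by
    have := mul_lt_mul_of_pos_left hv (by linarith : 0 < C + 1)
    rwa [mul_inv_cancel₀ (by linarith)] at this
  nlinarith [hb v, norm_nonneg v]

/-- An approximate metric derivative is dominated by every continuous, positively homogeneous
first-order upper bound for the increments of the map. -/
theorem HasApproxMetricDeriv.le_of_eventually_le {Y : Type*} [MetricSpace Y] {u : E2 → Y} {z : E2}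
    {s : Seminorm ℝ E2} (hs : HasApproxMetricDeriv u z s) {a : E2 → ℝ} (ha : Continuous a)
    (hom : ∀ (c : ℝ) (w : E2), 0 ≤ c → a (c • w) = c * a w)
    (hle : ∀ η : ℝ, 0 < η → ∀ᶠ y in 𝓝 z, dist (u y) (u z) ≤ a (y - z) + η * ‖y - z‖) (w : E2) :
    s w ≤ a w := by
  by_contra! hlt
  have hw : w ≠ 0 := by
    rintro rfl
    have := hom 0 0 le_rfl
    simp at this
    simp [this] at hlt
  have hwn : 0 < ‖w‖ := norm_pos_iff.2 hw
  set η : ℝ := (s w - a w) / (8 * ‖w‖) with hη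
  have hη0 : 0 < η := by
    rw [hη]; apply div_pos (by linarith) (by positivity)
  have hcont : Continuous fun v => s v - a v - 2 * η * ‖v‖ :=
    (((seminorm_e2_continuous s).sub ha).sub (continuous_const.mul continuous_norm))
  have hpos : 0 < s w - a w - 2 * η * ‖w‖ := by
    have : η * ‖w‖ = (s w - a w) / 8 := by rw [hη]; field_simp
    nlinarith
  obtain ⟨ρ, hρ, hball⟩ := Metric.eventually_nhds_iff_ball.1
    (hcont.continuousAt.eventually (lt_mem_nhds hpos) : ∀ᶠ v in 𝓝 w, 0 < s v - a v - 2 * η * ‖v‖)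
  obtain ⟨r₀, hr₀, hle'⟩ := Metric.eventually_nhds_iff_ball.1 (hle η hη0)
  set q : ℝ := ρ / (‖w‖ + ρ) with hq
  have hq0 : 0 < q := by positivity
  have hden : 0 < ‖w‖ + ρ := by positivity
  have key : ∀ r : ℝ, 0 < r → r < r₀ → ENNReal.ofReal (q ^ 2) ≤
      volume {y | y ∈ ball z r ∧ η * ‖y - z‖ ≤ |dist (u y) (u z) - s (y - z)|} /
        volume (ball z r) := by
    intro r hr hrr
    set t : ℝ := r / (‖w‖ + ρ) with ht
    have ht0 : 0 < t := by positivity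
    have htr : t * (‖w‖ + ρ) = r := by rw [ht]; field_simp
    have hsub : ball (z + t • w) (t * ρ) ⊆
        {y | y ∈ ball z r ∧ η * ‖y - z‖ ≤ |dist (u y) (u z) - s (y - z)|} := by
      intro y hy
      set v : E2 := t⁻¹ • (y - z) with hv
      have hyv : y - z = t • v := by rw [hv, smul_smul, mul_inv_cancel₀ ht0.ne', one_smul]
      have hvb : v ∈ ball w ρ := by
        rw [mem_ball, dist_eq_norm] at hy ⊢
        have h1 : y - (z + t • w) = t • (v - w) := by
          rw [smul_sub, ← hyv]; abel
        rw [h1, norm_smul, Real.norm_of_nonneg ht0.le] at hy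
        exact lt_of_mul_lt_mul_left hy ht0.le
      have h2 := hball v hvb
      have hvn : ‖v‖ < ‖w‖ + ρ := by
        rw [mem_ball, dist_eq_norm] at hvb
        have : ‖v‖ ≤ ‖w‖ + ‖v - w‖ := by
          simpa using norm_add_le w (v - w)
        linarith
      have hyb : y ∈ ball z r := by
        rw [mem_ball, dist_eq_norm, hyv, norm_smul, Real.norm_of_nonneg ht0.le, ← htr]
        exact mul_lt_mul_of_pos_left hvn ht0
      refine ⟨hyb, ?_⟩
      have h3 := hle' y (ball_subset_ball hrr.le hyb)
      have h4 : s (y - z) = t * s v := by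
        rw [hyv, map_smul_eq_mul, Real.norm_of_nonneg ht0.le]
      have h5 : a (y - z) = t * a v := by rw [hyv, hom _ _ ht0.le]
      have h6 : ‖y - z‖ = t * ‖v‖ := by rw [hyv, norm_smul, Real.norm_of_nonneg ht0.le]
      rw [h5] at h3
      rw [abs_sub_comm]
      refine le_trans ?_ (le_abs_self _)
      rw [h4]
      have : 0 < t * (s v - a v - 2 * η * ‖v‖) := mul_pos ht0 h2
      rw [h6] at h3 ⊢
      nlinarith
    have hb0 : volume (ball z r) ≠ 0 := (measure_ball_pos _ _ hr).ne'
    have hb1 : volume (ball z r) ≠ ⊤ := measure_ball_lt_top.ne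
    rw [ENNReal.le_div_iff_mul_le (Or.inl hb0) (Or.inl hb1)]
    refine le_trans (le_of_eq ?_) (measure_mono hsub)
    rw [EuclideanSpace.volume_ball_fin_two, EuclideanSpace.volume_ball_fin_two, ← mul_assoc,
      ← ENNReal.ofReal_pow hr.le, ← ENNReal.ofReal_pow (by positivity),
      ← ENNReal.ofReal_mul (by positivity)]
    congr 2
    rw [hq, ht]; field_simp
  have hlim := hs η hη0
  have h0 : (0 : ℝ≥0∞) < ENNReal.ofReal (q ^ 2) := ENNReal.ofReal_pos.2 (by positivity)
  have hev := hlim.eventually (gt_mem_nhds h0)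
  have hev2 : ∀ᶠ r in 𝓝[>] (0 : ℝ), r ∈ Ioo 0 r₀ := Ioo_mem_nhdsGT hr₀
  obtain ⟨r, hr1, hr2⟩ := (hev.and hev2).exists
  exact absurd (key r hr2.1 hr2.2) (not_le.2 hr1)

theorem seminormJacobian_le_det (s : Seminorm ℝ E2) (L : E2 →L[ℝ] E2)
    (h : ∀ w, s w ≤ |L w 0| + |L w 1|) : seminormJacobian s ≤ 4 * ENNReal.ofReal |L.det| := by
  unfold seminormJacobian
  split_ifs with hif
  · exact zero_le
  have hdet : LinearMap.det (L : E2 →ₗ[ℝ] E2) ≠ 0 := by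
    intro h0
    apply hif
    obtain ⟨v, hv, hv0⟩ := SetLike.exists_of_lt (LinearMap.bot_lt_ker_of_det_eq_zero h0)
    refine ⟨v, fun h => hv0 (by simp [h]), le_antisymm ?_ (apply_nonneg s v)⟩
    have hL : L v = 0 := by simpa using hv
    simpa [hL] using h v
  have hsub : L ⁻¹' (ball 0 (1 / 2)) ⊆ {v | s v ≤ 1} := by
    intro v hv
    rw [mem_preimage, mem_ball_zero_iff] at hv
    have h0 : |L v 0| ≤ ‖L v‖ := by simpa using PiLp.norm_apply_le (L v) 0
    have h1 : |L v 1| ≤ ‖L v‖ := by simpa using PiLp.norm_apply_le (L v) 1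
    have := h v
    simp only [mem_ofPred_eq]
    linarith
  have hvol := measure_mono (μ := (volume : Measure E2)) hsub
  rw [Measure.addHaar_preimage_continuousLinearMap _ hdet,
    EuclideanSpace.volume_ball_fin_two] at hvol
  have hd : 0 < |L.det| := abs_pos.2 hdet
  have e : ENNReal.ofReal |(LinearMap.det (L : E2 →ₗ[ℝ] E2))⁻¹|
      * (ENNReal.ofReal (1 / 2) ^ 2 * ENNReal.ofReal Real.pi)
      = ENNReal.ofReal (|L.det|⁻¹ * ((1 / 4) * Real.pi)) := by
    rw [← ENNReal.ofReal_pow (by norm_num), ← ENNReal.ofReal_mul (by positivity),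
      ← ENNReal.ofReal_mul (by positivity), abs_inv]
    norm_num
  rw [e] at hvol
  calc ENNReal.ofReal Real.pi / volume {v | s v ≤ 1}
      ≤ ENNReal.ofReal Real.pi / ENNReal.ofReal (|L.det|⁻¹ * ((1 / 4) * Real.pi)) :=
        ENNReal.div_le_div_left hvol _
    _ = ENNReal.ofReal (4 * |L.det|) := by
        rw [← ENNReal.ofReal_div_of_pos (by positivity)]
        congr 1
        field_simp
    _ = 4 * ENNReal.ofReal |L.det| := by
        rw [ENNReal.ofReal_mul (by norm_num)]; norm_num

/-- An area bound by change of variables: the increments of `v` are controlled by those of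
`W ∘ H`, where `H` is Lipschitz and injective and `W` has linear local upper bounds. -/
theorem parametrizedArea_le_lintegral {Y B : Type*} [MetricSpace Y] [MetricSpace B] {v : E2 → Y}
    {W : E2 → B} {H : E2 → E2} {K : ℝ≥0} (hH : LipschitzWith K H) (hinj : InjOn H unitDisc)
    {S : Set E2} (hS : MapsTo H unitDisc S)
    (hv : ∀ y z, dist (v y) (v z) ≤ dist (W (H y)) (W (H z))) {G : E2 → ℝ≥0∞}
    (hG : ∀ z ∈ S, ∃ L : E2 →L[ℝ] E2,
      (∀ᶠ y in 𝓝 z, dist (W y) (W z) ≤ |L (y - z) 0| + |L (y - z) 1|) ∧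
        ENNReal.ofReal |L.det| ≤ G z) :
    parametrizedArea v ≤ 4 * ∫⁻ z in S, G z := by
  set s : Set E2 := unitDisc ∩ {z | DifferentiableAt ℝ H z} with hs
  have hsm : MeasurableSet s := measurableSet_ball.inter (measurableSet_of_differentiableAt ℝ H)
  have hae : (s : Set E2) =ᵐ[volume] unitDisc := by
    rw [hs]
    exact inter_ae_eq_left_of_ae_eq_univ
      (eventuallyEq_univ.2 (hH.ae_differentiableAt (μ := (volume : Measure E2))))
  have hpt : ∀ z ∈ s, (⨆ (p : Seminorm ℝ E2) (_ : HasApproxMetricDeriv v z p), seminormJacobian p)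
      ≤ 4 * (ENNReal.ofReal |(fderiv ℝ H z).det| * G (H z)) := by
    intro z hz
    obtain ⟨L, hL, hLG⟩ := hG (H z) (hS hz.1)
    set A := fderiv ℝ H z with hA
    have hd : HasFDerivAt H A z := hz.2.hasFDerivAt
    refine iSup₂_le fun p hp => ?_
    have hb : ∀ w, p w ≤ |(L.comp A) w 0| + |(L.comp A) w 1| := by
      intro w
      refine hp.le_of_eventually_le (a := fun w => |(L.comp A) w 0| + |(L.comp A) w 1|)
        (by fun_prop) ?_ ?_ w
      · intro c w hc
        simp [abs_mul, abs_of_nonneg hc, mul_add]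
      · intro η hη
        have hcont : Tendsto H (𝓝 z) (𝓝 (H z)) := hH.continuous.continuousAt
        have h1 := hcont.eventually hL
        have h2 := hd.isLittleO.bound (c := η / (2 * (‖L‖ + 1))) (by positivity)
        filter_upwards [h1, h2] with y hy1 hy2
        refine (hv y z).trans (hy1.trans ?_)
        set e : E2 := H y - H z - A (y - z) with he
        have hsplit : H y - H z = A (y - z) + e := by rw [he]; abel
        have h3 : L (H y - H z) = L (A (y - z)) + L e := by rw [hsplit, map_add]
        have h4 : ‖L e‖ ≤ η / 2 * ‖y - z‖ := by
          calc ‖L e‖ ≤ ‖L‖ * ‖e‖ := L.le_opNorm e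
            _ ≤ (‖L‖ + 1) * (η / (2 * (‖L‖ + 1)) * ‖y - z‖) := by
                gcongr
                linarith
            _ = η / 2 * ‖y - z‖ := by field_simp
        have h5 : |L e 0| ≤ ‖L e‖ := by simpa using PiLp.norm_apply_le (L e) 0
        have h6 : |L e 1| ≤ ‖L e‖ := by simpa using PiLp.norm_apply_le (L e) 1
        rw [h3]
        have h7 := abs_add_le (L (A (y - z)) 0) (L e 0)
        have h8 := abs_add_le (L (A (y - z)) 1) (L e 1)
        simp only [PiLp.add_apply, ContinuousLinearMap.comp_apply]
        linarith
    refine (seminormJacobian_le_det p _ hb).trans ?_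
    gcongr
    have hdet : (L.comp A).det = L.det * A.det := by
      simp [ContinuousLinearMap.det, LinearMap.det_comp]
    rw [hdet, abs_mul, ENNReal.ofReal_mul (abs_nonneg _), mul_comm]
    gcongr
  calc parametrizedArea v
      = ∫⁻ z in s, ⨆ (p : Seminorm ℝ E2) (_ : HasApproxMetricDeriv v z p), seminormJacobian p := by
        rw [parametrizedArea, Measure.restrict_congr_set hae]
    _ ≤ ∫⁻ z in s, 4 * (ENNReal.ofReal |(fderiv ℝ H z).det| * G (H z)) :=
        setLIntegral_mono' hsm hpt
    _ = 4 * ∫⁻ z in s, ENNReal.ofReal |(fderiv ℝ H z).det| * G (H z) :=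
        lintegral_const_mul' _ _ (by norm_num)
    _ = 4 * ∫⁻ z in H '' s, G z := by
        rw [lintegral_image_eq_lintegral_abs_det_fderiv_mul volume hsm
          (fun x hx => hx.2.hasFDerivAt.hasFDerivWithinAt) (hinj.mono inter_subset_left)]
    _ ≤ 4 * ∫⁻ z in S, G z := by
        gcongr
        rintro _ ⟨x, hx, rfl⟩
        exact hS hx.1

/-- The sup norm on the plane. -/
def supN (z : E2) : ℝ := max |z 0| |z 1|

/-- A function comparable to the Euclidean norm, with the same Lipschitz constant. -/
structure NormLike (N : E2 → ℝ) : Prop where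
  lip : ∀ z w, |N z - N w| ≤ ‖z - w‖
  le : ∀ z, N z ≤ ‖z‖
  ge : ∀ z, ‖z‖ ≤ 2 * N z
  hom : ∀ (c : ℝ) z, 0 ≤ c → N (c • z) = c * N z

theorem normLike_norm : NormLike fun z => ‖z‖ where
  lip z w := abs_norm_sub_norm_le z w
  le z := le_rfl
  ge z := by linarith [norm_nonneg z]
  hom c z hc := by rw [norm_smul, Real.norm_of_nonneg hc]

theorem abs_apply_le_norm (z : E2) (i : Fin 2) : |z i| ≤ ‖z‖ := by
  simpa using PiLp.norm_apply_le z i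

theorem norm_le_abs_add_abs (z : E2) : ‖z‖ ≤ |z 0| + |z 1| := by
  rw [EuclideanSpace.norm_eq, Fin.sum_univ_two]
  apply Real.sqrt_le_iff.2 ⟨by positivity, ?_⟩
  simp only [Real.norm_eq_abs]
  nlinarith [mul_nonneg (abs_nonneg (z 0)) (abs_nonneg (z 1))]

theorem supN_le {z : E2} {r : ℝ} : supN z ≤ r ↔ |z 0| ≤ r ∧ |z 1| ≤ r := max_le_iff

theorem abs_apply_le_supN (z : E2) (i : Fin 2) : |z i| ≤ supN z := by
  fin_cases i
  · exact le_max_left _ _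
  · exact le_max_right _ _

theorem normLike_supN : NormLike supN where
  lip z w := by
    refine (abs_max_sub_max_le_max _ _ _ _).trans (max_le ?_ ?_)
    · exact (abs_abs_sub_abs_le_abs_sub _ _).trans (abs_apply_le_norm (z - w) 0)
    · exact (abs_abs_sub_abs_le_abs_sub _ _).trans (abs_apply_le_norm (z - w) 1)
  le z := max_le (abs_apply_le_norm z 0) (abs_apply_le_norm z 1)
  ge z := by
    have := norm_le_abs_add_abs z
    have h0 := abs_apply_le_supN z 0
    have h1 := abs_apply_le_supN z 1
    linarith
  hom c z hc := by
    simp only [supN, PiLp.smul_apply, smul_eq_mul, abs_mul, abs_of_nonneg hc]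
    exact (mul_max_of_nonneg _ _ hc).symm

/-- The radial map carrying the level sets of `N₂` to those of `N₁`. -/
def radialMap (N₁ N₂ : E2 → ℝ) (z : E2) : E2 := (N₁ z / N₂ z) • z

namespace NormLike
variable {N₁ N₂ : E2 → ℝ}

theorem nonneg (h : NormLike N₁) (z : E2) : 0 ≤ N₁ z := by
  have := h.ge z
  linarith [norm_nonneg z]

theorem pos (h : NormLike N₁) {z : E2} (hz : z ≠ 0) : 0 < N₁ z := by
  have := h.ge z
  linarith [norm_pos_iff.2 hz]

theorem map_zero (h : NormLike N₁) : N₁ 0 = 0 := by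
  have := h.le 0
  have := h.nonneg 0
  simp at *
  linarith

theorem div_le (h₁ : NormLike N₁) (h₂ : NormLike N₂) (z : E2) : N₁ z / N₂ z ≤ 2 := by
  apply div_le_of_le_mul₀ (h₂.nonneg z) (by norm_num)
  linarith [h₁.le z, h₂.ge z]

theorem radialMap_apply_radialMap (h₁ : NormLike N₁) (h₂ : NormLike N₂) (z : E2) :
    radialMap N₂ N₁ (radialMap N₁ N₂ z) = z := by
  by_cases hz : z = 0
  · simp [radialMap, hz]
  have p₁ := h₁.pos hz
  have p₂ := h₂.pos hz
  simp only [radialMap]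
  rw [h₁.hom _ _ (by positivity), h₂.hom _ _ (by positivity), smul_smul]
  have : N₁ z / N₂ z * N₂ z / (N₁ z / N₂ z * N₁ z) * (N₁ z / N₂ z) = 1 := by field_simp
  rw [this, one_smul]

theorem apply_radialMap (h₁ : NormLike N₁) (h₂ : NormLike N₂) (z : E2) :
    N₂ (radialMap N₁ N₂ z) = N₁ z := by
  by_cases hz : z = 0
  · simp [radialMap, hz, h₁.map_zero, h₂.map_zero]
  have p₁ := h₁.pos hz
  have p₂ := h₂.pos hz
  simp only [radialMap]
  rw [h₂.hom _ _ (by positivity)]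
  field_simp

theorem lipschitz_radialMap (h₁ : NormLike N₁) (h₂ : NormLike N₂) :
    LipschitzWith 8 (radialMap N₁ N₂) := by
  have key : ∀ z w : E2, ‖w‖ ≤ ‖z‖ → ‖radialMap N₁ N₂ z - radialMap N₁ N₂ w‖ ≤ 8 * ‖z - w‖ := by
    intro z w hwz
    by_cases hz : z = 0
    · have hw : w = 0 := by simpa [hz] using hwz
      simp [hz, hw]
    have hdz : 0 ≤ N₁ z / N₂ z := div_nonneg (h₁.nonneg z) (h₂.nonneg z)
    by_cases hw : w = 0
    · simp only [radialMap, hw, smul_zero, sub_zero, norm_smul, Real.norm_of_nonneg hdz]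
      nlinarith [h₁.div_le h₂ z, norm_nonneg z]
    have p₁ := h₁.pos hz
    have p₂ := h₂.pos hz
    have r₁ := h₁.pos hw
    have r₂ := h₂.pos hw
    have e : radialMap N₁ N₂ z - radialMap N₁ N₂ w
        = (N₁ z / N₂ z) • (z - w) + (N₁ z / N₂ z - N₁ w / N₂ w) • w := by
      simp only [radialMap]; module
    have hq : |N₁ z / N₂ z - N₁ w / N₂ w| ≤ 3 * ‖z - w‖ / N₂ z := by
      have : N₁ z / N₂ z - N₁ w / N₂ w
          = ((N₁ z - N₁ w) + (N₁ w / N₂ w) * (N₂ w - N₂ z)) / N₂ z := by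
        field_simp; ring
      rw [this, abs_div, abs_of_pos p₂]
      gcongr
      refine (abs_add_le _ _).trans ?_
      rw [abs_mul, abs_of_nonneg (div_nonneg r₁.le r₂.le)]
      have a1 := h₁.lip z w
      have a2 := h₂.lip w z
      rw [norm_sub_rev] at a2
      have a3 := mul_le_mul (h₁.div_le h₂ w) a2 (abs_nonneg _) (by norm_num)
      linarith
    rw [e]
    refine (norm_add_le _ _).trans ?_
    rw [norm_smul, norm_smul, Real.norm_of_nonneg hdz, Real.norm_eq_abs]
    have b1 : N₁ z / N₂ z * ‖z - w‖ ≤ 2 * ‖z - w‖ := by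
      gcongr; exact h₁.div_le h₂ z
    have b2 : |N₁ z / N₂ z - N₁ w / N₂ w| * ‖w‖ ≤ 6 * ‖z - w‖ := by
      calc |N₁ z / N₂ z - N₁ w / N₂ w| * ‖w‖ ≤ 3 * ‖z - w‖ / N₂ z * (2 * N₂ z) := by
            gcongr
            exact hwz.trans (h₂.ge z)
        _ = 6 * ‖z - w‖ := by field_simp; ring
    linarith
  refine LipschitzWith.of_dist_le_mul fun z w => ?_
  rw [dist_eq_norm, dist_eq_norm]
  rcases le_total ‖w‖ ‖z‖ with h | h
  · exact key z w h
  · rw [norm_sub_rev, norm_sub_rev z w]; exact key w z h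

end NormLike

section Combinatorics
open scoped Classical in
/-- If every closed `ZMod 2`-cochain is exact and the color classes are connected, then the number
of bichromatic edges exceeds the number of non-monochromatic triangles by at most the number of
colors. -/
theorem card_bichromatic_le {V E T : Type*} [Fintype E] [Fintype T] (src tgt : E → V)
    (e₁ e₂ e₃ : T → E)
    (hexact : ∀ ω : E → ZMod 2, (∀ t, ω (e₁ t) + ω (e₂ t) + ω (e₃ t) = 0) →
      ∃ g : V → ZMod 2, ∀ e, ω e = g (src e) + g (tgt e))
    {N : ℕ} (col : V → Fin N)
    (hcol : ∀ g : V → ZMod 2, (∀ e, col (src e) = col (tgt e) → g (src e) = g (tgt e)) →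
      ∃ g' : Fin N → ZMod 2, ∀ e, g (src e) = g' (col (src e)) ∧ g (tgt e) = g' (col (tgt e))) :
    (Finset.univ.filter fun e => col (src e) ≠ col (tgt e)).card ≤ N +
      (Finset.univ.filter fun t => ¬ (col (src (e₁ t)) = col (tgt (e₁ t)) ∧
        col (src (e₂ t)) = col (tgt (e₂ t)) ∧ col (src (e₃ t)) = col (tgt (e₃ t)))).card := by
  set P : E → Prop := fun e => col (src e) ≠ col (tgt e) with hP
  set Q : T → Prop := fun t => ¬ (col (src (e₁ t)) = col (tgt (e₁ t)) ∧
        col (src (e₂ t)) = col (tgt (e₂ t)) ∧ col (src (e₃ t)) = col (tgt (e₃ t))) with hQ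
  let ext : ({e // P e} → ZMod 2) →ₗ[ZMod 2] (E → ZMod 2) :=
    { toFun := fun ω e => if h : P e then ω ⟨e, h⟩ else 0
      map_add' := fun x y => by ext e; simp only [Pi.add_apply]; split_ifs <;> simp
      map_smul' := fun r x => by
        ext e; simp only [Pi.smul_apply, RingHom.id_apply]; split_ifs <;> simp }
  let D : ({e // P e} → ZMod 2) →ₗ[ZMod 2] ({t // Q t} → ZMod 2) :=
    { toFun := fun ω t => ext ω (e₁ t) + ext ω (e₂ t) + ext ω (e₃ t)
      map_add' := fun x y => by ext t; simp only [map_add, Pi.add_apply]; ring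
      map_smul' := fun r x => by
        ext t; simp only [map_smul, Pi.smul_apply, RingHom.id_apply, smul_eq_mul]; ring }
  let R : (Fin N → ZMod 2) →ₗ[ZMod 2] ({e // P e} → ZMod 2) :=
    { toFun := fun g e => g (col (src e)) + g (col (tgt e))
      map_add' := fun x y => by ext t; simp only [Pi.add_apply]; ring
      map_smul' := fun r x => by
        ext t; simp only [Pi.smul_apply, RingHom.id_apply, smul_eq_mul]; ring }
  have hext : ∀ ω (e : {e // P e}), ext ω e = ω e := fun ω e => dif_pos e.2
  have hext0 : ∀ ω e, ¬ P e → ext ω e = 0 := fun ω e he => dif_neg he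
  have hker : LinearMap.ker D ≤ LinearMap.range R := by
    intro ω hω
    have hω' : ∀ t : {t // Q t}, ext ω (e₁ t) + ext ω (e₂ t) + ext ω (e₃ t) = 0 := fun t =>
      congrFun (LinearMap.mem_ker.1 hω) t
    obtain ⟨g, hg⟩ := hexact (ext ω) (fun t => by
      by_cases ht : Q t
      · exact hω' ⟨t, ht⟩
      · simp only [hQ, not_not] at ht
        rw [hext0 _ _ (not_not.2 ht.1), hext0 _ _ (not_not.2 ht.2.1),
          hext0 _ _ (not_not.2 ht.2.2)]
        simp)
    obtain ⟨g', hg'⟩ := hcol g (fun e he => by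
      have h1 := hg e
      rw [hext0 _ _ (not_not.2 he)] at h1
      exact (CharTwo.add_eq_zero).1 h1.symm)
    refine ⟨g', ?_⟩
    ext e
    change g' (col (src e)) + g' (col (tgt e)) = ω e
    rw [← hext ω e, hg, (hg' e).1, (hg' e).2]
  have h1 := LinearMap.finrank_range_add_finrank_ker D
  have h2 : Module.finrank (ZMod 2) (LinearMap.range D) ≤ Fintype.card {t // Q t} := by
    simpa using (LinearMap.range D).finrank_le
  have h3 : Module.finrank (ZMod 2) (LinearMap.ker D) ≤ N := by
    refine (Submodule.finrank_mono hker).trans ((LinearMap.finrank_range_le R).trans ?_)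
    simp
  rw [Module.finrank_fintype_fun_eq_card] at h1
  have e1 : Fintype.card {e // P e} = (Finset.univ.filter P).card := by
    convert Fintype.card_subtype P
  have e2 : Fintype.card {t // Q t} = (Finset.univ.filter Q).card := by
    convert Fintype.card_subtype Q
  have e3 : (Finset.univ.filter P).card ≤ N + (Finset.univ.filter Q).card := by omega
  convert e3

/-- The number of ways to see three distinct colors. -/
def trichromatic {α : Type*} [DecidableEq α] (a b c : α) : ℕ :=
  if a ≠ b ∧ b ≠ c ∧ a ≠ c then 1 else 0

/-- The indicator of two distinct colors. -/
def bichromatic {α : Type*} [DecidableEq α] (a b : α) : ℕ := if a ≠ b then 1 else 0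

/-- Edges of the triangulated `m × m` grid: horizontal, vertical and diagonal ones. -/
abbrev GridEdge (m : ℕ) : Type :=
  (Fin m × Fin (m + 1)) ⊕ (Fin (m + 1) × Fin m) ⊕ (Fin m × Fin m)

namespace GridEdge
variable {m : ℕ}

/-- The initial vertex of a grid edge. -/
def src : GridEdge m → ℕ × ℕ
  | .inl p => (p.1, p.2)
  | .inr (.inl p) => (p.1, p.2)
  | .inr (.inr p) => (p.1, p.2)

/-- The terminal vertex of a grid edge. -/
def tgt : GridEdge m → ℕ × ℕ
  | .inl p => (p.1 + 1, p.2)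
  | .inr (.inl p) => (p.1, p.2 + 1)
  | .inr (.inr p) => (p.1 + 1, p.2 + 1)

/-- The horizontal edge of the lower or upper triangle of a grid square. -/
def horizontal (t : (Fin m × Fin m) × Bool) : GridEdge m :=
  .inl (t.1.1, if t.2 then t.1.2.succ else t.1.2.castSucc)

/-- The vertical edge of the upper or lower triangle of a grid square. -/
def vertical (t : (Fin m × Fin m) × Bool) : GridEdge m :=
  .inr (.inl (if t.2 then t.1.1.castSucc else t.1.1.succ, t.1.2))

/-- The diagonal of a grid square. -/
def diagonal (t : (Fin m × Fin m) × Bool) : GridEdge m := .inr (.inr t.1)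

theorem exact (ω : GridEdge m → ZMod 2)
    (hω : ∀ t, ω (horizontal t) + ω (vertical t) + ω (diagonal t) = 0) :
    ∃ g : ℕ × ℕ → ZMod 2, ∀ e, ω e = g (src e) + g (tgt e) := by
  let h : ℕ → ℕ → ZMod 2 := fun i j =>
    if H : i < m ∧ j < m + 1 then ω (.inl (⟨i, H.1⟩, ⟨j, H.2⟩)) else 0
  let v : ℕ → ℕ → ZMod 2 := fun i j =>
    if H : i < m + 1 ∧ j < m then ω (.inr (.inl (⟨i, H.1⟩, ⟨j, H.2⟩))) else 0
  let d : ℕ → ℕ → ZMod 2 := fun i j =>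
    if H : i < m ∧ j < m then ω (.inr (.inr (⟨i, H.1⟩, ⟨j, H.2⟩))) else 0
  have lower : ∀ i j, i < m → j < m → h i j + v (i + 1) j + d i j = 0 := by
    intro i j hi hj
    have := hω ((⟨i, hi⟩, ⟨j, hj⟩), false)
    simp only [h, v, d, hi, hj, Nat.lt_succ_of_lt hj, Nat.succ_lt_succ hi, and_self, dite_true]
    exact this
  have upper : ∀ i j, i < m → j < m → h i (j + 1) + v i j + d i j = 0 := by
    intro i j hi hj
    have := hω ((⟨i, hi⟩, ⟨j, hj⟩), true)
    simp only [h, v, d, hi, hj, Nat.lt_succ_of_lt hi, Nat.succ_lt_succ hj, and_self, dite_true]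
    exact this
  have two : (2 : ZMod 2) = 0 := rfl
  obtain ⟨g, gv, g0⟩ : ∃ g : ℕ → ℕ → ZMod 2, (∀ i j, v i j = g i j + g i (j + 1)) ∧
      ∀ i, h i 0 = g i 0 + g (i + 1) 0 := by
    refine ⟨fun i j => ∑ k ∈ Finset.range i, h k 0 + ∑ k ∈ Finset.range j, v i k, ?_, ?_⟩
    · intro i j
      simp only [Finset.sum_range_succ]
      linear_combination
        -(∑ k ∈ Finset.range i, h k 0 + ∑ k ∈ Finset.range j, v i k) * two
    · intro i
      simp only [Finset.sum_range_succ, Finset.sum_range_zero, add_zero]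
      linear_combination -(∑ k ∈ Finset.range i, h k 0) * two
  have gh : ∀ j i, i < m → j < m + 1 → h i j = g i j + g (i + 1) j := by
    intro j
    induction j with
    | zero =>
      exact fun i _ _ => g0 i
    | succ j ih =>
      intro i hi hj
      have hj' : j < m := by omega
      have h1 := ih i hi (by omega)
      have h2 := gv i j
      have h3 := gv (i + 1) j
      have h4 := lower i j hi hj'
      have h5 := upper i j hi hj'
      linear_combination h5 - h4 + h1 + h3 - h2 + (g (i + 1) j - g i (j + 1)) * two
  refine ⟨fun p => g p.1 p.2, ?_⟩
  rintro (⟨⟨i, hi⟩, ⟨j, hj⟩⟩ | ⟨⟨i, hi⟩, ⟨j, hj⟩⟩ | ⟨⟨i, hi⟩, ⟨j, hj⟩⟩)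
  · have := gh j i hi hj
    rwa [show h i j = _ from dif_pos ⟨hi, hj⟩] at this
  · have := gv i j
    rwa [show v i j = _ from dif_pos ⟨hi, hj⟩] at this
  · have h1 := lower i j hi hj
    have h2 := gh j i hi (by omega)
    have h3 := gv (i + 1) j
    have : d i j = g i j + g (i + 1) (j + 1) := by
      linear_combination h1 - h2 - h3 - (g i j + g (i + 1) j + g (i + 1) (j + 1)) * two
    rwa [show d i j = _ from dif_pos ⟨hi, hj⟩] at this

theorem exists_factor {N : ℕ} (col : ℕ × ℕ → Fin N) (g : ℕ × ℕ → ZMod 2)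
    (hcol : ∀ k, ∃ c, ∀ i j, i ≤ m → j ≤ m → col (i, j) = k → g (i, j) = c) :
    ∃ g' : Fin N → ZMod 2, ∀ e : GridEdge m,
      g (src e) = g' (col (src e)) ∧ g (tgt e) = g' (col (tgt e)) := by
  choose g' hg' using hcol
  refine ⟨g', ?_⟩
  rintro (⟨⟨i, hi⟩, ⟨j, hj⟩⟩ | ⟨⟨i, hi⟩, ⟨j, hj⟩⟩ | ⟨⟨i, hi⟩, ⟨j, hj⟩⟩) <;>
    exact ⟨hg' _ _ _ (by simp; omega) (by simp; omega) rfl,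
      hg' _ _ _ (by simp; omega) (by simp; omega) rfl⟩

end GridEdge

theorem trichromatic_add {α : Type*} [DecidableEq α] (a b d : α) :
    trichromatic a b d + 2 * (if ¬ (a = b ∧ b = d ∧ a = d) then 1 else 0)
      = bichromatic a b + bichromatic b d + bichromatic a d := by
  simp only [trichromatic, bichromatic]
  by_cases h1 : a = b
  · subst h1
    by_cases h3 : a = d <;> simp [h3]
  · by_cases h3 : a = d
    · subst h3
      simp [h1, Ne.symm h1]
    · by_cases h4 : b = d <;> simp [h1, h3, h4]

theorem trichromatic_add_trichromatic {α : Type*} [DecidableEq α] (a b c d : α) :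
    (trichromatic a b d + trichromatic a c d) +
      2 * ((if ¬ (c = d ∧ a = c ∧ a = d) then 1 else 0) +
        (if ¬ (a = b ∧ b = d ∧ a = d) then 1 else 0))
      = bichromatic a b + bichromatic c d + bichromatic a c + bichromatic b d
        + 2 * bichromatic a d := by
  have h1 := trichromatic_add a b d
  have h2 := trichromatic_add a c d
  have h3 : (if ¬ (c = d ∧ a = c ∧ a = d) then 1 else 0)
      = (if ¬ (a = c ∧ c = d ∧ a = d) then 1 else 0) := by
    simp only [and_left_comm]
  rw [h3]
  omega

/-- In a vertex coloring of the triangulated square grid with connected color classes, the numbers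
of trichromatic triangles and of bichromatic boundary edges are bounded in terms of the number of
colors alone. -/
theorem grid_trichromatic_add_boundary_le (m N : ℕ) (col : ℕ × ℕ → Fin N)
    (hcol : ∀ g : ℕ × ℕ → ZMod 2,
      (∀ i j, i < m → j ≤ m → col (i, j) = col (i + 1, j) → g (i, j) = g (i + 1, j)) →
      (∀ i j, i ≤ m → j < m → col (i, j) = col (i, j + 1) → g (i, j) = g (i, j + 1)) →
      ∀ k, ∃ c, ∀ i j, i ≤ m → j ≤ m → col (i, j) = k → g (i, j) = c) :
    ∑ i ∈ Finset.range m, ∑ j ∈ Finset.range m,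
      (trichromatic (col (i, j)) (col (i + 1, j)) (col (i + 1, j + 1)) +
        trichromatic (col (i, j)) (col (i, j + 1)) (col (i + 1, j + 1))) +
    ∑ i ∈ Finset.range m,
      (bichromatic (col (i, 0)) (col (i + 1, 0)) + bichromatic (col (i, m)) (col (i + 1, m)) +
        bichromatic (col (0, i)) (col (0, i + 1)) +
        bichromatic (col (m, i)) (col (m, i + 1))) ≤ 2 * N := by
  classical
  have main := card_bichromatic_le (GridEdge.src (m := m)) GridEdge.tgt GridEdge.horizontal
    GridEdge.vertical GridEdge.diagonal GridEdge.exact col (fun g hg =>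
      GridEdge.exists_factor col g (hcol g
        (fun i j hi hj => hg (.inl (⟨i, hi⟩, ⟨j, Nat.lt_succ_of_le hj⟩)))
        (fun i j hi hj => hg (.inr (.inl (⟨i, Nat.lt_succ_of_le hi⟩, ⟨j, hj⟩))))))
  rw [Finset.card_filter, Finset.card_filter] at main
  simp only [Fintype.sum_sum_type, Fintype.sum_prod_type, Fintype.sum_bool, GridEdge.src,
    GridEdge.tgt, GridEdge.horizontal, GridEdge.vertical, GridEdge.diagonal, if_true,
    Fin.val_succ, Fin.val_castSucc, Bool.false_eq_true, if_false] at main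
  set F : ℕ → ℕ → ℕ := fun i j => bichromatic (col (i, j)) (col (i + 1, j)) with hF
  set F' : ℕ → ℕ → ℕ := fun i j => bichromatic (col (i, j)) (col (i, j + 1)) with hF'
  set F'' : ℕ → ℕ → ℕ := fun i j => bichromatic (col (i, j)) (col (i + 1, j + 1)) with hF''
  set U : ℕ → ℕ → ℕ := fun i j => if ¬ (col (i, j + 1) = col (i + 1, j + 1) ∧
    col (i, j) = col (i, j + 1) ∧ col (i, j) = col (i + 1, j + 1)) then 1 else 0 with hU
  set L : ℕ → ℕ → ℕ := fun i j => if ¬ (col (i, j) = col (i + 1, j) ∧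
    col (i + 1, j) = col (i + 1, j + 1) ∧ col (i, j) = col (i + 1, j + 1)) then 1 else 0 with hL
  have toRange : ∀ (n k : ℕ) (f : ℕ → ℕ → ℕ), ∑ x : Fin n, ∑ y : Fin k, f x y
      = ∑ i ∈ Finset.range n, ∑ j ∈ Finset.range k, f i j := by
    intro n k f
    simp only [Finset.sum_range]
  have main' : ∑ i ∈ Finset.range m, ∑ j ∈ Finset.range (m + 1), F i j +
      (∑ i ∈ Finset.range (m + 1), ∑ j ∈ Finset.range m, F' i j +
        ∑ i ∈ Finset.range m, ∑ j ∈ Finset.range m, F'' i j) ≤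
      N + ∑ i ∈ Finset.range m, ∑ j ∈ Finset.range m, (U i j + L i j) := by
    rw [← toRange, ← toRange, ← toRange, ← toRange]
    exact main
  have hFb : ∑ i ∈ Finset.range m, ∑ j ∈ Finset.range (m + 1), F i j
      = ∑ i ∈ Finset.range m, ∑ j ∈ Finset.range m, F i j + ∑ i ∈ Finset.range m, F i m := by
    simp only [Finset.sum_range_succ, Finset.sum_add_distrib]
  have hFb' : ∑ i ∈ Finset.range m, ∑ j ∈ Finset.range (m + 1), F i j
      = ∑ i ∈ Finset.range m, ∑ j ∈ Finset.range m, F i (j + 1)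
        + ∑ i ∈ Finset.range m, F i 0 := by
    simp only [Finset.sum_range_succ', Finset.sum_add_distrib]
  have hGb : ∑ i ∈ Finset.range (m + 1), ∑ j ∈ Finset.range m, F' i j
      = ∑ i ∈ Finset.range m, ∑ j ∈ Finset.range m, F' i j + ∑ j ∈ Finset.range m, F' m j := by
    rw [Finset.sum_range_succ]
  have hGb' : ∑ i ∈ Finset.range (m + 1), ∑ j ∈ Finset.range m, F' i j
      = ∑ i ∈ Finset.range m, ∑ j ∈ Finset.range m, F' (i + 1) j
        + ∑ j ∈ Finset.range m, F' 0 j := by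
    rw [Finset.sum_range_succ']
  have hpt : ∀ i j, (trichromatic (col (i, j)) (col (i + 1, j)) (col (i + 1, j + 1)) +
        trichromatic (col (i, j)) (col (i, j + 1)) (col (i + 1, j + 1))) + 2 * (U i j + L i j)
      = F i j + F i (j + 1) + F' i j + F' (i + 1) j + 2 * F'' i j := by
    intro i j
    exact trichromatic_add_trichromatic _ _ _ _
  have hsum := Finset.sum_congr (rfl : Finset.range m = Finset.range m)
    (fun i _ => Finset.sum_congr (rfl : Finset.range m = Finset.range m) (fun j _ => hpt i j))
  simp only [Finset.sum_add_distrib, ← Finset.mul_sum] at hsum main' ⊢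
  change _ + (∑ i ∈ Finset.range m, F i 0 + ∑ i ∈ Finset.range m, F i m +
    ∑ i ∈ Finset.range m, F' 0 i + ∑ i ∈ Finset.range m, F' m i) ≤ _
  omega

end Combinatorics

section Interpolation

/-- The Courant hat function of the triangulated integer grid. -/
def courantHat (s t : ℝ) : ℝ := max 0 (1 - max |s| (max |t| |s - t|))

theorem courantHat_comm (s t : ℝ) : courantHat s t = courantHat t s := by
  rw [courantHat, courantHat, max_left_comm, abs_sub_comm]

theorem courantHat_eq_zero_left {s t : ℝ} (h : 1 ≤ |s|) : courantHat s t = 0 :=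
  max_eq_left (by linarith [le_max_left |s| (max |t| |s - t|)])

theorem courantHat_eq_zero_right {s t : ℝ} (h : 1 ≤ |t|) : courantHat s t = 0 := by
  rw [courantHat_comm, courantHat_eq_zero_left h]

theorem courantHat_values {u v : ℝ} (hv : 0 ≤ v) (hvu : v ≤ u) (hu : u ≤ 1) :
    courantHat u v = 1 - u ∧ courantHat (u - 1) v = u - v ∧ courantHat u (v - 1) = 0 ∧
      courantHat (u - 1) (v - 1) = v := by
  unfold courantHat
  refine ⟨?_, ?_, ?_, ?_⟩
  · rw [abs_of_nonneg (hv.trans hvu), abs_of_nonneg hv, abs_of_nonneg (by linarith),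
      max_eq_left (a := u) (max_le hvu (by linarith)), max_eq_right (by linarith)]
  · rw [abs_of_nonpos (by linarith), abs_of_nonneg hv, abs_of_nonpos (by linarith),
      max_eq_right (a := v) (by linarith), max_eq_right (a := -(u - 1)) (by linarith),
      max_eq_right (by linarith)]
    ring
  · refine max_eq_left ?_
    have h1 := le_max_right |u| (max |v - 1| |u - (v - 1)|)
    have h2 := le_max_right |v - 1| |u - (v - 1)|
    have h3 := le_abs_self (u - (v - 1))
    linarith
  · rw [abs_of_nonpos (by linarith), abs_of_nonpos (by linarith), abs_of_nonneg (by linarith),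
      max_eq_left (a := -(v - 1)) (by linarith), max_eq_right (a := -(u - 1)) (by linarith),
      max_eq_right (by linarith)]
    ring

variable {B : Type*} [NormedAddCommGroup B] [NormedSpace ℝ B]

/-- The piecewise affine interpolation of values prescribed at the vertices of the grid. -/
def gridInterp (m : ℕ) (p : ℕ × ℕ → B) (x y : ℝ) : B :=
  ∑ i ∈ Finset.range (m + 1), ∑ j ∈ Finset.range (m + 1), courantHat (x - i) (y - j) • p (i, j)

theorem one_le_abs_sub_of_mem {x : ℝ} {i k : ℕ} (h0 : (i : ℝ) ≤ x) (h1 : x ≤ i + 1) (hk : k ≠ i)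
    (hk' : k ≠ i + 1) : 1 ≤ |x - k| := by
  rcases lt_or_gt_of_ne hk with h | h
  · have : (k : ℝ) + 1 ≤ i := by exact_mod_cast h
    exact le_trans (by linarith) (le_abs_self _)
  · have : (i : ℝ) + 2 ≤ k := by exact_mod_cast (by omega : i + 2 ≤ k)
    exact le_trans (by linarith) (neg_le_abs _)

theorem gridInterp_cell {m : ℕ} (p : ℕ × ℕ → B) {x y : ℝ} {i j : ℕ} (hi : i < m) (hj : j < m)
    (hx0 : (i : ℝ) ≤ x) (hx1 : x ≤ i + 1) (hy0 : (j : ℝ) ≤ y) (hy1 : y ≤ j + 1) :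
    gridInterp m p x y =
      (courantHat (x - i) (y - j) • p (i, j) + courantHat (x - i) (y - j - 1) • p (i, j + 1)) +
      (courantHat (x - i - 1) (y - j) • p (i + 1, j) +
        courantHat (x - i - 1) (y - j - 1) • p (i + 1, j + 1)) := by
  have inner : ∀ k : ℕ, ∑ l ∈ Finset.range (m + 1), courantHat (x - k) (y - l) • p (k, l)
      = courantHat (x - k) (y - j) • p (k, j) + courantHat (x - k) (y - j - 1) • p (k, j + 1) := by
    intro k
    rw [Finset.sum_eq_add j (j + 1) (by omega)]
    · push_cast; rw [sub_sub]
    · intro c _ hc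
      rw [courantHat_eq_zero_right (one_le_abs_sub_of_mem hy0 hy1 hc.1 hc.2), zero_smul]
    · intro h; exact absurd (Finset.mem_range.2 (by omega)) h
    · intro h; exact absurd (Finset.mem_range.2 (by omega)) h
  unfold gridInterp
  simp only [inner]
  rw [Finset.sum_eq_add i (i + 1) (by omega)]
  · push_cast; simp only [sub_sub]
  · intro c _ hc
    rw [courantHat_eq_zero_left (one_le_abs_sub_of_mem hx0 hx1 hc.1 hc.2),
      courantHat_eq_zero_left (one_le_abs_sub_of_mem hx0 hx1 hc.1 hc.2)]
    simp
  · intro h; exact absurd (Finset.mem_range.2 (by omega)) h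
  · intro h; exact absurd (Finset.mem_range.2 (by omega)) h

theorem gridInterp_lower {m : ℕ} (p : ℕ × ℕ → B) {x y : ℝ} {i j : ℕ} (hi : i < m) (hj : j < m)
    (hx1 : x ≤ i + 1) (hy0 : (j : ℝ) ≤ y) (hxy : y - j ≤ x - i) :
    gridInterp m p x y = p (i, j) + (x - i) • (p (i + 1, j) - p (i, j))
      + (y - j) • (p (i + 1, j + 1) - p (i + 1, j)) := by
  rw [gridInterp_cell p hi hj (by linarith) hx1 hy0 (by linarith)]
  obtain ⟨h1, h2, h3, h4⟩ := courantHat_values (u := x - i) (v := y - j) (by linarith) hxy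
    (by linarith)
  rw [h1, h2, h3, h4]
  module

theorem gridInterp_upper {m : ℕ} (p : ℕ × ℕ → B) {x y : ℝ} {i j : ℕ} (hi : i < m) (hj : j < m)
    (hx0 : (i : ℝ) ≤ x) (hy1 : y ≤ j + 1) (hxy : x - i ≤ y - j) :
    gridInterp m p x y = p (i, j) + (y - j) • (p (i, j + 1) - p (i, j))
      + (x - i) • (p (i + 1, j + 1) - p (i, j + 1)) := by
  rw [gridInterp_cell p hi hj hx0 (by linarith) (by linarith) hy1]
  obtain ⟨h1, h2, h3, h4⟩ := courantHat_values (u := y - j) (v := x - i) (by linarith) hxy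
    (by linarith)
  rw [courantHat_comm (x - i), courantHat_comm (x - i), courantHat_comm (x - i - 1),
    courantHat_comm (x - i - 1), h1, h2, h3, h4]
  module

theorem gridInterp_horizontal {m : ℕ} (p : ℕ × ℕ → B) {x : ℝ} {i j : ℕ} (hi : i < m) (hj : j ≤ m)
    (hx0 : (i : ℝ) ≤ x) (hx1 : x ≤ i + 1) :
    gridInterp m p x j = p (i, j) + (x - i) • (p (i + 1, j) - p (i, j)) := by
  rcases hj.lt_or_eq with h | h
  · rw [gridInterp_lower p hi h hx1 le_rfl (by linarith)]
    simp
  · obtain ⟨k, rfl⟩ : ∃ k, j = k + 1 := ⟨j - 1, by omega⟩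
    push_cast
    rw [gridInterp_upper p hi (by omega : k < m) hx0 le_rfl (by linarith)]
    have : (k : ℝ) + 1 - k = 1 := by ring
    rw [this]
    module

theorem gridInterp_vertical {m : ℕ} (p : ℕ × ℕ → B) {y : ℝ} {i j : ℕ} (hi : i ≤ m) (hj : j < m)
    (hy0 : (j : ℝ) ≤ y) (hy1 : y ≤ j + 1) :
    gridInterp m p i y = p (i, j) + (y - j) • (p (i, j + 1) - p (i, j)) := by
  rcases hi.lt_or_eq with h | h
  · rw [gridInterp_upper p h hj le_rfl hy1 (by linarith)]
    simp
  · obtain ⟨k, rfl⟩ : ∃ k, i = k + 1 := ⟨i - 1, by omega⟩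
    push_cast
    rw [gridInterp_lower p (by omega : k < m) hj le_rfl hy0 (by linarith)]
    have : (k : ℝ) + 1 - k = 1 := by ring
    rw [this]
    module

theorem exists_cell {m : ℕ} (hm : 0 < m) {x : ℝ} (hx0 : 0 ≤ x) (hx1 : x ≤ m) :
    ∃ i : ℕ, i < m ∧ (i : ℝ) ≤ x ∧ x ≤ i + 1 := by
  rcases hx1.lt_or_eq with h | h
  · exact ⟨⌊x⌋₊, (Nat.floor_lt hx0).2 h, Nat.floor_le hx0, (Nat.lt_floor_add_one x).le⟩
  · obtain ⟨k, rfl⟩ : ∃ k, m = k + 1 := ⟨m - 1, by omega⟩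
    refine ⟨k, by omega, ?_, ?_⟩ <;> rw [h] <;> push_cast <;> linarith

theorem abs_courantHat_sub_le (s t s' t' : ℝ) :
    |courantHat s t - courantHat s' t'| ≤ |s - s'| + |t - t'| := by
  unfold courantHat
  have h1 := abs_abs_sub_abs_le_abs_sub s s'
  have h2 := abs_abs_sub_abs_le_abs_sub t t'
  have h3 := abs_abs_sub_abs_le_abs_sub (s - t) (s' - t')
  have h4 : |s - t - (s' - t')| ≤ |s - s'| + |t - t'| := by
    have : s - t - (s' - t') = (s - s') - (t - t') := by ring
    rw [this]; exact abs_sub _ _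
  have h5 := abs_max_sub_max_le_max |t| |s - t| |t'| |s' - t'|
  have h6 := abs_max_sub_max_le_max |s| (max |t| |s - t|) |s'| (max |t'| |s' - t'|)
  have h7 := abs_max_sub_max_le_max 0 (1 - max |s| (max |t| |s - t|)) 0
    (1 - max |s'| (max |t'| |s' - t'|))
  refine h7.trans (max_le (by simp; positivity) ?_)
  have h8 : ∀ a b : ℝ, 1 - a - (1 - b) = -(a - b) := fun a b => by ring
  rw [h8, abs_neg]
  refine h6.trans (max_le ?_ (h5.trans (max_le ?_ ?_)))
  · linarith [abs_nonneg (t - t')]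
  · linarith [abs_nonneg (s - s')]
  · linarith

theorem norm_gridInterp_sub_le (m : ℕ) (p : ℕ × ℕ → B) :
    ∃ K : ℝ, 0 ≤ K ∧ ∀ x y x' y', ‖gridInterp m p x y - gridInterp m p x' y'‖
      ≤ K * (|x - x'| + |y - y'|) := by
  refine ⟨∑ i ∈ Finset.range (m + 1), ∑ j ∈ Finset.range (m + 1), ‖p (i, j)‖, by positivity, ?_⟩
  intro x y x' y'
  unfold gridInterp
  rw [← Finset.sum_sub_distrib, Finset.sum_mul]
  refine (norm_sum_le _ _).trans (Finset.sum_le_sum fun i _ => ?_)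
  rw [← Finset.sum_sub_distrib, Finset.sum_mul]
  refine (norm_sum_le _ _).trans (Finset.sum_le_sum fun j _ => ?_)
  rw [← sub_smul, norm_smul, mul_comm, Real.norm_eq_abs]
  gcongr
  refine (abs_courantHat_sub_le _ _ _ _).trans ?_
  rw [sub_sub_sub_cancel_right, sub_sub_sub_cancel_right]

end Interpolation

/-- The plane linear map with given matrix entries. -/
def planeMap (a b c d : ℝ) : E2 →L[ℝ] E2 :=
  LinearMap.toContinuousLinearMap (Matrix.toLpLin 2 2 !![a, b; c, d])

theorem planeMap_apply_zero (a b c d : ℝ) (w : E2) : planeMap a b c d w 0 = a * w 0 + b * w 1 := by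
  simp [planeMap,  Matrix.mulVec, dotProduct, Fin.sum_univ_two]

theorem planeMap_apply_one (a b c d : ℝ) (w : E2) : planeMap a b c d w 1 = c * w 0 + d * w 1 := by
  simp [planeMap,  Matrix.mulVec, dotProduct, Fin.sum_univ_two]

theorem det_planeMap (a b c d : ℝ) : (planeMap a b c d).det = a * d - b * c := by
  rw [planeMap, LinearMap.det_toContinuousLinearMap, Matrix.toLpLin_eq_toLin,
    LinearMap.det_toLin, Matrix.det_fin_two_of]

/-- A half-open unit square of the integer grid. -/
def unitCell (i j : ℤ) : Set E2 := {z | ((i : ℝ) ≤ z 0 ∧ z 0 < i + 1) ∧ (j : ℝ) ≤ z 1 ∧ z 1 < j + 1}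

theorem measurableSet_unitCell (i j : ℤ) : MeasurableSet (unitCell i j) := by
  have h0 : Measurable fun z : E2 => z 0 := by fun_prop
  have h1 : Measurable fun z : E2 => z 1 := by fun_prop
  exact ((measurableSet_le measurable_const h0).inter (measurableSet_lt h0 measurable_const)).inter
    ((measurableSet_le measurable_const h1).inter (measurableSet_lt h1 measurable_const))

theorem volume_unitCell_le (i j : ℤ) : volume (unitCell i j) ≤ 1 := by
  have hmp := PiLp.volume_preserving_ofLp (Fin 2)
  have hsub : unitCell i j ⊆ (WithLp.ofLp : E2 → Fin 2 → ℝ) ⁻¹'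
      (Set.pi univ fun k : Fin 2 => Ico (![(i : ℝ), j] k) (![(i : ℝ), j] k + 1)) := by
    intro z hz k _
    fin_cases k
    · exact hz.1
    · exact hz.2
  refine (measure_mono hsub).trans ?_
  rw [hmp.measure_preimage (MeasurableSet.pi countable_univ
    (fun k _ => measurableSet_Ico)).nullMeasurableSet, Real.volume_pi_Ico]
  simp

theorem volume_affine_line {a b : ℝ} (h : a ≠ 0 ∨ b ≠ 0) (c : ℝ) :
    volume {z : E2 | a * z 0 + b * z 1 = c} = 0 := by
  let f : E2 →ₗ[ℝ] ℝ := a • (EuclideanSpace.proj (𝕜 := ℝ) (0 : Fin 2)).toLinearMap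
    + b • (EuclideanSpace.proj (𝕜 := ℝ) (1 : Fin 2)).toLinearMap
  have hf : ∀ z, f z = a * z 0 + b * z 1 := fun z => rfl
  have hker : LinearMap.ker f ≠ ⊤ := by
    intro htop
    have h0 : f (EuclideanSpace.single 0 1) = 0 := LinearMap.mem_ker.1 (htop ▸ Submodule.mem_top)
    have h1 : f (EuclideanSpace.single 1 1) = 0 := LinearMap.mem_ker.1 (htop ▸ Submodule.mem_top)
    simp [hf] at h0 h1
    exact h.elim (fun h => h h0) (fun h => h h1)
  rcases {z : E2 | a * z 0 + b * z 1 = c}.eq_empty_or_nonempty with he | ⟨x, hx⟩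
  · rw [he, measure_empty]
  have : {z : E2 | a * z 0 + b * z 1 = c} = (fun z => z + -x) ⁻¹' (LinearMap.ker f : Set E2) := by
    ext z
    have hx' : f x = c := hx
    rw [mem_preimage, SetLike.mem_coe, LinearMap.mem_ker, map_add, map_neg, hx', hf,
      add_neg_eq_zero]
    rfl
  rw [this, measure_preimage_add_right, Measure.addHaar_submodule _ _ hker]

/-- The points of the plane lying on a grid line or on a diagonal of a grid square. -/
def gridLines : Set E2 :=
  {z | ∃ k : ℤ, z 0 = k} ∪ {z | ∃ k : ℤ, z 1 = k} ∪ {z | ∃ k : ℤ, z 0 - z 1 = k}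

theorem volume_gridLines : volume gridLines = 0 := by
  have key : ∀ {a b : ℝ}, a ≠ 0 ∨ b ≠ 0 → volume {z : E2 | ∃ k : ℤ, a * z 0 + b * z 1 = k} = 0 := by
    intro a b h
    rw [ofPred_exists]
    exact measure_iUnion_null fun k => volume_affine_line h k
  unfold gridLines
  refine measure_union_null (measure_union_null ?_ ?_) ?_
  · simpa using key (a := 1) (b := 0) (by simp)
  · simpa using key (a := 0) (b := 1) (by simp)
  · simpa [sub_eq_add_neg] using key (a := 1) (b := -1) (by simp)

section Collar

/-- Truncation to the interval `[0, m]`. -/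
def clampTo (m x : ℝ) : ℝ := max 0 (min x m)

theorem clampTo_of_mem {m x : ℝ} (h0 : 0 ≤ x) (h1 : x ≤ m) : clampTo m x = x := by
  rw [clampTo, min_eq_left h1, max_eq_right h0]

theorem clampTo_of_nonpos {m x : ℝ} (h0 : x ≤ 0) : clampTo m x = 0 :=
  max_eq_left ((min_le_left _ _).trans h0)

theorem clampTo_of_ge {m x : ℝ} (hm : 0 ≤ m) (h : m ≤ x) : clampTo m x = m := by
  rw [clampTo, min_eq_right h, max_eq_right hm]

theorem clampTo_mem {m : ℝ} (hm : 0 ≤ m) (x : ℝ) : 0 ≤ clampTo m x ∧ clampTo m x ≤ m :=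
  ⟨le_max_left _ _, max_le hm (min_le_right _ _)⟩

theorem abs_clampTo_sub_le (m x y : ℝ) : |clampTo m x - clampTo m y| ≤ |x - y| := by
  unfold clampTo
  refine (abs_max_sub_max_le_max _ _ _ _).trans (max_le (by simp) ?_)
  refine (abs_min_sub_min_le_max _ _ _ _).trans (max_le le_rfl (by simp))

theorem abs_sub_clampTo_le {m x : ℝ} (hm : 0 ≤ m) (h0 : -1 ≤ x) (h1 : x ≤ m + 1) :
    |x - clampTo m x| ≤ 1 := by
  rcases le_total x 0 with h | h
  · rw [clampTo_of_nonpos h, abs_le]; constructor <;> linarith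
  rcases le_total x m with h' | h'
  · rw [clampTo_of_mem h h']; simp
  · rw [clampTo_of_ge hm h', abs_le]; constructor <;> linarith

/-- The sup-distance from a point of the plane to the square `[0, m]²`. -/
def collar (m : ℝ) (z : E2) : ℝ := max |z 0 - clampTo m (z 0)| |z 1 - clampTo m (z 1)|

theorem collar_nonneg (m : ℝ) (z : E2) : 0 ≤ collar m z := (abs_nonneg _).trans (le_max_left _ _)

/-- The open square concentric to `[0, m]²` with margin one. -/
def collarSquare (m : ℝ) : Set E2 := {z | ∀ i, -1 < z i ∧ z i < m + 1}

theorem collar_le_one {m : ℝ} (hm : 0 ≤ m) {z : E2} (hz : ∀ i, -1 ≤ z i ∧ z i ≤ m + 1) :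
    collar m z ≤ 1 :=
  max_le (abs_sub_clampTo_le hm (hz 0).1 (hz 0).2) (abs_sub_clampTo_le hm (hz 1).1 (hz 1).2)

theorem abs_collar_sub_le (m : ℝ) (y z : E2) :
    |collar m y - collar m z| ≤ 2 * (|y 0 - z 0| + |y 1 - z 1|) := by
  have key : ∀ s t : ℝ, abs (|s - clampTo m s| - |t - clampTo m t|) ≤ 2 * |s - t| := by
    intro s t
    refine (abs_abs_sub_abs_le_abs_sub _ _).trans ?_
    have : s - clampTo m s - (t - clampTo m t) = (s - t) - (clampTo m s - clampTo m t) := by ring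
    rw [this]
    refine (abs_sub _ _).trans ?_
    linarith [abs_clampTo_sub_le m s t]
  refine (abs_max_sub_max_le_max _ _ _ _).trans (max_le ?_ ?_)
  · linarith [key (y 0) (z 0), abs_nonneg (y 1 - z 1)]
  · linarith [key (y 1) (z 1), abs_nonneg (y 0 - z 0)]

variable {B : Type*} [NormedAddCommGroup B] [NormedSpace ℝ B]

/-- The map which is the grid interpolation on `[0, m]²` and which is joined to `C` along the
collar of width one. -/
def collarMap (m : ℕ) (p : ℕ × ℕ → B) (C : E2 → B) (z : E2) : B :=
  (1 - collar m z) • gridInterp m p (clampTo m (z 0)) (clampTo m (z 1)) + collar m z • C z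

theorem norm_collarMap_sub_le {m : ℕ} {p : ℕ × ℕ → B} {C : E2 → B} {z : E2} (y : E2)
    (hz : collar m z ≤ 1) :
    ‖collarMap m p C y - collarMap m p C z‖ ≤
      ‖gridInterp m p (clampTo m (y 0)) (clampTo m (y 1))
        - gridInterp m p (clampTo m (z 0)) (clampTo m (z 1))‖ + ‖C y - C z‖ +
      |collar m y - collar m z|
        * ‖C y - gridInterp m p (clampTo m (y 0)) (clampTo m (y 1))‖ := by
  have h0 := collar_nonneg m z
  unfold collarMap
  generalize gridInterp m p (clampTo m (y 0)) (clampTo m (y 1)) = Py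
  generalize gridInterp m p (clampTo m (z 0)) (clampTo m (z 1)) = Pz
  have : (1 - collar m y) • Py + collar m y • C y - ((1 - collar m z) • Pz + collar m z • C z)
      = (1 - collar m z) • (Py - Pz) + collar m z • (C y - C z)
        + (collar m y - collar m z) • (C y - Py) := by module
  rw [this]
  refine (norm_add₃_le).trans ?_
  rw [norm_smul, norm_smul, norm_smul, Real.norm_of_nonneg h0,
    Real.norm_of_nonneg (by linarith : 0 ≤ 1 - collar m z), Real.norm_eq_abs]
  have h1 : (1 - collar m z) * ‖Py - Pz‖ ≤ 1 * ‖Py - Pz‖ := by gcongr; linarith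
  have h2 : collar m z * ‖C y - C z‖ ≤ 1 * ‖C y - C z‖ := by gcongr
  linarith

theorem exists_planeMap_triangle {A₁ A₂ A₃ : B} {N : ℕ} (c₁ c₂ c₃ : Fin N) (pt : Fin N → B)
    (h₁ : A₁ = pt c₁) (h₂ : A₂ = pt c₂) (h₃ : A₃ = pt c₃) {b : ℝ}
    (h12 : ‖A₂ - A₁‖ ≤ b) (h23 : ‖A₃ - A₂‖ ≤ b) :
    ∃ α β γ δ : ℝ, (∀ s t : ℝ, ‖s • (A₂ - A₁) + t • (A₃ - A₂)‖ ≤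
      |α * s + β * t| + |γ * s + δ * t|) ∧ |α * δ - β * γ| ≤ b ^ 2 * trichromatic c₁ c₂ c₃ := by
  by_cases h13 : c₁ = c₃
  · refine ⟨‖A₂ - A₁‖, -‖A₂ - A₁‖, 0, 0, fun s t => ?_, by simp; positivity⟩
    have : A₃ = A₁ := by rw [h₃, h₁, h13]
    rw [this]
    have e1 : s • (A₂ - A₁) + t • (A₁ - A₂) = (s - t) • (A₂ - A₁) := by module
    have e2 : ‖A₂ - A₁‖ * s + -‖A₂ - A₁‖ * t = (s - t) * ‖A₂ - A₁‖ := by ring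
    rw [e1, e2, norm_smul, abs_mul, abs_of_nonneg (norm_nonneg (A₂ - A₁))]
    simp
  · refine ⟨‖A₂ - A₁‖, 0, 0, ‖A₃ - A₂‖, fun s t => ?_, ?_⟩
    · refine (norm_add_le _ _).trans ?_
      rw [norm_smul, norm_smul]
      simp [abs_mul, mul_comm]
    · by_cases h : c₁ = c₂
      · rw [h₂, h₁, h]; simp; positivity
      by_cases h' : c₂ = c₃
      · rw [h₂, h₃, h']; simp; positivity
      · simp only [trichromatic, ne_eq, h, h', h13, not_false_eq_true, and_self, if_true]
        rw [mul_zero, sub_zero, abs_of_nonneg (by positivity)]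
        have := mul_le_mul h12 h23 (norm_nonneg _) ((norm_nonneg _).trans h12)
        push_cast
        linarith

end Collar

section CollarLocal

/-- The admissible data for the collar construction: the grid vertices carry values `pt ∘ col`,
adjacent values are `b`-close, and the boundary values are `a`-close to the Lipschitz map `C`. -/
structure CollarData {B : Type*} [NormedAddCommGroup B] [NormedSpace ℝ B] (m N : ℕ)
    (col : ℕ × ℕ → Fin N) (pt : Fin N → B) (C : E2 → B) (K : ℝ≥0) (a b : ℝ) : Prop where
  pos : 0 < m
  lip : LipschitzWith K C
  a_nonneg : 0 ≤ a
  b_nonneg : 0 ≤ b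
  adj : ∀ i j i' j', i' ≤ m → j' ≤ m → (i' = i ∨ i' = i + 1) → (j' = j ∨ j' = j + 1) →
    ‖pt (col (i', j')) - pt (col (i, j))‖ ≤ b
  bdry : ∀ z : E2, (∀ i, -1 ≤ z i ∧ z i ≤ m + 1) → ∀ i j, i ≤ m → j ≤ m →
    (i = 0 ∨ i = m ∨ j = 0 ∨ j = m) → |clampTo m (z 0) - i| ≤ 1 → |clampTo m (z 1) - j| ≤ 1 →
    ‖C z - pt (col (i, j))‖ ≤ a

variable {B : Type*} [NormedAddCommGroup B] [NormedSpace ℝ B] {m N : ℕ} {col : ℕ × ℕ → Fin N}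
  {pt : Fin N → B} {C : E2 → B} {K : ℝ≥0} {a b : ℝ}

namespace CollarData

theorem dist_le (D : CollarData m N col pt C K a b) (y z : E2) :
    ‖C y - C z‖ ≤ K * (|y 0 - z 0| + |y 1 - z 1|) := by
  have h := D.lip.dist_le_mul y z
  rw [dist_eq_norm, dist_eq_norm] at h
  refine h.trans ?_
  gcongr
  exact norm_le_abs_add_abs (y - z)

theorem norm_sub_interp_le {c x y : B} {a u : ℝ} (hu0 : 0 ≤ u) (hu1 : u ≤ 1) (hx : ‖c - x‖ ≤ a)
    (hy : ‖c - y‖ ≤ a) : ‖c - (x + u • (y - x))‖ ≤ a := by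
  have : c - (x + u • (y - x)) = (1 - u) • (c - x) + u • (c - y) := by module
  rw [this]
  refine (norm_add_le _ _).trans ?_
  rw [norm_smul, norm_smul, Real.norm_of_nonneg hu0, Real.norm_of_nonneg (by linarith)]
  nlinarith

/-- Over the boundary of the square, the two maps joined in the collar are close. -/
theorem norm_sub_gridInterp_le (D : CollarData m N col pt C K a b) {z : E2}
    (hz : ∀ i, -1 ≤ z i ∧ z i ≤ m + 1)
    (h : clampTo m (z 0) = 0 ∨ clampTo m (z 0) = m ∨ clampTo m (z 1) = 0 ∨ clampTo m (z 1) = m) :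
    ‖C z - gridInterp m (fun k => pt (col k)) (clampTo m (z 0)) (clampTo m (z 1))‖ ≤ a := by
  have hm : (0 : ℝ) ≤ m := Nat.cast_nonneg m
  have key0 : ∀ i : ℕ, i ≤ m → (i = 0 ∨ i = m) → clampTo m (z 0) = i →
      ‖C z - gridInterp m (fun k => pt (col k)) (clampTo m (z 0)) (clampTo m (z 1))‖ ≤ a := by
    intro i hi hi' e
    obtain ⟨j, hj, hj0, hj1⟩ := exists_cell D.pos (clampTo_mem hm (z 1)).1 (clampTo_mem hm (z 1)).2
    have hbd : ∀ j', i = 0 ∨ i = m ∨ j' = 0 ∨ j' = m := fun j' => by tauto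
    have b1 := D.bdry z hz i j hi hj.le (hbd j) (by rw [e]; simp)
      (by rw [abs_le]; constructor <;> linarith)
    have b2 := D.bdry z hz i (j + 1) hi hj (hbd _) (by rw [e]; simp)
      (by push_cast; rw [abs_le]; constructor <;> linarith)
    rw [e, gridInterp_vertical _ hi hj hj0 hj1]
    exact norm_sub_interp_le (by linarith) (by linarith) b1 b2
  have key1 : ∀ j : ℕ, j ≤ m → (j = 0 ∨ j = m) → clampTo m (z 1) = j →
      ‖C z - gridInterp m (fun k => pt (col k)) (clampTo m (z 0)) (clampTo m (z 1))‖ ≤ a := by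
    intro j hj hj' e
    obtain ⟨i, hi, hi0, hi1⟩ := exists_cell D.pos (clampTo_mem hm (z 0)).1 (clampTo_mem hm (z 0)).2
    have hbd : ∀ i', i' = 0 ∨ i' = m ∨ j = 0 ∨ j = m := fun i' => by tauto
    have b1 := D.bdry z hz i j hi.le hj (hbd i)
      (by rw [abs_le]; constructor <;> linarith) (by rw [e]; simp)
    have b2 := D.bdry z hz (i + 1) j hi hj (hbd _)
      (by push_cast; rw [abs_le]; constructor <;> linarith) (by rw [e]; simp)
    rw [e, gridInterp_horizontal _ hi hj hi0 hi1]
    exact norm_sub_interp_le (by linarith) (by linarith) b1 b2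
  rcases h with h | h | h | h
  · exact key0 0 (Nat.zero_le _) (Or.inl rfl) (by simpa using h)
  · exact key0 m le_rfl (Or.inr rfl) h
  · exact key1 0 (Nat.zero_le _) (Or.inl rfl) (by simpa using h)
  · exact key1 m le_rfl (Or.inr rfl) h

/-- The interpolation stays close to the prescribed vertex values. -/
theorem exists_norm_gridInterp_sub_le (D : CollarData m N col pt C K a b) {x y : ℝ} (hx0 : 0 ≤ x)
    (hx1 : x ≤ m) (hy0 : 0 ≤ y) (hy1 : y ≤ m) :
    ∃ k, ‖gridInterp m (fun k => pt (col k)) x y - pt k‖ ≤ 2 * b := by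
  obtain ⟨i, hi, hi0, hi1⟩ := exists_cell D.pos hx0 hx1
  obtain ⟨j, hj, hj0, hj1⟩ := exists_cell D.pos hy0 hy1
  have hb := D.b_nonneg
  refine ⟨col (i, j), ?_⟩
  have sm : ∀ {u : ℝ} {w : B}, 0 ≤ u → u ≤ 1 → ‖w‖ ≤ b → ‖u • w‖ ≤ b := by
    intro u w h0 h1 hw
    rw [norm_smul, Real.norm_of_nonneg h0]
    nlinarith [norm_nonneg w]
  rcases le_total (y - j) (x - i) with h | h
  · rw [gridInterp_lower _ hi hj hi1 hj0 h, add_assoc, add_sub_cancel_left]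
    refine (norm_add_le _ _).trans ?_
    have h1 := sm (u := x - i) (by linarith) (by linarith)
      (D.adj i j (i + 1) j hi hj.le (Or.inr rfl) (Or.inl rfl))
    have h2 := sm (u := y - j) (by linarith) (by linarith)
      (D.adj (i + 1) j (i + 1) (j + 1) hi hj (Or.inl rfl) (Or.inr rfl))
    linarith
  · rw [gridInterp_upper _ hi hj hi0 hj1 h, add_assoc, add_sub_cancel_left]
    refine (norm_add_le _ _).trans ?_
    have h1 := sm (u := y - j) (by linarith) (by linarith)
      (D.adj i j i (j + 1) hi.le hj (Or.inl rfl) (Or.inr rfl))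
    have h2 := sm (u := x - i) (by linarith) (by linarith)
      (D.adj i (j + 1) (i + 1) (j + 1) hi hj (Or.inr rfl) (Or.inl rfl))
    linarith

theorem exists_norm_collarMap_sub_le (D : CollarData m N col pt C K a b) {z : E2}
    (hz : ∀ i, -1 ≤ z i ∧ z i ≤ m + 1) :
    ∃ k, ‖collarMap m (fun k => pt (col k)) C z - pt k‖ ≤ a + 2 * b := by
  have hm : (0 : ℝ) ≤ m := Nat.cast_nonneg m
  have hc0 := clampTo_mem hm (z 0)
  have hc1 := clampTo_mem hm (z 1)
  obtain ⟨k, hk⟩ := D.exists_norm_gridInterp_sub_le hc0.1 hc0.2 hc1.1 hc1.2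
  refine ⟨k, ?_⟩
  have ha := D.a_nonneg
  by_cases hin : ∀ i, 0 ≤ z i ∧ z i ≤ m
  · have : collar m z = 0 := by
      rw [collar, clampTo_of_mem (hin 0).1 (hin 0).2, clampTo_of_mem (hin 1).1 (hin 1).2]; simp
    rw [collarMap, this]
    simp only [sub_zero, one_smul, zero_smul, add_zero]
    linarith
  · have hor : clampTo m (z 0) = 0 ∨ clampTo m (z 0) = m ∨ clampTo m (z 1) = 0 ∨
        clampTo m (z 1) = m := by
      by_contra! hne
      apply hin
      have : ∀ x : ℝ, clampTo m x ≠ 0 → clampTo m x ≠ m → 0 ≤ x ∧ x ≤ m := by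
        intro x h0 h1
        by_contra! hx
        rcases lt_or_ge x 0 with h | h
        · exact h0 (clampTo_of_nonpos h.le)
        · exact h1 (clampTo_of_ge hm (hx h).le)
      intro i
      fin_cases i
      · exact this _ hne.1 hne.2.1
      · exact this _ hne.2.2.1 hne.2.2.2
    have h1 := D.norm_sub_gridInterp_le hz hor
    have hl0 := collar_nonneg m z
    have hl1 := collar_le_one hm hz
    have : collarMap m (fun k => pt (col k)) C z - pt k =
        (gridInterp m (fun k => pt (col k)) (clampTo m (z 0)) (clampTo m (z 1)) - pt k)
        + collar m z • (C z -
          gridInterp m (fun k => pt (col k)) (clampTo m (z 0)) (clampTo m (z 1))) := by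
      unfold collarMap; module
    rw [this]
    refine (norm_add_le _ _).trans ?_
    rw [norm_smul, Real.norm_of_nonneg hl0]
    nlinarith [norm_nonneg (C z -
          gridInterp m (fun k => pt (col k)) (clampTo m (z 0)) (clampTo m (z 1)))]

theorem collarMap_eq_of_boundary {p : ℕ × ℕ → B} {z : E2} (h : collar m z = 1) :
    collarMap m p C z = C z := by
  simp [collarMap, h]

theorem lipschitzOnWith (D : CollarData m N col pt C K a b) :
    ∃ K' : ℝ≥0, LipschitzOnWith K' (collarMap m (fun k => pt (col k)) C)
      {z | ∀ i, -1 ≤ z i ∧ z i ≤ (m : ℝ) + 1} := by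
  obtain ⟨L, hL0, hL⟩ := norm_gridInterp_sub_le m (fun k => pt (col k))
  have hm : (0 : ℝ) ≤ m := Nat.cast_nonneg m
  set A : ℝ := ‖C 0‖ + K * (2 * (m + 1)) + (‖gridInterp m (fun k => pt (col k)) 0 0‖ + L * (2 * m))
  have hA0 : 0 ≤ A := by positivity
  have hA : ∀ z : E2, (∀ i, -1 ≤ z i ∧ z i ≤ (m : ℝ) + 1) →
      ‖C z - gridInterp m (fun k => pt (col k)) (clampTo m (z 0)) (clampTo m (z 1))‖ ≤ A := by
    intro z hz
    refine (norm_sub_le _ _).trans (add_le_add ?_ ?_)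
    · have h1 := D.dist_le z 0
      have h2 : ‖C z‖ ≤ ‖C 0‖ + ‖C z - C 0‖ := by
        simpa using norm_add_le (C 0) (C z - C 0)
      have h3 : ∀ i, |z i| ≤ (m : ℝ) + 1 := fun i =>
        abs_le.2 ⟨by linarith [(hz i).1], (hz i).2⟩
      have h4 : (K : ℝ) * (|z 0 - (0 : E2) 0| + |z 1 - (0 : E2) 1|) ≤ K * (2 * (m + 1)) := by
        gcongr
        simp only [PiLp.zero_apply, sub_zero]
        linarith [h3 0, h3 1]
      linarith
    · have h1 := hL (clampTo m (z 0)) (clampTo m (z 1)) 0 0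
      set P := gridInterp m (fun k => pt (col k)) (clampTo m (z 0)) (clampTo m (z 1))
      set P0 := gridInterp m (fun k => pt (col k)) 0 0
      have h2 : ‖P‖ ≤ ‖P0‖ + ‖P - P0‖ := by
        simpa using norm_add_le P0 (P - P0)
      have h3 : ∀ i, |clampTo m (z i) - 0| ≤ m := fun i => by
        rw [sub_zero, abs_of_nonneg (clampTo_mem hm _).1]; exact (clampTo_mem hm _).2
      have h4 : L * (|clampTo m (z 0) - 0| + |clampTo m (z 1) - 0|) ≤ L * (2 * m) := by
        gcongr
        linarith [h3 0, h3 1]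
      linarith
  refine ⟨⟨2 * (L + K + 2 * A), by positivity⟩, LipschitzOnWith.of_dist_le_mul ?_⟩
  intro y hy z hz
  rw [dist_eq_norm, dist_eq_norm]
  refine (norm_collarMap_sub_le y (collar_le_one hm hz)).trans ?_
  set T : ℝ := |y 0 - z 0| + |y 1 - z 1| with hT
  have hTn : T ≤ 2 * ‖y - z‖ := by
    have h0 := abs_apply_le_norm (y - z) 0
    have h1 := abs_apply_le_norm (y - z) 1
    simp only [PiLp.sub_apply] at h0 h1
    linarith
  have h1 := hL (clampTo m (y 0)) (clampTo m (y 1)) (clampTo m (z 0)) (clampTo m (z 1))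
  have h2 : L * (|clampTo m (y 0) - clampTo m (z 0)| + |clampTo m (y 1) - clampTo m (z 1)|)
      ≤ L * T := by
    gcongr
    exact add_le_add (abs_clampTo_sub_le _ _ _) (abs_clampTo_sub_le _ _ _)
  have h3 := D.dist_le y z
  have h4 := abs_collar_sub_le m y z
  have h5 := mul_le_mul h4 (hA y hy) (norm_nonneg _) (by positivity)
  calc _ ≤ L * T + K * T + 2 * T * A := by linarith
    _ = (L + K + 2 * A) * T := by ring
    _ ≤ (L + K + 2 * A) * (2 * ‖y - z‖) := by gcongr
    _ = 2 * (L + K + 2 * A) * ‖y - z‖ := by ring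

end CollarData
end CollarLocal

section CollarArea

variable {B : Type*} [NormedAddCommGroup B] [NormedSpace ℝ B] {m N : ℕ} {col : ℕ × ℕ → Fin N}
  {pt : Fin N → B} {C : E2 → B} {K : ℝ≥0} {a b : ℝ}

theorem add_smul_sub_add_smul_sub (u v w : B) (s t s' t' : ℝ) :
    u + s • v + t • w - (u + s' • v + t' • w) = (s - s') • v + (t - t') • w := by
  module

theorem continuous_coord (i : Fin 2) : Continuous fun y : E2 => y i := by fun_prop

theorem eventually_mem_Ioo {z : E2} {i : Fin 2} {s t : ℝ} (h0 : s < z i) (h1 : z i < t) :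
    ∀ᶠ y : E2 in 𝓝 z, s < y i ∧ y i < t :=
  ((continuous_coord i).tendsto z).eventually (Ioo_mem_nhds h0 h1)

theorem isOpen_collarSquare (m : ℝ) : IsOpen (collarSquare m) := by
  have : collarSquare m = ⋂ i : Fin 2, (fun y : E2 => y i) ⁻¹' Ioo (-1) (m + 1) := by
    ext z; simp [collarSquare]
  rw [this]
  exact isOpen_iInter_of_finite fun i => isOpen_Ioo.preimage (continuous_coord i)

namespace CollarData

theorem exists_bound_interior (D : CollarData m N col pt C K a b) {z : E2} {i j : ℕ} (hi : i < m)
    (hj : j < m) (hi0 : (i : ℝ) < z 0) (hi1 : z 0 < i + 1) (hj0 : (j : ℝ) < z 1)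
    (hj1 : z 1 < j + 1) (hne : z 0 - i ≠ z 1 - j) :
    ∃ L : E2 →L[ℝ] E2, (∀ᶠ y in 𝓝 z, dist (collarMap m (fun k => pt (col k)) C y)
      (collarMap m (fun k => pt (col k)) C z) ≤ |L (y - z) 0| + |L (y - z) 1|) ∧
      |L.det| ≤ b ^ 2 * (trichromatic (col (i, j)) (col (i + 1, j)) (col (i + 1, j + 1)) +
        trichromatic (col (i, j)) (col (i, j + 1)) (col (i + 1, j + 1)) : ℕ) := by
  have him : (i : ℝ) + 1 ≤ m := by exact_mod_cast hi
  have hjm : (j : ℝ) + 1 ≤ m := by exact_mod_cast hj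
  have hi' : (0 : ℝ) ≤ i := Nat.cast_nonneg i
  have hj' : (0 : ℝ) ≤ j := Nat.cast_nonneg j
  have hW : ∀ y : E2, (i : ℝ) < y 0 ∧ y 0 < i + 1 → (j : ℝ) < y 1 ∧ y 1 < j + 1 →
      collarMap m (fun k => pt (col k)) C y = gridInterp m (fun k => pt (col k)) (y 0) (y 1) := by
    intro y h0 h1
    have e0 : clampTo m (y 0) = y 0 := clampTo_of_mem (by linarith) (by linarith)
    have e1 : clampTo m (y 1) = y 1 := clampTo_of_mem (by linarith) (by linarith)
    simp [collarMap, collar, e0, e1]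
  have ev0 := eventually_mem_Ioo hi0 hi1
  have ev1 := eventually_mem_Ioo hj0 hj1
  rcases lt_or_gt_of_ne hne with h | h
  · have ev2 : ∀ᶠ y : E2 in 𝓝 z, y 0 - i < y 1 - j :=
      (((continuous_coord 0).sub continuous_const).tendsto z).eventually_lt
        (((continuous_coord 1).sub continuous_const).tendsto z) h
    obtain ⟨α, β, γ, δ, hb, hd⟩ := exists_planeMap_triangle (col (i, j)) (col (i, j + 1))
      (col (i + 1, j + 1)) pt rfl rfl rfl (D.adj i j i (j + 1) hi.le hj (Or.inl rfl) (Or.inr rfl))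
      (D.adj i (j + 1) (i + 1) (j + 1) hi hj (Or.inr rfl) (Or.inl rfl))
    refine ⟨planeMap β α δ γ, ?_, ?_⟩
    · filter_upwards [ev0, ev1, ev2] with y h0 h1 h2
      rw [hW y h0 h1, hW z ⟨hi0, hi1⟩ ⟨hj0, hj1⟩, dist_eq_norm,
        gridInterp_upper _ hi hj h0.1.le h1.2.le h2.le,
        gridInterp_upper _ hi hj hi0.le hj1.le h.le, planeMap_apply_zero, planeMap_apply_one]
      have := hb (y 1 - z 1) (y 0 - z 0)
      rw [add_smul_sub_add_smul_sub, PiLp.sub_apply, PiLp.sub_apply, add_comm (β * _),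
        add_comm (δ * _)]
      simpa only [sub_sub_sub_cancel_right] using this
    · rw [det_planeMap, abs_sub_comm]
      refine hd.trans ?_
      gcongr
      omega
  · have ev2 : ∀ᶠ y : E2 in 𝓝 z, y 1 - j < y 0 - i :=
      (((continuous_coord 1).sub continuous_const).tendsto z).eventually_lt
        (((continuous_coord 0).sub continuous_const).tendsto z) h
    obtain ⟨α, β, γ, δ, hb, hd⟩ := exists_planeMap_triangle (col (i, j)) (col (i + 1, j))
      (col (i + 1, j + 1)) pt rfl rfl rfl (D.adj i j (i + 1) j hi hj.le (Or.inr rfl) (Or.inl rfl))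
      (D.adj (i + 1) j (i + 1) (j + 1) hi hj (Or.inl rfl) (Or.inr rfl))
    refine ⟨planeMap α β γ δ, ?_, ?_⟩
    · filter_upwards [ev0, ev1, ev2] with y h0 h1 h2
      rw [hW y h0 h1, hW z ⟨hi0, hi1⟩ ⟨hj0, hj1⟩, dist_eq_norm,
        gridInterp_lower _ hi hj h0.2.le h1.1.le h2.le,
        gridInterp_lower _ hi hj hi1.le hj0.le h.le, planeMap_apply_zero, planeMap_apply_one]
      have := hb (y 0 - z 0) (y 1 - z 1)
      rw [add_smul_sub_add_smul_sub, PiLp.sub_apply, PiLp.sub_apply]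
      simpa only [sub_sub_sub_cancel_right] using this
    · rw [det_planeMap]
      refine hd.trans ?_
      gcongr
      omega

/-- Local estimate in the part of the collar over a horizontal side. -/
theorem exists_bound_horizontal (D : CollarData m N col pt C K a b) {z : E2}
    (hz : z ∈ collarSquare m) {i j : ℕ} (hi : i < m) (hj : j ≤ m) (hj' : j = 0 ∨ j = m)
    (hi0 : (i : ℝ) < z 0) (hi1 : z 0 < i + 1) (hc : ∀ᶠ y : E2 in 𝓝 z, clampTo m (y 1) = j) :
    ∃ L : E2 →L[ℝ] E2, (∀ᶠ y in 𝓝 z, dist (collarMap m (fun k => pt (col k)) C y)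
      (collarMap m (fun k => pt (col k)) C z) ≤ |L (y - z) 0| + |L (y - z) 1|) ∧
      |L.det| ≤ (b * bichromatic (col (i, j)) (col (i + 1, j)) + K) * (a + K) := by
  have him : (i : ℝ) + 1 ≤ m := by exact_mod_cast hi
  have hi' : (0 : ℝ) ≤ i := Nat.cast_nonneg i
  have ha := D.a_nonneg
  have hb := D.b_nonneg
  refine ⟨planeMap (b * bichromatic (col (i, j)) (col (i + 1, j)) + K) 0 0 (a + K), ?_, ?_⟩
  · have hz1 := hc.self_of_nhds
    filter_upwards [eventually_mem_Ioo hi0 hi1, hc, (isOpen_collarSquare m).mem_nhds hz]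
      with y h0 h1 h2
    have hy' : ∀ i, -1 ≤ y i ∧ y i ≤ m + 1 := fun i => ⟨(h2 i).1.le, (h2 i).2.le⟩
    have hz' : ∀ i, -1 ≤ z i ∧ z i ≤ m + 1 := fun i => ⟨(hz i).1.le, (hz i).2.le⟩
    rw [dist_eq_norm, planeMap_apply_zero, planeMap_apply_one]
    refine (norm_collarMap_sub_le y (collar_le_one (Nat.cast_nonneg m) hz')).trans ?_
    have e0 : clampTo m (y 0) = y 0 := clampTo_of_mem (by linarith) (by linarith)
    have e1 : clampTo m (z 0) = z 0 := clampTo_of_mem (by linarith) (by linarith)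
    have hP := D.norm_sub_gridInterp_le hy' (by
      rcases hj' with rfl | rfl
      · right; right; left; simpa using h1
      · right; right; right; exact h1)
    have hcy : collar m y = |y 1 - j| := by simp [collar, e0, h1]
    have hcz : collar m z = |z 1 - j| := by simp [collar, e1, hz1]
    have hd : |collar m y - collar m z| ≤ |y 1 - z 1| := by
      rw [hcy, hcz]
      refine (abs_abs_sub_abs_le_abs_sub _ _).trans (le_of_eq ?_)
      congr 1; ring
    have hG : ‖gridInterp m (fun k => pt (col k)) (clampTo m (y 0)) (clampTo m (y 1))
        - gridInterp m (fun k => pt (col k)) (clampTo m (z 0)) (clampTo m (z 1))‖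
        ≤ |y 0 - z 0| * (b * bichromatic (col (i, j)) (col (i + 1, j))) := by
      rw [e0, e1, h1, hz1, gridInterp_horizontal _ hi hj h0.1.le h0.2.le,
        gridInterp_horizontal _ hi hj hi0.le hi1.le]
      have : ∀ u v : B, u + (y 0 - i) • (v - u) - (u + (z 0 - i) • (v - u))
          = (y 0 - z 0) • (v - u) := fun u v => by module
      rw [this, norm_smul, Real.norm_eq_abs]
      gcongr
      by_cases h : col (i, j) = col (i + 1, j)
      · simp [h, bichromatic]
      · simpa [h, bichromatic] using D.adj i j (i + 1) j hi hj (Or.inr rfl) (Or.inl rfl)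
    have hC := D.dist_le y z
    have hm := mul_le_mul hd hP (norm_nonneg _) (abs_nonneg _)
    simp only [PiLp.sub_apply, zero_mul, add_zero, zero_add]
    rw [abs_mul, abs_mul, abs_of_nonneg (show 0 ≤ a + K by positivity),
      abs_of_nonneg (show 0 ≤ b * (bichromatic (col (i, j)) (col (i + 1, j)) : ℝ) + K by
        positivity)]
    linarith
  · rw [det_planeMap, mul_zero, sub_zero, abs_of_nonneg (by positivity)]

/-- Local estimate in the part of the collar over a vertical side. -/
theorem exists_bound_vertical (D : CollarData m N col pt C K a b) {z : E2}
    (hz : z ∈ collarSquare m) {i j : ℕ} (hi : i ≤ m) (hj : j < m) (hi' : i = 0 ∨ i = m)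
    (hj0 : (j : ℝ) < z 1) (hj1 : z 1 < j + 1) (hc : ∀ᶠ y : E2 in 𝓝 z, clampTo m (y 0) = i) :
    ∃ L : E2 →L[ℝ] E2, (∀ᶠ y in 𝓝 z, dist (collarMap m (fun k => pt (col k)) C y)
      (collarMap m (fun k => pt (col k)) C z) ≤ |L (y - z) 0| + |L (y - z) 1|) ∧
      |L.det| ≤ (b * bichromatic (col (i, j)) (col (i, j + 1)) + K) * (a + K) := by
  have hjm : (j : ℝ) + 1 ≤ m := by exact_mod_cast hj
  have hj' : (0 : ℝ) ≤ j := Nat.cast_nonneg j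
  have ha := D.a_nonneg
  have hb := D.b_nonneg
  refine ⟨planeMap (a + K) 0 0 (b * bichromatic (col (i, j)) (col (i, j + 1)) + K), ?_, ?_⟩
  · have hz1 := hc.self_of_nhds
    filter_upwards [eventually_mem_Ioo hj0 hj1, hc, (isOpen_collarSquare m).mem_nhds hz]
      with y h0 h1 h2
    have hy' : ∀ i, -1 ≤ y i ∧ y i ≤ m + 1 := fun i => ⟨(h2 i).1.le, (h2 i).2.le⟩
    have hz' : ∀ i, -1 ≤ z i ∧ z i ≤ m + 1 := fun i => ⟨(hz i).1.le, (hz i).2.le⟩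
    rw [dist_eq_norm, planeMap_apply_zero, planeMap_apply_one]
    refine (norm_collarMap_sub_le y (collar_le_one (Nat.cast_nonneg m) hz')).trans ?_
    have e0 : clampTo m (y 1) = y 1 := clampTo_of_mem (by linarith) (by linarith)
    have e1 : clampTo m (z 1) = z 1 := clampTo_of_mem (by linarith) (by linarith)
    have hP := D.norm_sub_gridInterp_le hy' (by
      rcases hi' with rfl | rfl
      · left; simpa using h1
      · right; left; exact h1)
    have hcy : collar m y = |y 0 - i| := by simp [collar, e0, h1]
    have hcz : collar m z = |z 0 - i| := by simp [collar, e1, hz1]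
    have hd : |collar m y - collar m z| ≤ |y 0 - z 0| := by
      rw [hcy, hcz]
      refine (abs_abs_sub_abs_le_abs_sub _ _).trans (le_of_eq ?_)
      congr 1; ring
    have hG : ‖gridInterp m (fun k => pt (col k)) (clampTo m (y 0)) (clampTo m (y 1))
        - gridInterp m (fun k => pt (col k)) (clampTo m (z 0)) (clampTo m (z 1))‖
        ≤ |y 1 - z 1| * (b * bichromatic (col (i, j)) (col (i, j + 1))) := by
      rw [e0, e1, h1, hz1, gridInterp_vertical _ hi hj h0.1.le h0.2.le,
        gridInterp_vertical _ hi hj hj0.le hj1.le]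
      have : ∀ u v : B, u + (y 1 - j) • (v - u) - (u + (z 1 - j) • (v - u))
          = (y 1 - z 1) • (v - u) := fun u v => by module
      rw [this, norm_smul, Real.norm_eq_abs]
      gcongr
      by_cases h : col (i, j) = col (i, j + 1)
      · simp [h, bichromatic]
      · simpa [h, bichromatic] using D.adj i j i (j + 1) hi hj (Or.inl rfl) (Or.inr rfl)
    have hC := D.dist_le y z
    have hm := mul_le_mul hd hP (norm_nonneg _) (abs_nonneg _)
    simp only [PiLp.sub_apply, zero_mul, add_zero, zero_add]
    rw [abs_mul, abs_mul, abs_of_nonneg (show 0 ≤ a + K by positivity),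
      abs_of_nonneg (show 0 ≤ b * (bichromatic (col (i, j)) (col (i, j + 1)) : ℝ) + K by
        positivity)]
    linarith
  · rw [det_planeMap, mul_zero, sub_zero, abs_of_nonneg (by positivity), mul_comm]

/-- Local estimate in the part of the collar over a corner. -/
theorem exists_bound_corner (D : CollarData m N col pt C K a b) {z : E2}
    (hz : z ∈ collarSquare m) {i j : ℕ} (hi' : i = 0 ∨ i = m)
    (hc0 : ∀ᶠ y : E2 in 𝓝 z, clampTo m (y 0) = i) (hc1 : ∀ᶠ y : E2 in 𝓝 z, clampTo m (y 1) = j) :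
    ∃ L : E2 →L[ℝ] E2, (∀ᶠ y in 𝓝 z, dist (collarMap m (fun k => pt (col k)) C y)
      (collarMap m (fun k => pt (col k)) C z) ≤ |L (y - z) 0| + |L (y - z) 1|) ∧
      |L.det| ≤ (a + K) ^ 2 := by
  have ha := D.a_nonneg
  refine ⟨planeMap (a + K) 0 0 (a + K), ?_, ?_⟩
  · have hz0 := hc0.self_of_nhds
    have hz1 := hc1.self_of_nhds
    filter_upwards [hc0, hc1, (isOpen_collarSquare m).mem_nhds hz] with y h0 h1 h2
    have hy' : ∀ i, -1 ≤ y i ∧ y i ≤ m + 1 := fun i => ⟨(h2 i).1.le, (h2 i).2.le⟩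
    have hz' : ∀ i, -1 ≤ z i ∧ z i ≤ m + 1 := fun i => ⟨(hz i).1.le, (hz i).2.le⟩
    rw [dist_eq_norm, planeMap_apply_zero, planeMap_apply_one]
    refine (norm_collarMap_sub_le y (collar_le_one (Nat.cast_nonneg m) hz')).trans ?_
    have hP := D.norm_sub_gridInterp_le hy' (by
      rcases hi' with rfl | rfl
      · left; simpa using h0
      · right; left; exact h0)
    have hd : |collar m y - collar m z| ≤ |y 0 - z 0| + |y 1 - z 1| := by
      have key : ∀ s t u : ℝ, abs (|s - u| - |t - u|) ≤ |s - t| := fun s t u => by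
        refine (abs_abs_sub_abs_le_abs_sub _ _).trans (le_of_eq ?_)
        congr 1; ring
      rw [collar, collar, h0, h1, hz0, hz1]
      refine (abs_max_sub_max_le_max _ _ _ _).trans (max_le ?_ ?_)
      · linarith [key (y 0) (z 0) i, abs_nonneg (y 1 - z 1)]
      · linarith [key (y 1) (z 1) j, abs_nonneg (y 0 - z 0)]
    have hC := D.dist_le y z
    have hm := mul_le_mul hd hP (norm_nonneg _) (by positivity)
    rw [h0, h1, hz0, hz1, sub_self, norm_zero, zero_add]
    rw [h0, h1] at hm
    simp only [PiLp.sub_apply, zero_mul, add_zero, zero_add]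
    rw [abs_mul, abs_mul, abs_of_nonneg (show 0 ≤ a + K by positivity)]
    linarith
  · rw [det_planeMap, mul_zero, sub_zero, abs_of_nonneg (by positivity), sq]

theorem exists_bound_lipschitz (D : CollarData m N col pt C K a b) {z : E2}
    (hz : z ∈ collarSquare m) :
    ∃ L : E2 →L[ℝ] E2, ∀ᶠ y in 𝓝 z, dist (collarMap m (fun k => pt (col k)) C y)
      (collarMap m (fun k => pt (col k)) C z) ≤ |L (y - z) 0| + |L (y - z) 1| := by
  obtain ⟨K', h⟩ := D.lipschitzOnWith
  refine ⟨planeMap K' 0 0 K', ?_⟩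
  filter_upwards [(isOpen_collarSquare m).mem_nhds hz] with y hy
  refine (h.dist_le_mul y (fun i => ⟨(hy i).1.le, (hy i).2.le⟩) z
    (fun i => ⟨(hz i).1.le, (hz i).2.le⟩)).trans ?_
  rw [planeMap_apply_zero, planeMap_apply_one, dist_eq_norm, zero_mul, zero_mul, add_zero,
    zero_add, abs_mul, abs_mul, abs_of_nonneg K'.coe_nonneg, ← mul_add]
  gcongr
  exact norm_le_abs_add_abs (y - z)

end CollarData
end CollarArea

section CollarWeight

/-- The weight `w` on a unit cell of the integer grid. -/
def cellWeight (i j : ℤ) (w : ℝ) : E2 → ℝ≥0∞ := (unitCell i j).indicator fun _ => ENNReal.ofReal w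

theorem measurable_cellWeight (i j : ℤ) (w : ℝ) : Measurable (cellWeight i j w) :=
  measurable_const.indicator (measurableSet_unitCell i j)

theorem lintegral_cellWeight_le (i j : ℤ) (w : ℝ) :
    ∫⁻ z, cellWeight i j w z ≤ ENNReal.ofReal w := by
  unfold cellWeight
  rw [lintegral_indicator_const (measurableSet_unitCell i j)]
  calc _ ≤ ENNReal.ofReal w * 1 := by gcongr; exact volume_unitCell_le i j
    _ = _ := mul_one _

theorem le_cellWeight {i j : ℤ} {w d : ℝ} {z : E2} (hz : z ∈ unitCell i j) (h : d ≤ w) :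
    ENNReal.ofReal d ≤ cellWeight i j w z := by
  rw [cellWeight, indicator_of_mem hz]
  exact ENNReal.ofReal_le_ofReal h

/-- The position of a non-integral coordinate of a point of the collared square. -/
theorem coord_cases {m : ℕ} {z : E2} {q : Fin 2} (h0 : -1 < z q) (h1 : z q < m + 1)
    (hz : ∀ k : ℤ, z q ≠ k) :
    (∃ i < m, (i : ℝ) < z q ∧ z q < i + 1) ∨
      ∃ i : ℕ, ∃ k : ℤ, (i = 0 ∧ k = -1 ∨ i = m ∧ k = m) ∧ (k : ℝ) ≤ z q ∧ z q < k + 1 ∧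
        ∀ᶠ y : E2 in 𝓝 z, clampTo m (y q) = i := by
  rcases lt_or_gt_of_ne (hz 0) with h | h
  · refine Or.inr ⟨0, -1, Or.inl ⟨rfl, rfl⟩, by push_cast; exact h0.le, by simpa using h, ?_⟩
    filter_upwards [eventually_mem_Ioo h0 h] with y hy
    rw [clampTo_of_nonpos (by simpa using hy.2.le)]; simp
  rcases lt_or_gt_of_ne (hz m) with h' | h'
  · left
    rw [Int.cast_zero] at h
    rw [Int.cast_natCast] at h'
    refine ⟨⌊z q⌋₊, (Nat.floor_lt h.le).2 h', ?_, Nat.lt_floor_add_one _⟩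
    refine lt_of_le_of_ne (Nat.floor_le h.le) fun e => hz ⌊z q⌋₊ ?_
    rw [Int.cast_natCast, e]
  · rw [Int.cast_natCast] at h'
    refine Or.inr ⟨m, m, Or.inr ⟨rfl, rfl⟩, by simpa using h'.le, by simpa using h1, ?_⟩
    filter_upwards [eventually_mem_Ioo h' h1] with y hy
    exact clampTo_of_ge (Nat.cast_nonneg m) hy.1.le

variable {B : Type*} [NormedAddCommGroup B] [NormedSpace ℝ B] {m N : ℕ} {col : ℕ × ℕ → Fin N}
  {pt : Fin N → B} {C : E2 → B} {K : ℝ≥0} {a b : ℝ}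

/-- The number of tricolored triangles of a cell. -/
def cellCount (col : ℕ × ℕ → Fin N) (i j : ℕ) : ℕ :=
  trichromatic (col (i, j)) (col (i + 1, j)) (col (i + 1, j + 1)) +
    trichromatic (col (i, j)) (col (i, j + 1)) (col (i + 1, j + 1))

/-- A bound for the Jacobian of the collared interpolation. -/
def collarWeight (m : ℕ) (col : ℕ × ℕ → Fin N) (b K c : ℝ) (z : E2) : ℝ≥0∞ :=
  gridLines.indicator (fun _ => ⊤) z +
    ((∑ i ∈ Finset.range m, ∑ j ∈ Finset.range m,
      cellWeight i j (b ^ 2 * cellCount col i j) z) +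
    ((∑ i ∈ Finset.range m,
      (cellWeight i (-1) ((b * bichromatic (col (i, 0)) (col (i + 1, 0)) + K) * c) z +
      cellWeight i m ((b * bichromatic (col (i, m)) (col (i + 1, m)) + K) * c) z +
      cellWeight (-1) i ((b * bichromatic (col (0, i)) (col (0, i + 1)) + K) * c) z +
      cellWeight m i ((b * bichromatic (col (m, i)) (col (m, i + 1)) + K) * c) z)) +
    (cellWeight (-1) (-1) (c ^ 2) z + cellWeight (-1) m (c ^ 2) z +
      cellWeight m (-1) (c ^ 2) z + cellWeight m m (c ^ 2) z)))

theorem lintegral_collarWeight_le {b K c : ℝ} (hb : 0 ≤ b) (hK : 0 ≤ K) (hc : 0 ≤ c)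
    (hcol : ∑ i ∈ Finset.range m, ∑ j ∈ Finset.range m, cellCount col i j +
      ∑ i ∈ Finset.range m, (bichromatic (col (i, 0)) (col (i + 1, 0))
        + bichromatic (col (i, m)) (col (i + 1, m)) + bichromatic (col (0, i)) (col (0, i + 1))
        + bichromatic (col (m, i)) (col (m, i + 1))) ≤ 2 * N) :
    ∫⁻ z, collarWeight m col b K c z ≤
      ENNReal.ofReal (2 * N * b ^ 2 + 2 * N * b * c + 4 * m * K * c + 4 * c ^ 2) := by
  have hms := measurable_cellWeight
  unfold collarWeight
  have hline : ∫⁻ z, gridLines.indicator (fun _ => (⊤ : ℝ≥0∞)) z = 0 := by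
    refine le_antisymm ((lintegral_indicator_const_le _ _).trans ?_) bot_le
    rw [volume_gridLines, mul_zero]
  rw [lintegral_add_right _ (by fun_prop), hline, zero_add, lintegral_add_left (by fun_prop),
    lintegral_add_left (by fun_prop), lintegral_finsetSum _ (by fun_prop),
    lintegral_finsetSum _ (by fun_prop)]
  calc _ ≤ (∑ i ∈ Finset.range m, ∑ j ∈ Finset.range m,
        ENNReal.ofReal (b ^ 2 * cellCount col i j)) +
      ((∑ i ∈ Finset.range m, ENNReal.ofReal
        (((b * bichromatic (col (i, 0)) (col (i + 1, 0)) + K) * c) +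
        ((b * bichromatic (col (i, m)) (col (i + 1, m)) + K) * c) +
        ((b * bichromatic (col (0, i)) (col (0, i + 1)) + K) * c) +
        ((b * bichromatic (col (m, i)) (col (m, i + 1)) + K) * c))) +
      ENNReal.ofReal (4 * c ^ 2)) := by
        refine add_le_add ?_ (add_le_add ?_ ?_)
        · refine Finset.sum_le_sum fun i _ => ?_
          rw [lintegral_finsetSum _ (by fun_prop)]
          exact Finset.sum_le_sum fun j _ => lintegral_cellWeight_le _ _ _
        · refine Finset.sum_le_sum fun i _ => ?_
          rw [lintegral_add_left (by fun_prop), lintegral_add_left (by fun_prop),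
            lintegral_add_left (by fun_prop), ENNReal.ofReal_add (by positivity) (by positivity),
            ENNReal.ofReal_add (by positivity) (by positivity),
            ENNReal.ofReal_add (by positivity) (by positivity)]
          gcongr <;> exact lintegral_cellWeight_le _ _ _
        · rw [lintegral_add_left (by fun_prop), lintegral_add_left (by fun_prop),
            lintegral_add_left (by fun_prop),
            show 4 * c ^ 2 = c ^ 2 + c ^ 2 + c ^ 2 + c ^ 2 by ring,
            ENNReal.ofReal_add (by positivity) (by positivity),
            ENNReal.ofReal_add (by positivity) (by positivity),
            ENNReal.ofReal_add (by positivity) (by positivity)]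
          gcongr <;> exact lintegral_cellWeight_le _ _ _
    _ = ENNReal.ofReal ((∑ i ∈ Finset.range m, ∑ j ∈ Finset.range m,
        (b ^ 2 * cellCount col i j)) +
      ((∑ i ∈ Finset.range m,
        (((b * bichromatic (col (i, 0)) (col (i + 1, 0)) + K) * c) +
        ((b * bichromatic (col (i, m)) (col (i + 1, m)) + K) * c) +
        ((b * bichromatic (col (0, i)) (col (0, i + 1)) + K) * c) +
        ((b * bichromatic (col (m, i)) (col (m, i + 1)) + K) * c))) + 4 * c ^ 2)) := by
        rw [ENNReal.ofReal_add (by positivity) (by positivity),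
          ENNReal.ofReal_add (by positivity) (by positivity),
          ENNReal.ofReal_sum_of_nonneg fun i _ => by positivity,
          ENNReal.ofReal_sum_of_nonneg fun i _ => by positivity]
        congr 1
        refine Finset.sum_congr rfl fun i _ => ?_
        rw [ENNReal.ofReal_sum_of_nonneg fun i _ => by positivity]
    _ ≤ _ := by
        refine ENNReal.ofReal_le_ofReal ?_
        have e1 : ∀ i, (((b * bichromatic (col (i, 0)) (col (i + 1, 0)) + K) * c) +
            ((b * bichromatic (col (i, m)) (col (i + 1, m)) + K) * c) +
            ((b * bichromatic (col (0, i)) (col (0, i + 1)) + K) * c) +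
            ((b * bichromatic (col (m, i)) (col (m, i + 1)) + K) * c)) =
            b * c * ((bichromatic (col (i, 0)) (col (i + 1, 0))
              + bichromatic (col (i, m)) (col (i + 1, m)) +
              bichromatic (col (0, i)) (col (0, i + 1))
              + bichromatic (col (m, i)) (col (m, i + 1)) : ℕ) : ℝ) + 4 * K * c := by
          intro i; push_cast; ring
        simp only [e1, Finset.sum_add_distrib, ← Finset.mul_sum, Finset.sum_const,
          Finset.card_range, nsmul_eq_mul, ← Nat.cast_sum]
        set T := ∑ i ∈ Finset.range m, ∑ j ∈ Finset.range m, cellCount col i j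
        set S := ∑ i ∈ Finset.range m, (bichromatic (col (i, 0)) (col (i + 1, 0))
          + bichromatic (col (i, m)) (col (i + 1, m)) + bichromatic (col (0, i)) (col (0, i + 1))
          + bichromatic (col (m, i)) (col (m, i + 1)))
        have hT : (T : ℝ) ≤ 2 * N := by exact_mod_cast (by omega : T ≤ 2 * N)
        have hS : (S : ℝ) ≤ 2 * N := by exact_mod_cast (by omega : S ≤ 2 * N)
        have h1 : b ^ 2 * T ≤ b ^ 2 * (2 * N) := by gcongr
        have h2 : b * c * S ≤ b * c * (2 * N) := by gcongr
        simp only [S, Finset.sum_add_distrib] at h2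
        linarith

theorem CollarData.exists_bound (D : CollarData m N col pt C K a b) {z : E2}
    (hz : z ∈ collarSquare m) :
    ∃ L : E2 →L[ℝ] E2, (∀ᶠ y in 𝓝 z, dist (collarMap m (fun k => pt (col k)) C y)
      (collarMap m (fun k => pt (col k)) C z) ≤ |L (y - z) 0| + |L (y - z) 1|) ∧
      ENNReal.ofReal |L.det| ≤ collarWeight m col b K (a + K) z := by
  unfold collarWeight
  by_cases hl : z ∈ gridLines
  · obtain ⟨L, hL⟩ := D.exists_bound_lipschitz hz
    exact ⟨L, hL, by simp [hl]⟩
  have hl' : (∀ k : ℤ, z 0 ≠ k) ∧ (∀ k : ℤ, z 1 ≠ k) ∧ ∀ k : ℤ, z 0 - z 1 ≠ k := by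
    refine ⟨fun k h => hl ?_, fun k h => hl ?_, fun k h => hl ?_⟩
    · exact Or.inl (Or.inl ⟨k, h⟩)
    · exact Or.inl (Or.inr ⟨k, h⟩)
    · exact Or.inr ⟨k, h⟩
  rcases coord_cases (hz 0).1 (hz 0).2 hl'.1 with ⟨i, hi, hi0, hi1⟩ | ⟨i, k, hik, hk0, hk1, hc0⟩ <;>
  rcases coord_cases (hz 1).1 (hz 1).2 hl'.2.1 with ⟨j, hj, hj0, hj1⟩ | ⟨j, l, hjl, hl0, hl1, hc1⟩
  · obtain ⟨L, h1, h2⟩ := D.exists_bound_interior hi hj hi0 hi1 hj0 hj1 fun e =>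
      hl'.2.2 (i - j) (by push_cast; linarith)
    refine ⟨L, h1, le_add_left (le_add_right ?_)⟩
    have hcell : z ∈ unitCell i j := ⟨⟨by simpa using hi0.le, by simpa using hi1⟩,
      by simpa using hj0.le, by simpa using hj1⟩
    refine (le_cellWeight hcell h2).trans ?_
    refine le_trans ?_ (Finset.single_le_sum (f := fun i : ℕ => ∑ j ∈ Finset.range m,
      cellWeight i j (b ^ 2 * cellCount col i j) z) (fun _ _ => bot_le) (Finset.mem_range.2 hi))
    exact Finset.single_le_sum (f := fun j : ℕ =>
      cellWeight i j (b ^ 2 * cellCount col i j) z) (fun _ _ => bot_le) (Finset.mem_range.2 hj)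
  · have hcell : z ∈ unitCell i l := ⟨⟨by simpa using hi0.le, by simpa using hi1⟩, hl0, hl1⟩
    obtain ⟨L, h1, h2⟩ := D.exists_bound_horizontal hz hi (j := j) (by omega) (by omega) hi0 hi1 hc1
    refine ⟨L, h1, le_add_left (le_add_left (le_add_right ?_))⟩
    refine (le_cellWeight hcell h2).trans ?_
    refine le_trans ?_ (Finset.single_le_sum (fun _ _ => bot_le) (Finset.mem_range.2 hi))
    rcases hjl with ⟨rfl, rfl⟩ | ⟨rfl, rfl⟩
    · exact le_add_right (le_add_right (le_add_right le_rfl))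
    · exact le_add_right (le_add_right (le_add_left le_rfl))
  · have hcell : z ∈ unitCell k j := ⟨⟨hk0, hk1⟩, by simpa using hj0.le, by simpa using hj1⟩
    obtain ⟨L, h1, h2⟩ := D.exists_bound_vertical hz (i := i) (by omega) hj (by omega) hj0 hj1 hc0
    refine ⟨L, h1, le_add_left (le_add_left (le_add_right ?_))⟩
    refine (le_cellWeight hcell h2).trans ?_
    refine le_trans ?_ (Finset.single_le_sum (fun _ _ => bot_le) (Finset.mem_range.2 hj))
    rcases hik with ⟨rfl, rfl⟩ | ⟨rfl, rfl⟩
    · exact le_add_right (le_add_left le_rfl)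
    · exact le_add_left le_rfl
  · have hcell : z ∈ unitCell k l := ⟨⟨hk0, hk1⟩, hl0, hl1⟩
    obtain ⟨L, h1, h2⟩ := D.exists_bound_corner hz (by omega) hc0 hc1
    refine ⟨L, h1, le_add_left (le_add_left (le_add_left ?_))⟩
    refine (le_cellWeight hcell h2).trans ?_
    rcases hik with ⟨rfl, rfl⟩ | ⟨rfl, rfl⟩ <;> rcases hjl with ⟨rfl, rfl⟩ | ⟨rfl, rfl⟩
    · exact le_add_right (le_add_right (le_add_right le_rfl))
    · exact le_add_right (le_add_right (le_add_left le_rfl))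
    · exact le_add_right (le_add_left le_rfl)
    · exact le_add_left le_rfl

end CollarWeight

section Unicoherence

theorem IsPreconnected.eq_of_exp_eq_one {X : Type*} [TopologicalSpace X] {A : Set X}
    (hA : IsPreconnected A) {f : X → ℂ} (hf : ContinuousOn f A)
    (h : ∀ x ∈ A, Complex.exp (f x) = 1) {x y : X} (hx : x ∈ A) (hy : y ∈ A) : f x = f y := by
  have hc : {w : ℂ | Complex.exp w = 1}.Countable := by
    refine (countable_range fun n : ℤ => (n * (2 * Real.pi * Complex.I) : ℂ)).mono ?_
    intro w hw
    obtain ⟨n, hn⟩ := Complex.exp_eq_one_iff.1 hw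
    exact ⟨n, hn.symm⟩
  exact hc.isTotallyDisconnected (f '' A) (by rintro _ ⟨z, hz, rfl⟩; exact h z hz)
    (hA.image f hf) (mem_image_of_mem f hx) (mem_image_of_mem f hy)

/-- A simply connected, locally path connected space is unicoherent. -/
theorem isPreconnected_inter_of_union_eq_univ {X : Type*} [TopologicalSpace X] [NormalSpace X]
    [SimplyConnectedSpace X] [LocallyPathConnectedSpace X] {A C : Set X} (hA : IsClosed A)
    (hC : IsClosed C) (hAc : IsPreconnected A) (hCc : IsPreconnected C) (hAC : A ∪ C = univ) :
    IsPreconnected (A ∩ C) := by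
  classical
  rw [isPreconnected_closed_iff]
  intro t t' ht ht' hsub hne hne'
  by_contra hemp
  rw [not_nonempty_iff_eq_empty] at hemp
  have hdisj : Disjoint (A ∩ C ∩ t) (A ∩ C ∩ t') := by
    rw [Set.disjoint_iff_inter_eq_empty, ← hemp]
    ext x; simp only [mem_inter_iff]; tauto
  obtain ⟨g, hg0, hg1, -⟩ := exists_continuous_zero_one_of_isClosed
    ((hA.inter hC).inter ht) ((hA.inter hC).inter ht') hdisj
  set h : X → ℂ := fun x => Complex.exp ((if x ∈ A then 1 else -1) * (Real.pi * g x * Complex.I))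
    with hh
  have hgc : Continuous fun x => (Real.pi * g x * Complex.I : ℂ) := by fun_prop
  have hAeq : ∀ x ∈ A, h x = Complex.exp (Real.pi * g x * Complex.I) := fun x hx => by
    simp [hh, hx]
  have hCeq : ∀ x ∈ C, h x = Complex.exp (-(Real.pi * g x * Complex.I)) := fun x hx => by
    by_cases hxA : x ∈ A
    · rw [hAeq x hxA]
      rcases hsub ⟨hxA, hx⟩ with h' | h'
      · simp [hg0 ⟨⟨hxA, hx⟩, h'⟩]
      · simp [hg1 ⟨⟨hxA, hx⟩, h'⟩, Complex.exp_neg, Complex.exp_pi_mul_I]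
    · simp [hh, hxA]
  have hcont : Continuous h := by
    rw [← continuousOn_univ, ← hAC]
    refine ContinuousOn.union_of_isClosed ?_ ?_ hA hC
    · exact hgc.cexp.continuousOn.congr hAeq
    · exact hgc.neg.cexp.continuousOn.congr hCeq
  obtain ⟨θ, hθc, hθ⟩ := Complex.exists_continuousOn_eqOn_exp_comp (X := X) (U := univ) (g := h)
    ((Homeomorph.Set.univ X).toHomotopyEquiv.simplyConnectedSpace_iff.2 ‹_›) isOpen_univ
      hcont.continuousOn (by
      rintro ⟨x, -, hx⟩; exact Complex.exp_ne_zero _ hx)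
  rw [continuousOn_univ] at hθc
  obtain ⟨p, ⟨hpA, hpC⟩, hpt⟩ := hne
  obtain ⟨q, ⟨hqA, hqC⟩, hqt⟩ := hne'
  have e1 := hAc.eq_of_exp_eq_one (f := fun x => θ x - Real.pi * g x * Complex.I)
    (hθc.sub hgc).continuousOn (fun x hx => by
      rw [Complex.exp_sub, ← hAeq x hx, ← hθ (mem_univ x)]
      exact div_self (Complex.exp_ne_zero _)) hpA hqA
  have e2 := hCc.eq_of_exp_eq_one (f := fun x => θ x - -(Real.pi * g x * Complex.I))
    (hθc.sub hgc.neg).continuousOn (fun x hx => by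
      rw [Complex.exp_sub, ← hCeq x hx, ← hθ (mem_univ x)]
      exact div_self (Complex.exp_ne_zero _)) hpC hqC
  simp only [hg0 ⟨⟨hpA, hpC⟩, hpt⟩, hg1 ⟨⟨hqA, hqC⟩, hqt⟩] at e1 e2
  have e3 : (2 * Real.pi : ℂ) * Complex.I = 0 := by
    simp at e1 e2
    linear_combination e1 - e2
  simp [Real.pi_ne_zero] at e3

theorem isPreconnected_inter_of_homeomorph_disc {X : Type*} [TopologicalSpace X]
    (φ : ↥unitClosedDisc ≃ₜ X) {A C : Set X} (hA : IsClosed A)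
    (hC : IsClosed C) (hAc : IsPreconnected A) (hCc : IsPreconnected C) (hAC : A ∪ C = univ) :
    IsPreconnected (A ∩ C) := by
  have hconv : Convex ℝ unitClosedDisc := convex_closedBall _ _
  have := hconv.locallyPathConnectedSpace
  have : ContractibleSpace unitClosedDisc :=
    hconv.contractibleSpace ⟨0, by simp [unitClosedDisc]⟩
  rw [← φ.isPreconnected_preimage] at hAc hCc ⊢
  rw [preimage_inter]
  exact isPreconnected_inter_of_union_eq_univ (hA.preimage φ.continuous) (hC.preimage φ.continuous)
    hAc hCc (by rw [← preimage_union, hAC, preimage_univ])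

end Unicoherence

section Eilenberg

variable {X : Type*} [MetricSpace X] [MeasurableSpace X] [BorelSpace X]

theorem exists_cover_tsum_ediam_le (hfin : μH[2] (univ : Set X) ≠ ⊤) {r : ℝ≥0∞} (hr : 0 < r) :
    ∃ U : ℕ → Set X, ⋃ n, U n = univ ∧ (∀ n, ediam (U n) ≤ r) ∧
      ∑' n, ediam (U n) * ediam (U n) ≤ μH[2] (univ : Set X) + r := by
  have h := Measure.hausdorffMeasure_apply 2 (univ : Set X)
  have hlt : μH[2] (univ : Set X) < μH[2] (univ : Set X) + r := ENNReal.lt_add_right hfin hr.ne'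
  have h2 : ⨅ (t : ℕ → Set X) (_ : univ ⊆ ⋃ n, t n) (_ : ∀ n, ediam (t n) ≤ r),
      ∑' n, ⨆ _ : (t n).Nonempty, ediam (t n) ^ (2 : ℝ) < μH[2] (univ : Set X) + r := by
    refine lt_of_le_of_lt ?_ hlt
    rw [h]
    exact le_iSup₂ (f := fun (r : ℝ≥0∞) (_ : 0 < r) =>
      ⨅ (t : ℕ → Set X) (_ : univ ⊆ ⋃ n, t n) (_ : ∀ n, ediam (t n) ≤ r),
      ∑' n, ⨆ _ : (t n).Nonempty, ediam (t n) ^ (2 : ℝ)) r hr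
  simp only [iInf_lt_iff] at h2
  obtain ⟨U, hU, hUr, hsum⟩ := h2
  refine ⟨U, univ_subset_iff.1 hU, hUr, le_trans (ENNReal.tsum_le_tsum fun n => ?_) hsum.le⟩
  rcases (U n).eq_empty_or_nonempty with h | h
  · simp [h]
  · simp [h, sq]

/-- Eilenberg's inequality for level sets of a `1`-Lipschitz function, in the plane case. -/
theorem exists_measurable_level_bound [Nonempty X] (hfin : μH[2] (univ : Set X) ≠ ⊤) {f : X → ℝ}
    (hf : LipschitzWith 1 f) :
    ∃ G : ℝ → ℝ≥0∞, Measurable G ∧ (∀ t, μH[1] (f ⁻¹' {t}) ≤ G t) ∧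
      ∫⁻ t, G t ≤ 2 * μH[2] (univ : Set X) := by
  have hr0 : ∀ n : ℕ, (0 : ℝ≥0∞) < (n + 1 : ℝ≥0∞)⁻¹ := fun n =>
    ENNReal.inv_pos.2 (by finiteness)
  choose U hU hUr hUs using fun n : ℕ => exists_cover_tsum_ediam_le hfin (hr0 n)
  have hne1 : ∀ n : ℕ, (n + 1 : ℝ≥0∞)⁻¹ ≠ ⊤ := fun n => ENNReal.inv_ne_top.2 (by simp)
  have hx : ∀ n i, ∃ x, (U n i).Nonempty → x ∈ U n i := fun n i => by
    rcases (U n i).eq_empty_or_nonempty with h | ⟨x, hx⟩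
    · exact ⟨Classical.arbitrary X, fun h' => by simp [h] at h'⟩
    · exact ⟨x, fun _ => hx⟩
  choose x hx using hx
  set I : ℕ → ℕ → Set ℝ := fun n i => closedBall (f (x n i)) (ediam (U n i)).toReal
  have hmem : ∀ n i, ∀ y ∈ U n i, f y ∈ I n i := by
    intro n i y hy
    rw [mem_closedBall, dist_edist]
    refine ENNReal.toReal_mono (ne_top_of_le_ne_top (hne1 n) (hUr n i)) ?_
    have := hf y (x n i)
    rw [ENNReal.coe_one, one_mul] at this
    exact this.trans (edist_le_ediam_of_mem hy (hx n i ⟨y, hy⟩))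
  set G : ℕ → ℝ → ℝ≥0∞ := fun n t => ∑' i, (I n i).indicator (fun _ => ediam (U n i)) t
  have hGm : ∀ n, Measurable (G n) := fun n =>
    Measurable.tsum fun i => measurable_const.indicator isClosed_closedBall.measurableSet
  have hrt : Tendsto (fun n : ℕ => (n + 1 : ℝ≥0∞)⁻¹) atTop (𝓝 0) := by
    have := (tendsto_add_atTop_iff_nat 1).2 ENNReal.tendsto_inv_nat_nhds_zero
    simpa using this
  refine ⟨fun t => liminf (fun n => G n t) atTop, Measurable.liminf hGm, fun t => ?_, ?_⟩
  · refine (Measure.hausdorffMeasure_le_liminf_tsum 1 (f ⁻¹' {t})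
      (fun n : ℕ => (n + 1 : ℝ≥0∞)⁻¹) hrt
      (fun n i => U n i ∩ f ⁻¹' {t})
      (Eventually.of_forall fun n i => (ediam_mono inter_subset_left).trans (hUr n i))
      (Eventually.of_forall fun n => ?_)).trans ?_
    · rw [← iUnion_inter, hU, univ_inter]
    · refine liminf_le_liminf (Eventually.of_forall fun n => ?_)
      refine ENNReal.tsum_le_tsum fun i => ?_
      rw [ENNReal.rpow_one]
      rcases (U n i ∩ f ⁻¹' {t}).eq_empty_or_nonempty with h | ⟨y, hy, hyt⟩
      · simp [h]
      · have : t ∈ I n i := by rw [← hyt]; exact hmem n i y hy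
        rw [indicator_of_mem this]
        exact ediam_mono inter_subset_left
  · refine (lintegral_liminf_le hGm).trans ?_
    have hb : ∀ n, ∫⁻ t, G n t ≤ 2 * (μH[2] (univ : Set X) + (n + 1 : ℝ≥0∞)⁻¹) := by
      intro n
      rw [lintegral_tsum fun i => (measurable_const.indicator
        isClosed_closedBall.measurableSet).aemeasurable]
      refine le_trans ?_ (mul_le_mul_right (hUs n) 2)
      rw [← ENNReal.tsum_mul_left]
      refine ENNReal.tsum_le_tsum fun i => ?_
      rw [lintegral_indicator_const isClosed_closedBall.measurableSet, Real.volume_closedBall,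
        ENNReal.ofReal_mul (by norm_num),
        ENNReal.ofReal_toReal (ne_top_of_le_ne_top (hne1 n) (hUr n i))]
      simp only [ENNReal.ofReal_ofNat]
      rw [mul_left_comm]
    have hlim : Tendsto (fun n : ℕ => 2 * (μH[2] (univ : Set X) + (n + 1 : ℝ≥0∞)⁻¹)) atTop
        (𝓝 (2 * (μH[2] (univ : Set X) + 0))) :=
      ENNReal.Tendsto.const_mul (tendsto_const_nhds.add hrt) (Or.inr (by simp))
    rw [add_zero] at hlim
    rw [← hlim.liminf_eq]
    exact liminf_le_liminf (Eventually.of_forall hb)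

end Eilenberg

section Geodesics

variable {X : Type*} [MetricSpace X]

/-- Any two points are joined by an isometrically embedded interval. -/
def HasGeodesics (X : Type*) [MetricSpace X] : Prop :=
  ∀ x y : X, ∃ g : ℝ → X, g 0 = x ∧ g (dist x y) = y ∧
    ∀ s ∈ Icc 0 (dist x y), ∀ t ∈ Icc 0 (dist x y), dist (g s) (g t) = |s - t|

theorem MCurve.dist_eq_sub_of_length_le (γ : MCurve X)
    (hl : γ.length ≤ edist (γ.toFun γ.a) (γ.toFun γ.b)) {s t : ℝ} (hs : s ∈ Icc γ.a γ.b)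
    (ht : t ∈ Icc γ.a γ.b) (hst : s ≤ t) :
    dist (γ.toFun s) (γ.toFun t) =
      dist (γ.toFun γ.a) (γ.toFun t) - dist (γ.toFun γ.a) (γ.toFun s) := by
  have ha : γ.a ∈ Icc γ.a γ.b := left_mem_Icc.2 γ.hab
  have hb : γ.b ∈ Icc γ.a γ.b := right_mem_Icc.2 γ.hab
  have h1 := eVariationOn.Icc_add_Icc γ.toFun (s := univ) hs.1 hst (mem_univ s)
  have h2 := eVariationOn.Icc_add_Icc γ.toFun (s := univ) ht.1 ht.2 (mem_univ t)
  simp only [univ_inter] at h1 h2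
  have e1 := eVariationOn.edist_le γ.toFun (left_mem_Icc.2 hs.1) (right_mem_Icc.2 hs.1)
  have e2 := eVariationOn.edist_le γ.toFun (left_mem_Icc.2 hst) (right_mem_Icc.2 hst)
  have e3 := eVariationOn.edist_le γ.toFun (left_mem_Icc.2 ht.2) (right_mem_Icc.2 ht.2)
  have key : edist (γ.toFun γ.a) (γ.toFun s) + edist (γ.toFun s) (γ.toFun t) +
      edist (γ.toFun t) (γ.toFun γ.b) ≤ edist (γ.toFun γ.a) (γ.toFun γ.b) := by
    refine le_trans ?_ hl
    rw [MCurve.length, ← h2, ← h1]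
    gcongr
  simp only [edist_dist] at key
  rw [← ENNReal.ofReal_add (by positivity) (by positivity),
    ← ENNReal.ofReal_add (by positivity) (by positivity),
    ENNReal.ofReal_le_ofReal_iff (by positivity)] at key
  have t1 := dist_triangle (γ.toFun γ.a) (γ.toFun s) (γ.toFun t)
  have t2 := dist_triangle (γ.toFun γ.a) (γ.toFun t) (γ.toFun γ.b)
  linarith

theorem IsGeodesicSpace.hasGeodesics (h : IsGeodesicSpace X) : HasGeodesics X := by
  intro x y
  obtain ⟨γ, rfl, rfl, hl⟩ := h x y
  have ha : γ.a ∈ Icc γ.a γ.b := left_mem_Icc.2 γ.hab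
  have hb : γ.b ∈ Icc γ.a γ.b := right_mem_Icc.2 γ.hab
  have hiv : ∀ r : ℝ, ∃ s, r ∈ Icc 0 (dist (γ.toFun γ.a) (γ.toFun γ.b)) →
      s ∈ Icc γ.a γ.b ∧ dist (γ.toFun γ.a) (γ.toFun s) = r := by
    intro r
    by_cases hr : r ∈ Icc 0 (dist (γ.toFun γ.a) (γ.toFun γ.b))
    · have hc : ContinuousOn (fun s => dist (γ.toFun γ.a) (γ.toFun s)) (Icc γ.a γ.b) :=
        (LipschitzWith.dist_right (γ.toFun γ.a)).continuous.comp_continuousOn γ.cont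
      obtain ⟨s, hs, hsr⟩ := intermediate_value_Icc γ.hab hc (by simpa using hr)
      exact ⟨s, fun _ => ⟨hs, hsr⟩⟩
    · exact ⟨0, fun h' => absurd h' hr⟩
  choose σ hσ using hiv
  have hd0 : (0 : ℝ) ≤ dist (γ.toFun γ.a) (γ.toFun γ.b) := dist_nonneg
  refine ⟨fun r => γ.toFun (σ r), ?_, ?_, ?_⟩
  · obtain ⟨-, h0⟩ := hσ 0 ⟨le_rfl, hd0⟩
    exact (dist_eq_zero.1 h0).symm
  · obtain ⟨h1, h0⟩ := hσ _ ⟨hd0, le_rfl⟩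
    have := γ.dist_eq_sub_of_length_le hl.le h1 hb h1.2
    rw [h0, sub_self] at this
    exact dist_eq_zero.1 this
  · have main : ∀ s ∈ Icc 0 (dist (γ.toFun γ.a) (γ.toFun γ.b)),
        ∀ t ∈ Icc 0 (dist (γ.toFun γ.a) (γ.toFun γ.b)), σ s ≤ σ t →
        dist (γ.toFun (σ s)) (γ.toFun (σ t)) = |s - t| := by
      intro s hs t ht hst
      have := γ.dist_eq_sub_of_length_le hl.le (hσ s hs).1 (hσ t ht).1 hst
      rw [(hσ s hs).2, (hσ t ht).2] at this
      rw [this, abs_sub_comm, abs_of_nonneg]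
      rw [← this]
      exact dist_nonneg
    intro s hs t ht
    rcases le_total (σ s) (σ t) with h' | h'
    · exact main s hs t ht h'
    · rw [dist_comm, abs_sub_comm]
      exact main t ht s hs h'

/-- A continuous-path form: a connected set joining two points all of whose points
`z` satisfy `dist x z + dist z y = dist x y`. -/
theorem HasGeodesics.exists_segment (h : HasGeodesics X) (x y : X) :
    ∃ S : Set X, IsCompact S ∧ IsPreconnected S ∧ x ∈ S ∧ y ∈ S ∧
      ∀ z ∈ S, dist x z + dist z y = dist x y := by
  obtain ⟨g, h0, h1, hg⟩ := h x y
  have hd0 : (0 : ℝ) ≤ dist x y := dist_nonneg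
  have hc : ContinuousOn g (Icc 0 (dist x y)) := by
    have : LipschitzOnWith 1 g (Icc 0 (dist x y)) :=
      LipschitzOnWith.of_dist_le_mul fun s hs t ht => by
        rw [hg s hs t ht, NNReal.coe_one, one_mul, Real.dist_eq]
    exact this.continuousOn
  refine ⟨g '' Icc 0 (dist x y), isCompact_Icc.image_of_continuousOn hc,
    isPreconnected_Icc.image g hc, ⟨0, ⟨le_rfl, hd0⟩, h0⟩, ⟨_, ⟨hd0, le_rfl⟩, h1⟩, ?_⟩
  rintro _ ⟨s, hs, rfl⟩
  have e1 := hg 0 ⟨le_rfl, hd0⟩ s hs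
  have e2 := hg s hs _ ⟨hd0, le_rfl⟩
  rw [h0] at e1
  rw [h1] at e2
  rw [e1, e2, abs_of_nonpos (by linarith [hs.1]), abs_of_nonpos (by linarith [hs.2])]
  ring

end Geodesics

section HausdorffOne

variable {X : Type*} [MetricSpace X] [MeasurableSpace X] [BorelSpace X]

theorem ofReal_le_hausdorffMeasure_of_isPreconnected {S : Set X} (hS : IsPreconnected S) {p q : X}
    (hp : p ∈ S) (hq : q ∈ S) {r : ℝ} (hr : r ≤ dist p q) :
    ENNReal.ofReal r ≤ μH[1] (S ∩ ball p r) := by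
  have hl : LipschitzWith 1 (fun z => dist p z) := LipschitzWith.dist_right p
  have h1 := (hl.lipschitzOnWith (s := S ∩ ball p r)).hausdorffMeasure_image_le
    (d := 1) zero_le_one
  have hsub : Ico 0 r ⊆ (fun z => dist p z) '' (S ∩ ball p r) := by
    intro t ht
    have himg := (hS.image _ hl.continuous.continuousOn).ordConnected
    have := himg.out (mem_image_of_mem _ hp) (mem_image_of_mem _ hq)
    simp only [dist_self] at this
    obtain ⟨z, hz, hzt⟩ := this ⟨ht.1, ht.2.le.trans hr⟩
    exact ⟨z, ⟨hz, by rw [mem_ball, dist_comm]; exact hzt.trans_lt ht.2⟩, hzt⟩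
  have h2 := (measure_mono hsub).trans h1
  rw [hausdorffMeasure_real, Real.volume_Ico, sub_zero] at h2
  simpa using h2

theorem HasFiniteLength.hausdorffMeasure_ne_top {Γ : Set X} (h : HasFiniteLength Γ) :
    μH[1] Γ ≠ ⊤ := by
  obtain ⟨γ, rfl, hl⟩ := h
  have hb : BoundedVariationOn γ.toFun (Icc γ.a γ.b) := hl
  have hlb := hb.locallyBoundedVariationOn
  have ha : γ.a ∈ Icc γ.a γ.b := left_mem_Icc.2 γ.hab
  set v := variationOnFromTo γ.toFun (Icc γ.a γ.b) γ.a
  have hdist : ∀ s ∈ Icc γ.a γ.b, ∀ t ∈ Icc γ.a γ.b,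
      dist (γ.toFun s) (γ.toFun t) ≤ dist (v s) (v t) := by
    have main : ∀ s ∈ Icc γ.a γ.b, ∀ t ∈ Icc γ.a γ.b, s ≤ t →
        dist (γ.toFun s) (γ.toFun t) ≤ dist (v s) (v t) := by
      intro s hs t ht hst
      have e := variationOnFromTo.add hlb ha hs ht
      have e2 := variationOnFromTo.edist_zero_of_eq_zero hlb hs ht
      have e3 := hlb s t hs ht
      have e4 := eVariationOn.edist_le γ.toFun (s := Icc γ.a γ.b ∩ Icc s t)
        ⟨hs, left_mem_Icc.2 hst⟩ ⟨ht, right_mem_Icc.2 hst⟩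
      have e5 : dist (γ.toFun s) (γ.toFun t) ≤ variationOnFromTo γ.toFun (Icc γ.a γ.b) s t := by
        rw [variationOnFromTo.eq_of_le _ _ hst, dist_edist]
        exact ENNReal.toReal_mono e3 e4
      rw [dist_comm (v s), Real.dist_eq]
      refine (e5.trans ?_).trans (le_abs_self _)
      simp only [v]
      linarith
    intro s hs t ht
    rcases le_total s t with h' | h'
    · exact main s hs t ht h'
    · rw [dist_comm, dist_comm (v s)]
      exact main t ht s hs h'
  have hw : ∀ r : ℝ, ∃ s, r ∈ v '' Icc γ.a γ.b → s ∈ Icc γ.a γ.b ∧ v s = r := by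
    intro r
    by_cases hr : r ∈ v '' Icc γ.a γ.b
    · obtain ⟨s, hs, hsr⟩ := hr
      exact ⟨s, fun _ => ⟨hs, hsr⟩⟩
    · exact ⟨0, fun h' => absurd h' hr⟩
  choose w hw using hw
  have hL : LipschitzOnWith 1 (fun r => γ.toFun (w r)) (v '' Icc γ.a γ.b) := by
    refine LipschitzOnWith.of_dist_le_mul fun r hr s hs => ?_
    have := hdist _ (hw r hr).1 _ (hw s hs).1
    rw [(hw r hr).2, (hw s hs).2] at this
    simpa using this
  have himg : γ.toFun '' Icc γ.a γ.b ⊆ (fun r => γ.toFun (w r)) '' (v '' Icc γ.a γ.b) := by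
    rintro _ ⟨s, hs, rfl⟩
    refine ⟨v s, mem_image_of_mem _ hs, ?_⟩
    have h1 := hw _ (mem_image_of_mem v hs)
    have := hdist _ h1.1 s hs
    rw [h1.2, dist_self] at this
    exact dist_le_zero.1 this
  have hv : v '' Icc γ.a γ.b ⊆ Icc (v γ.a) (v γ.b) := by
    rintro _ ⟨s, hs, rfl⟩
    have hm := variationOnFromTo.monotoneOn hlb ha
    exact ⟨hm ha hs hs.1, hm hs (right_mem_Icc.2 γ.hab) hs.2⟩
  refine ne_top_of_le_ne_top ?_ ((measure_mono himg).trans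
    (hL.hausdorffMeasure_image_le zero_le_one))
  rw [hausdorffMeasure_real]
  exact ENNReal.mul_ne_top (by simp)
    (ne_top_of_le_ne_top (by simp) (measure_mono hv))

end HausdorffOne

section SuperlevelComponents

variable {X : Type*} [MetricSpace X]

theorem HasGeodesics.exists_dist_eq (hg : HasGeodesics X) (x y : X) {r : ℝ} (h0 : 0 ≤ r)
    (hr : r ≤ dist x y) : ∃ z, dist x z = r ∧ dist z y = dist x y - r := by
  obtain ⟨g, h1, h2, h⟩ := hg x y
  have e1 := h 0 ⟨le_rfl, dist_nonneg⟩ r ⟨h0, hr⟩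
  have e2 := h r ⟨h0, hr⟩ _ ⟨dist_nonneg, le_rfl⟩
  refine ⟨g r, ?_, ?_⟩
  · rw [← h1, e1, zero_sub, abs_neg, abs_of_nonneg h0]
  · rw [h2] at e2
    rw [e2, abs_of_nonpos (by linarith)]
    ring

/-- The component of `y` in the set of points at distance at least `t` from `B`. -/
def superComp (B : Set X) (t : ℝ) (y : X) : Set X :=
  connectedComponentIn {z | t ≤ infDist z B} y

variable {B : Set X} {t : ℝ} {x y z : X}

theorem le_infDist_of_mem_superComp (h : z ∈ superComp B t y) : t ≤ infDist z B :=
  connectedComponentIn_subset {z | t ≤ infDist z B} y h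

theorem mem_superComp_self (h : t ≤ infDist y B) : y ∈ superComp B t y :=
  mem_connectedComponentIn h

theorem superComp_eq (h : z ∈ superComp B t y) : superComp B t y = superComp B t z :=
  connectedComponentIn_eq h

theorem superComp_anti {s : ℝ} (h : s ≤ t) : superComp B t y ⊆ superComp B s y :=
  connectedComponentIn_mono _ fun _ hz => h.trans hz

theorem isClosed_superComp : IsClosed (superComp B t y) := by
  by_cases hy : t ≤ infDist y B
  · refine isClosed_of_closure_subset
      (isPreconnected_connectedComponentIn.closure.subset_connectedComponentIn
        (subset_closure (mem_superComp_self hy)) ?_)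
    exact closure_minimal (connectedComponentIn_subset _ _)
      (isClosed_le continuous_const (continuous_infDist_pt B))
  · rw [superComp, connectedComponentIn_eq_empty (F := {z | t ≤ infDist z B}) hy]
    exact isClosed_empty

theorem infDist_abs_sub_le (B : Set X) (x y : X) : |infDist x B - infDist y B| ≤ dist x y := by
  have := (lipschitz_infDist_pt B).dist_le_mul x y
  simpa [Real.dist_eq] using this

theorem HasGeodesics.mem_superComp_of_forall (hg : HasGeodesics X) (hz : z ∈ superComp B t y)
    (h : ∀ w, dist z w + dist w x = dist z x → t ≤ infDist w B) : x ∈ superComp B t y := by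
  obtain ⟨S, -, hS, hzS, hxS, hSd⟩ := hg.exists_segment z x
  rw [superComp_eq hz]
  exact hS.subset_connectedComponentIn hzS (fun w hw => h w (hSd w hw)) hxS

theorem HasGeodesics.mem_superComp_of_dist_le (hg : HasGeodesics X) (hz : z ∈ superComp B t y)
    (h : dist z x ≤ infDist z B - t) : x ∈ superComp B t y := by
  refine hg.mem_superComp_of_forall hz fun w hw => ?_
  have := (le_abs_self _).trans (infDist_abs_sub_le B z w)
  have : (0 : ℝ) ≤ dist w x := dist_nonneg
  linarith

theorem HasGeodesics.exists_mem_superComp_infDist_eq (hg : HasGeodesics X) (hB : IsCompact B)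
    (hne : B.Nonempty) (ht : 0 ≤ t) (hty : t ≤ infDist y B) :
    ∃ s ∈ superComp B t y, infDist s B = t ∧ dist y s = infDist y B - t := by
  obtain ⟨b, hb, hyb⟩ := hB.exists_infDist_eq_dist hne y
  obtain ⟨s, hs1, hs2⟩ := hg.exists_dist_eq y b (r := infDist y B - t) (by linarith) (by linarith)
  refine ⟨s, hg.mem_superComp_of_dist_le (mem_superComp_self hty) hs1.le, ?_, hs1⟩
  have h1 := infDist_le_dist_of_mem (x := s) hb
  have h2 := (le_abs_self _).trans (infDist_abs_sub_le B y s)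
  rw [← hyb] at hs2
  linarith

theorem HasGeodesics.isPreconnected_compl_superComp (hg : HasGeodesics X) (hB : IsCompact B)
    (hne : B.Nonempty) (hBc : IsPreconnected B) (ht : 0 < t) :
    IsPreconnected (superComp B t y)ᶜ := by
  obtain ⟨b₀, hb₀⟩ := hne
  have hBU : B ⊆ (superComp B t y)ᶜ := fun b hb hbC => by
    have := le_infDist_of_mem_superComp hbC
    rw [infDist_zero_of_mem hb] at this
    linarith
  refine isPreconnected_of_forall b₀ fun x hx => ?_
  obtain ⟨b, hb, hxb⟩ := hB.exists_infDist_eq_dist ⟨b₀, hb₀⟩ x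
  obtain ⟨S, -, hS, hxS, hbS, hSd⟩ := hg.exists_segment x b
  refine ⟨S ∪ B, union_subset (fun z hz hzC => hx ?_) hBU, Or.inr hb₀, Or.inl hxS,
    hS.union b hbS hb hBc⟩
  refine hg.mem_superComp_of_forall hzC fun w hw => ?_
  have h1 := (le_abs_self _).trans (infDist_abs_sub_le B x w)
  have h2 := le_infDist_of_mem_superComp hzC
  have h3 := infDist_le_dist_of_mem (x := z) hb
  have h4 := hSd z hz
  have h5 : (0 : ℝ) ≤ dist z w := dist_nonneg
  rw [dist_comm z x, dist_comm w x] at hw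
  linarith

theorem HasGeodesics.superComp_inter_closure_compl (hg : HasGeodesics X) (hB : IsCompact B)
    (hne : B.Nonempty) (ht : 0 < t) :
    superComp B t y ∩ closure (superComp B t y)ᶜ = {z ∈ superComp B t y | infDist z B = t} := by
  ext z
  constructor
  · rintro ⟨hz, hzc⟩
    refine ⟨hz, le_antisymm ?_ (le_infDist_of_mem_superComp hz)⟩
    by_contra! hlt
    obtain ⟨w, hw, hwz⟩ := Metric.mem_closure_iff.1 hzc (infDist z B - t) (by linarith)
    exact hw (hg.mem_superComp_of_dist_le hz hwz.le)
  · rintro ⟨hz, hzt⟩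
    refine ⟨hz, Metric.mem_closure_iff.2 fun δ hδ => ?_⟩
    obtain ⟨b, hb, hzb⟩ := hB.exists_infDist_eq_dist hne z
    have hm : 0 < min (δ / 2) t := lt_min (by linarith) ht
    obtain ⟨w, hw1, hw2⟩ := hg.exists_dist_eq z b (r := min (δ / 2) t) hm.le
      ((min_le_right _ _).trans (by linarith))
    refine ⟨w, fun hwC => ?_, by rw [hw1]; exact (min_le_left _ _).trans_lt (by linarith)⟩
    have h1 := le_infDist_of_mem_superComp hwC
    have h2 := infDist_le_dist_of_mem (x := w) hb
    linarith

theorem HasGeodesics.isPreconnected_superComp_level (hg : HasGeodesics X) (hB : IsCompact B)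
    (hne : B.Nonempty) (hBc : IsPreconnected B)
    (huni : ∀ A C : Set X, IsClosed A → IsClosed C → IsPreconnected A → IsPreconnected C →
      A ∪ C = univ → IsPreconnected (A ∩ C)) (ht : 0 < t) :
    IsPreconnected {z ∈ superComp B t y | infDist z B = t} := by
  rw [← hg.superComp_inter_closure_compl hB hne ht]
  refine huni _ _ isClosed_superComp isClosed_closure isPreconnected_connectedComponentIn
    (hg.isPreconnected_compl_superComp hB hne hBc ht).closure ?_
  exact univ_subset_iff.1 fun z _ => (em (z ∈ superComp B t y)).imp id fun h => subset_closure h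

/-- A segment leaving a superlevel component crosses its level set. -/
theorem HasGeodesics.exists_level_between (hg : HasGeodesics X) (hB : IsCompact B)
    (hne : B.Nonempty) (ht : 0 < t) (hx : x ∈ superComp B t y) (hz : z ∉ superComp B t y) :
    ∃ s ∈ superComp B t y, infDist s B = t ∧ dist x s + dist s z = dist x z := by
  obtain ⟨S, -, hS, hxS, hzS, hSd⟩ := hg.exists_segment x z
  have hne' : (S ∩ (superComp B t y ∩ closure (superComp B t y)ᶜ)).Nonempty := by
    by_contra! hem
    obtain ⟨w, -, hw1, hw2⟩ := hS (interior (superComp B t y)) (superComp B t y)ᶜ isOpen_interior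
      isClosed_superComp.isOpen_compl (fun w hw => by
        by_cases hwC : w ∈ superComp B t y
        · refine Or.inl ?_
          by_contra hwi
          rw [← mem_compl_iff, ← closure_compl] at hwi
          exact (hem.subset ⟨hw, hwC, hwi⟩ : w ∈ (∅ : Set X))
        · exact Or.inr hwC)
      (by
        refine ⟨x, hxS, ?_⟩
        by_contra hwi
        rw [← mem_compl_iff, ← closure_compl] at hwi
        exact (hem.subset ⟨hxS, hx, hwi⟩ : x ∈ (∅ : Set X)))
      ⟨z, hzS, hz⟩
    exact hw2 (interior_subset hw1)
  obtain ⟨s, hs, hsC⟩ := hne'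
  have := (hg.superComp_inter_closure_compl hB hne ht).subset hsC
  exact ⟨s, hsC.1, this.2, hSd s hs⟩

end SuperlevelComponents

section LevelNet

variable {X : Type*} [MetricSpace X]

/-- The level set bounding the superlevel component of `y` has diameter at least `ε`. -/
def LevelBig (B : Set X) (ε t : ℝ) (y : X) : Prop :=
  ∃ p ∈ superComp B t y, ∃ q ∈ superComp B t y,
    infDist p B = t ∧ infDist q B = t ∧ ε ≤ dist p q

/-- `P` is an `ε`-net of `B` together with the points on the levels `t k` which lie only in
superlevel components with big boundary. -/
structure LevelNet (B : Set X) (ε : ℝ) (t : ℕ → ℝ) (P : Set X) : Prop where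
  pos : 0 < ε
  lower : ∀ k : ℕ, k * ε < t k
  upper : ∀ k : ℕ, t k < (k + 1) * ε
  net_base : ∀ b ∈ B, ∃ p ∈ P, dist b p ≤ ε
  net_level : ∀ k z, infDist z B = t k → (∀ j ≤ k, LevelBig B ε (t j) z) → ∃ p ∈ P, dist z p ≤ ε
  mem : ∀ p ∈ P, p ∈ B ∨ ∃ k, infDist p B = t k ∧ ∀ j ≤ k, LevelBig B ε (t j) p

variable {B : Set X} {ε : ℝ} {t : ℕ → ℝ} {P : Set X}

theorem LevelBig.congr {s : ℝ} {y z : X} (h : LevelBig B ε s y) (hz : z ∈ superComp B s y) :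
    LevelBig B ε s z := by
  rw [LevelBig, ← superComp_eq hz]
  exact h

theorem LevelNet.strictMono (D : LevelNet B ε t P) : StrictMono t :=
  strictMono_nat_of_lt_succ fun k => (D.upper k).trans (by exact_mod_cast D.lower (k + 1))

theorem LevelNet.level_pos (D : LevelNet B ε t P) (k : ℕ) : 0 < t k :=
  (mul_nonneg k.cast_nonneg D.pos.le).trans_lt (D.lower k)

theorem LevelNet.exists_dist_le (D : LevelNet B ε t P) (hg : HasGeodesics X) (hB : IsCompact B)
    (hne : B.Nonempty) {z : X} (hz : ∀ i, t i < infDist z B → LevelBig B ε (t i) z) :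
    ∃ p ∈ P, dist z p ≤ 3 * ε := by
  have hε := D.pos
  by_cases h0 : infDist z B ≤ t 0
  · obtain ⟨b, hb, hzb⟩ := hB.exists_infDist_eq_dist hne z
    obtain ⟨p, hp, hbp⟩ := D.net_base b hb
    refine ⟨p, hp, (dist_triangle z b p).trans ?_⟩
    have := D.upper 0
    push_cast at this
    linarith
  · push Not at h0
    have hex : ∃ k, infDist z B ≤ t (k + 1) := by
      obtain ⟨n, hn⟩ := exists_nat_gt (infDist z B / ε)
      refine ⟨n, ?_⟩
      rw [div_lt_iff₀ hε] at hn
      exact hn.le.trans ((D.lower n).le.trans (D.strictMono.monotone n.le_succ))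
    classical
    set k := Nat.find hex with hk
    have hk1 : infDist z B ≤ t (k + 1) := Nat.find_spec hex
    have hk0 : t k < infDist z B := by
      rcases Nat.eq_zero_or_pos k with h | h
      · rw [h]; exact h0
      · have := Nat.find_min hex (m := k - 1) (by omega)
        rw [Nat.sub_add_cancel h] at this
        exact not_le.1 this
    obtain ⟨s, hs, hst, hzs⟩ :=
      hg.exists_mem_superComp_infDist_eq hB hne (D.level_pos k).le hk0.le
    obtain ⟨p, hp, hsp⟩ := D.net_level k s hst fun j hj =>
      (hz j ((D.strictMono.monotone hj).trans_lt hk0)).congr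
        (superComp_anti (D.strictMono.monotone hj) hs)
    refine ⟨p, hp, (dist_triangle z s p).trans ?_⟩
    have h1 := D.lower k
    have h2 := D.upper (k + 1)
    push_cast at h2
    nlinarith

/-- A point enclosed by a small level curve. -/
theorem LevelNet.exists_small (D : LevelNet B ε t P) (hg : HasGeodesics X) (hB : IsCompact B)
    (hne : B.Nonempty) {y : X} (hy : ¬ ∀ i, t i ≤ infDist y B → LevelBig B ε (t i) y) :
    ∃ j, t j ≤ infDist y B ∧ ¬ LevelBig B ε (t j) y ∧
      (∀ i, t i ≤ infDist y B → ¬ LevelBig B ε (t i) y → j ≤ i) ∧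
      (∀ s ∈ superComp B (t j) y, infDist s B = t j → ∃ p ∈ P, dist s p ≤ 3 * ε) ∧
      ∀ p ∈ P, p ∉ superComp B (t j) y := by
  classical
  push Not at hy
  obtain ⟨hj1, hj2⟩ := Nat.find_spec hy
  have hmin : ∀ i, t i ≤ infDist y B → ¬ LevelBig B ε (t i) y → Nat.find hy ≤ i :=
    fun i h1 h2 => Nat.find_min' hy ⟨h1, h2⟩
  generalize Nat.find hy = j at hj1 hj2 hmin
  refine ⟨j, hj1, hj2, hmin, fun s hs hst => ?_, fun p hp hpC => ?_⟩
  · refine D.exists_dist_le hg hB hne fun i hi => ?_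
    rw [hst, D.strictMono.lt_iff_lt] at hi
    have hti := D.strictMono.monotone hi.le
    refine LevelBig.congr (y := y) ?_ (superComp_anti hti hs)
    by_contra hb
    exact absurd (hmin i (hti.trans hj1) hb) (not_le.2 hi)
  · have hpj := le_infDist_of_mem_superComp hpC
    rcases D.mem p hp with hpB | ⟨k, hk, hbig⟩
    · rw [infDist_zero_of_mem hpB] at hpj
      exact absurd hpj (not_le.2 (D.level_pos j))
    · rw [hk, D.strictMono.le_iff_le] at hpj
      apply hj2
      refine (hbig j hpj).congr ?_
      rw [← superComp_eq hpC]
      exact mem_superComp_self hj1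

theorem LevelNet.exists_level_dist_le (D : LevelNet B ε t P) (hg : HasGeodesics X)
    (hB : IsCompact B) (hne : B.Nonempty) {y p : X} {j : ℕ} (hj : t j ≤ infDist y B)
    (hnear : ∀ s ∈ superComp B (t j) y, infDist s B = t j → ∃ p ∈ P, dist s p ≤ 3 * ε)
    (hP : p ∉ superComp B (t j) y) (hmin : ∀ q ∈ P, dist y p ≤ dist y q) :
    ∃ s ∈ superComp B (t j) y, infDist s B = t j ∧ dist s p ≤ 3 * ε := by
  obtain ⟨s, hs, hst, hsd⟩ := hg.exists_level_between hB hne (D.level_pos j)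
    (mem_superComp_self hj) hP
  obtain ⟨q, hq, hsq⟩ := hnear s hs hst
  refine ⟨s, hs, hst, ?_⟩
  have := hmin q hq
  have := dist_triangle y s q
  linarith

theorem dist_lt_of_not_levelBig {s : ℝ} {y p q : X} (h : ¬ LevelBig B ε s y)
    (hp : p ∈ superComp B s y) (hps : infDist p B = s) (hq : q ∈ superComp B s y)
    (hqs : infDist q B = s) : dist p q < ε := by
  by_contra! hle
  exact h ⟨p, hp, q, hq, hps, hqs, hle⟩

theorem LevelNet.dist_nearest_le (D : LevelNet B ε t P) (hg : HasGeodesics X) (hB : IsCompact B)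
    (hne : B.Nonempty) {y y' p p' : X} (hyy : dist y y' ≤ ε) (hp : p ∈ P) (hp' : p' ∈ P)
    (hmin : ∀ q ∈ P, dist y p ≤ dist y q) (hmin' : ∀ q ∈ P, dist y' p' ≤ dist y' q) :
    dist p p' ≤ 10 * ε := by
  have hε := D.pos
  have good : ∀ {z q : X}, (∀ r ∈ P, dist z q ≤ dist z r) →
      (∀ i, t i ≤ infDist z B → LevelBig B ε (t i) z) → dist z q ≤ 3 * ε := by
    intro z q hq h
    obtain ⟨r, hr, hzr⟩ := D.exists_dist_le hg hB hne (z := z) fun i hi => h i hi.le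
    exact (hq r hr).trans hzr
  have outside : ∀ {z z' q q' : X} {j : ℕ}, dist z z' ≤ ε → q' ∈ P →
      (∀ r ∈ P, dist z q ≤ dist z r) →
      (∀ r ∈ P, dist z' q' ≤ dist z' r) → t j ≤ infDist z' B → ¬ LevelBig B ε (t j) z' →
      (∀ s ∈ superComp B (t j) z', infDist s B = t j → ∃ p ∈ P, dist s p ≤ 3 * ε) →
      (∀ p ∈ P, p ∉ superComp B (t j) z') → z ∉ superComp B (t j) z' → dist q q' ≤ 10 * ε := by
    intro z z' q q' j hzz hq' hqm hqm' hj hnb hnear hPC hzC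
    obtain ⟨s₀, hs₀, hst₀, hsq₀⟩ := D.exists_level_dist_le hg hB hne hj hnear (hPC q' hq') hqm'
    obtain ⟨s, hs, hst, hsd⟩ := hg.exists_level_between hB hne (D.level_pos j)
      (mem_superComp_self hj) hzC
    have h1 := dist_lt_of_not_levelBig hnb hs hst hs₀ hst₀
    have h2 := hqm q' hq'
    have h3 := dist_triangle4 z s s₀ q'
    have h4 := dist_triangle_left q q' z
    rw [dist_comm s z, dist_comm z' z] at hsd
    have h5 : (0 : ℝ) ≤ dist z' s := dist_nonneg
    linarith
  by_cases hy : ∀ i, t i ≤ infDist y B → LevelBig B ε (t i) y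
  · by_cases hy' : ∀ i, t i ≤ infDist y' B → LevelBig B ε (t i) y'
    · have h1 := good hmin hy
      have h2 := good hmin' hy'
      have h3 := dist_triangle4 p y y' p'
      rw [dist_comm p y] at h3
      linarith
    · obtain ⟨j, hj, hnb, -, hnear, hPC⟩ := D.exists_small hg hB hne hy'
      refine outside hyy hp' hmin hmin' hj hnb hnear hPC fun hyC => hnb ?_
      refine (hy j (le_infDist_of_mem_superComp hyC)).congr ?_
      rw [← superComp_eq hyC]
      exact mem_superComp_self hj
  · obtain ⟨i, hi, hnbi, himin, hneari, hPCi⟩ := D.exists_small hg hB hne hy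
    by_cases hyC' : y' ∈ superComp B (t i) y
    swap
    · rw [dist_comm]
      exact outside (by rwa [dist_comm]) hp hmin' hmin hi hnbi hneari hPCi hyC'
    have hi' := le_infDist_of_mem_superComp hyC'
    have hnbi' : ¬ LevelBig B ε (t i) y' := fun h => hnbi (h.congr (by
      rw [← superComp_eq hyC']; exact mem_superComp_self hi))
    obtain ⟨j, hj, hnb, hjmin, hnear, hPC⟩ := D.exists_small hg hB hne (y := y')
      fun h => hnbi' (h i hi')
    by_cases hyC : y ∈ superComp B (t j) y'
    swap
    · exact outside hyy hp' hmin hmin' hj hnb hnear hPC hyC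
    have hj' := le_infDist_of_mem_superComp hyC
    have hnb' : ¬ LevelBig B ε (t j) y := fun h => hnb (h.congr (by
      rw [← superComp_eq hyC]; exact mem_superComp_self hj))
    obtain rfl : i = j := le_antisymm (himin j hj' hnb') (hjmin i hi' hnbi')
    obtain ⟨s, hs, hst, hsp⟩ := D.exists_level_dist_le hg hB hne hi hneari (hPCi p hp) hmin
    obtain ⟨s', hs', hst', hsp'⟩ := D.exists_level_dist_le hg hB hne hj hnear (hPC p' hp') hmin'
    rw [← superComp_eq hyC'] at hs'
    have h1 := dist_lt_of_not_levelBig hnbi hs hst hs' hst'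
    have h2 := dist_triangle4 p s s' p'
    rw [dist_comm p s] at h2
    linarith

end LevelNet

section NetCount

variable {X : Type*} [MetricSpace X]

theorem exists_finset_separated_net [CompactSpace X] (S : Set X) {ε : ℝ} (hε : 0 < ε) :
    ∃ P : Finset X, ↑P ⊆ S ∧ (∀ p ∈ P, ∀ q ∈ P, p ≠ q → ε ≤ dist p q) ∧
      ∀ z ∈ S, ∃ p ∈ P, dist z p ≤ ε := by
  lift ε to ℝ≥0 using hε.le
  have hε' : ε ≠ 0 := by exact_mod_cast hε.ne'
  obtain ⟨N, -, hNf, hN⟩ := exists_finite_isCover_of_isCompact (ε := ε / 2)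
    (by positivity) (isCompact_univ (X := X))
  have hpk : packingNumber ε S ≠ ⊤ := by
    have h1 := packingNumber_two_mul_le_externalCoveringNumber (ε / 2) S
    rw [mul_div_cancel₀ _ two_ne_zero] at h1
    refine ne_top_of_le_ne_top ?_ (h1.trans
      (IsCover.externalCoveringNumber_le_encard (hN.anti (subset_univ S))))
    exact hNf.encard_lt_top.ne
  have hfin : (maximalSeparatedSet ε S).Finite := by
    rw [← Set.encard_ne_top_iff, encard_maximalSeparatedSet hpk]
    exact hpk
  refine ⟨hfin.toFinset, by simpa using maximalSeparatedSet_subset, fun p hp q hq hpq => ?_,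
    fun z hz => ?_⟩
  · have : (ε : ℝ≥0∞) < edist p q := isSeparated_maximalSeparatedSet
      (hfin.mem_toFinset.1 hp) (hfin.mem_toFinset.1 hq) hpq
    rw [edist_nndist, ENNReal.coe_lt_coe] at this
    exact_mod_cast this.le
  · obtain ⟨p, hp, hzp⟩ := isCover_maximalSeparatedSet hpk hz
    refine ⟨p, hfin.mem_toFinset.2 hp, ?_⟩
    change edist z p ≤ (ε : ℝ≥0∞) at hzp
    rw [edist_nndist, ENNReal.coe_le_coe] at hzp
    exact_mod_cast hzp

theorem card_mul_le_measure_of_separated [MeasurableSpace X] [BorelSpace X] (μ : Measure X)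
    {P : Finset X} {S : Set X} (hS : MeasurableSet S) {ε : ℝ} {c : ℝ≥0∞}
    (hsep : ∀ p ∈ P, ∀ q ∈ P, p ≠ q → ε ≤ dist p q)
    (hP : ∀ p ∈ P, c ≤ μ (S ∩ ball p (ε / 2))) : P.card * c ≤ μ S := by
  calc (P.card : ℝ≥0∞) * c = ∑ _p ∈ P, c := by simp
    _ ≤ ∑ p ∈ P, μ (S ∩ ball p (ε / 2)) := Finset.sum_le_sum hP
    _ = μ (⋃ p ∈ P, S ∩ ball p (ε / 2)) := by
        refine (measure_biUnion_finset (fun p hp q hq hpq => ?_)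
          fun p _ => hS.inter measurableSet_ball).symm
        refine Disjoint.mono inter_subset_right inter_subset_right (ball_disjoint_ball ?_)
        linarith [hsep p hp q hq hpq]
    _ ≤ μ S := measure_mono (iUnion₂_subset fun _ _ => inter_subset_left)

theorem exists_mem_Ioo_mul_le_setLIntegral {G : ℝ → ℝ≥0∞} (hG : Measurable G) {a b : ℝ}
    (hab : a < b) :
    ∃ t ∈ Ioo a b, ENNReal.ofReal (b - a) * G t ≤ ∫⁻ s in Ioo a b, G s := by
  have hv : (volume : Measure ℝ) (Ioo a b) = ENNReal.ofReal (b - a) := Real.volume_Ioo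
  have h0 : ENNReal.ofReal (b - a) ≠ 0 := by simpa using hab
  obtain ⟨t, ht, h⟩ := exists_le_setLAverage (μ := volume) (s := Ioo a b) (by rwa [hv])
    (by simp) hG.aemeasurable
  refine ⟨t, ht, ?_⟩
  rw [setLAverage_eq, hv] at h
  calc _ ≤ ENNReal.ofReal (b - a) * ((∫⁻ s in Ioo a b, G s) / ENNReal.ofReal (b - a)) := by gcongr
    _ = _ := ENNReal.mul_div_cancel h0 ENNReal.ofReal_ne_top

theorem half_le_hausdorffMeasure_level [MeasurableSpace X] [BorelSpace X] {B : Set X} {ε t : ℝ}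
    {p : X} (hS : IsPreconnected {z ∈ superComp B t p | infDist z B = t})
    (hp : infDist p B = t) (hbig : LevelBig B ε t p) :
    ENNReal.ofReal (ε / 2) ≤ μH[1] ((fun z => infDist z B) ⁻¹' {t} ∩ ball p (ε / 2)) := by
  obtain ⟨a, ha, b, hb, hat, hbt, hab⟩ := hbig
  obtain ⟨q, hq, hqt, hpq⟩ : ∃ q ∈ superComp B t p, infDist q B = t ∧ ε / 2 ≤ dist p q := by
    by_contra! h
    have h1 := h a ha hat
    have h2 := h b hb hbt
    have := dist_triangle_left a b p
    linarith
  refine (ofReal_le_hausdorffMeasure_of_isPreconnected hS (p := p) (q := q)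
    ⟨mem_superComp_self hp.ge, hp⟩ ⟨hq, hqt⟩ hpq).trans (measure_mono ?_)
  exact inter_subset_inter_left _ fun z hz => hz.2

theorem card_mul_le_of_isPreconnected [MeasurableSpace X] [BorelSpace X] {B : Set X}
    (hB : IsClosed B) (hBc : IsPreconnected B) {P : Finset X} (hP : ↑P ⊆ B) {ε : ℝ}
    (hsep : ∀ p ∈ P, ∀ q ∈ P, p ≠ q → ε ≤ dist p q) :
    P.card ≤ 1 ∨ P.card * ENNReal.ofReal (ε / 2) ≤ μH[1] B := by
  rcases Nat.lt_or_ge 1 P.card with h | h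
  · refine Or.inr (card_mul_le_measure_of_separated _ hB.measurableSet hsep fun p hp => ?_)
    obtain ⟨q, hq, hqp⟩ := Finset.exists_mem_ne h p
    refine ofReal_le_hausdorffMeasure_of_isPreconnected hBc (hP hp) (hP hq) ?_
    have := hsep p hp q hq hqp.symm
    linarith [dist_nonneg (x := p) (y := q)]
  · exact Or.inl h

theorem HasGeodesics.exists_finset_net [CompactSpace X] [MeasurableSpace X] [BorelSpace X]
    (hg : HasGeodesics X) {B : Set X} (hB : IsCompact B) (hne : B.Nonempty)
    (hBc : IsPreconnected B)
    (huni : ∀ A C : Set X, IsClosed A → IsClosed C → IsPreconnected A → IsPreconnected C →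
      A ∪ C = univ → IsPreconnected (A ∩ C))
    (hH2 : μH[2] (univ : Set X) ≠ ⊤) (hH1 : μH[1] B ≠ ⊤) :
    ∃ M₀ : ℝ, 0 ≤ M₀ ∧ ∀ ε : ℝ, 0 < ε → ε ≤ 1 → ∃ P : Finset X, P.Nonempty ∧
      P.card * ε ^ 2 ≤ M₀ ∧ (∀ b ∈ B, ∃ p ∈ P, dist b p ≤ ε) ∧
      ∀ y y' : X, ∀ p ∈ P, ∀ p' ∈ P, dist y y' ≤ ε → (∀ q ∈ P, dist y p ≤ dist y q) →
        (∀ q ∈ P, dist y' p' ≤ dist y' q) → dist p p' ≤ 10 * ε := by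
  classical
  have : Nonempty X := hne.to_type
  obtain ⟨G, hGm, hG, hGint⟩ := exists_measurable_level_bound hH2 (lipschitz_infDist_pt B)
  refine ⟨1 + 2 * (μH[1] B).toReal + 4 * (μH[2] (univ : Set X)).toReal, by positivity,
    fun ε hε hε1 => ?_⟩
  have hab : ∀ k : ℕ, (k : ℝ) * ε < (k + 1) * ε := fun k => by nlinarith
  choose t ht htG using fun k : ℕ => exists_mem_Ioo_mul_le_setLIntegral hGm (hab k)
  have hwidth : ∀ k : ℕ, ((k : ℝ) + 1) * ε - k * ε = ε := fun k => by ring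
  simp only [hwidth] at htG
  obtain ⟨P₀, hP₀B, hP₀s, hP₀n⟩ := exists_finset_separated_net B hε
  set Γ : ℕ → Set X := fun k => {z | infDist z B = t k ∧ ∀ j ≤ k, LevelBig B ε (t j) z}
  choose Pk hPk hPks hPkn using fun k => exists_finset_separated_net (Γ k) hε
  obtain ⟨D, hD⟩ : ∃ D : ℝ, ∀ z : X, infDist z B ≤ D := by
    obtain ⟨D, hD⟩ := (isCompact_univ (X := X)).bddAbove_image
      (continuous_infDist_pt B).continuousOn
    exact ⟨D, fun z => hD (mem_image_of_mem _ (mem_univ z))⟩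
  obtain ⟨K₀, hK₀⟩ := exists_nat_gt (D / ε)
  rw [div_lt_iff₀ hε] at hK₀
  set P : Finset X := P₀ ∪ (Finset.range K₀).biUnion Pk with hPdef
  have htpos : ∀ k, 0 < t k := fun k => lt_of_le_of_lt (by positivity) (ht k).1
  have hnet : LevelNet B ε t (P : Set X) := by
    refine ⟨hε, fun k => (ht k).1, fun k => (ht k).2, fun b hb => ?_, fun k z hz hbig => ?_,
      fun p hp => ?_⟩
    · obtain ⟨p, hp, hbp⟩ := hP₀n b hb
      exact ⟨p, by simp [hPdef, hp], hbp⟩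
    · obtain ⟨p, hp, hzp⟩ := hPkn k z ⟨hz, hbig⟩
      refine ⟨p, ?_, hzp⟩
      have hk : k < K₀ := by
        have h1 := (ht k).1
        have h2 := hD z
        rw [hz] at h2
        have : (k : ℝ) * ε < K₀ * ε := by linarith
        exact_mod_cast lt_of_mul_lt_mul_right this hε.le
      simp only [hPdef, Finset.coe_union, mem_union, Finset.mem_coe, Finset.mem_biUnion,
        Finset.mem_range]
      exact Or.inr ⟨k, hk, hp⟩
    · simp only [hPdef, Finset.coe_union, mem_union, Finset.mem_coe, Finset.mem_biUnion,
        Finset.mem_range] at hp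
      rcases hp with hp | ⟨k, -, hp⟩
      · exact Or.inl (hP₀B hp)
      · exact Or.inr ⟨k, hPk k hp⟩
  have hcard0 : (P₀.card : ℝ) * ε ^ 2 ≤ 1 + 2 * (μH[1] B).toReal := by
    rcases card_mul_le_of_isPreconnected hB.isClosed hBc hP₀B hP₀s with h | h
    · have : (P₀.card : ℝ) ≤ 1 := by exact_mod_cast h
      have h2 : ε ^ 2 ≤ 1 := pow_le_one₀ hε.le hε1
      have h3 : (0 : ℝ) ≤ (μH[1] B).toReal := ENNReal.toReal_nonneg
      nlinarith [sq_nonneg ε]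
    · have h' := ENNReal.toReal_mono hH1 h
      rw [ENNReal.toReal_mul, ENNReal.toReal_natCast, ENNReal.toReal_ofReal (by positivity)] at h'
      have : (P₀.card : ℝ) * ε ^ 2 ≤ P₀.card * ε := by
        gcongr
        nlinarith
      linarith
  have hcardk : ∀ k, (Pk k).card * ENNReal.ofReal (ε / 2) * ENNReal.ofReal ε ≤
      ∫⁻ s in Ioo (k * ε) ((k + 1) * ε), G s := by
    intro k
    refine le_trans ?_ (htG k)
    rw [mul_comm (_ * _)]
    gcongr
    refine le_trans ?_ (hG (t k))
    refine card_mul_le_measure_of_separated _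
      ((isClosed_singleton.preimage (continuous_infDist_pt B)).measurableSet) (hPks k)
      fun p hp => ?_
    exact half_le_hausdorffMeasure_level
      (hg.isPreconnected_superComp_level hB hne hBc huni (htpos k)) (hPk k hp).1
      ((hPk k hp).2 k le_rfl)
  have hsum : ∑ k ∈ Finset.range K₀, (Pk k).card * ENNReal.ofReal (ε / 2) * ENNReal.ofReal ε ≤
      2 * μH[2] (univ : Set X) := by
    refine (Finset.sum_le_sum fun k _ => hcardk k).trans ?_
    rw [← lintegral_biUnion_finset (fun i _ j _ hij => ?_) (fun _ _ => measurableSet_Ioo)]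
    · exact (setLIntegral_le_lintegral _ _).trans hGint
    · have aux : ∀ i j : ℕ, i < j →
          Disjoint (Ioo ((i : ℝ) * ε) ((i + 1) * ε)) (Ioo ((j : ℝ) * ε) ((j + 1) * ε)) := by
        intro i j hij
        rw [Set.disjoint_left]
        intro s hs hs'
        have : (i : ℝ) + 1 ≤ j := by exact_mod_cast hij
        nlinarith [hs.2, hs'.1]
      rcases lt_or_gt_of_ne hij with h | h
      · exact aux i j h
      · exact (aux j i h).symm
  have hcard1 : (∑ k ∈ Finset.range K₀, ((Pk k).card : ℝ)) * ε ^ 2 ≤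
      4 * (μH[2] (univ : Set X)).toReal := by
    have h' := ENNReal.toReal_mono (by finiteness) hsum
    rw [ENNReal.toReal_sum (fun k _ => by finiteness), ENNReal.toReal_mul] at h'
    simp only [ENNReal.toReal_mul, ENNReal.toReal_natCast,
      ENNReal.toReal_ofReal (half_pos hε).le, ENNReal.toReal_ofReal hε.le,
      ENNReal.toReal_ofNat] at h'
    rw [← Finset.sum_mul, ← Finset.sum_mul] at h'
    nlinarith
  refine ⟨P, ?_, ?_, fun b hb => ?_, fun y y' p hp p' hp' hyy hmin hmin' => ?_⟩
  · obtain ⟨b, hb⟩ := hne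
    obtain ⟨p, hp, -⟩ := hP₀n b hb
    exact ⟨p, by simp [hPdef, hp]⟩
  · have h1 : (P.card : ℝ) ≤ P₀.card + ∑ k ∈ Finset.range K₀, ((Pk k).card : ℝ) := by
      exact_mod_cast (Finset.card_union_le _ _).trans
        (Nat.add_le_add_left Finset.card_biUnion_le _)
    have h2 : (P.card : ℝ) * ε ^ 2 ≤
        (P₀.card + ∑ k ∈ Finset.range K₀, ((Pk k).card : ℝ)) * ε ^ 2 := by gcongr
    linarith
  · exact hnet.net_base b hb
  · exact hnet.dist_nearest_le hg hB hne hyy hp hp' hmin hmin'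

end NetCount

section Voronoi

variable {X : Type*} [MetricSpace X] {N : ℕ}

theorem exists_voronoi_index [NeZero N] (p : Fin N → X) (x : X) :
    ∃ k, (∀ l, dist x (p k) ≤ dist x (p l)) ∧ ∀ l, dist x (p l) ≤ dist x (p k) → k ≤ l := by
  obtain ⟨k₀, -, hk₀⟩ := Finset.exists_min_image Finset.univ (fun l => dist x (p l))
    ⟨0, Finset.mem_univ _⟩
  obtain ⟨k, hk, hmin⟩ := Finset.exists_min_image
    (Finset.univ.filter fun l => dist x (p l) ≤ dist x (p k₀)) id ⟨k₀, by simp⟩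
  simp only [Finset.mem_filter, Finset.mem_univ, true_and, id] at hk hmin
  exact ⟨k, fun l => hk.trans (hk₀ l (Finset.mem_univ _)), fun l hl => hmin l (hl.trans hk)⟩

/-- Finitely many points can be joined to their nearest centers by disjoint connected sets. -/
theorem HasGeodesics.exists_voronoi_skeleton (hg : HasGeodesics X) [NeZero N] {p : Fin N → X}
    (hp : Function.Injective p) {V : Set X} (hV : V.Finite) :
    ∃ K : Fin N → Set X, (∀ k, IsCompact (K k)) ∧ (∀ k, IsPreconnected (K k)) ∧
      (∀ k l, k ≠ l → Disjoint (K k) (K l)) ∧ (∀ v ∈ V, ∃ k, v ∈ K k) ∧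
      ∀ k, ∀ x ∈ K k, ∀ l, dist x (p k) ≤ dist x (p l) := by
  choose vor hvor hvor' using exists_voronoi_index p
  choose S hSc hSp hSx hSy hSd using hg.exists_segment
  have hself : ∀ k, vor (p k) = k := fun k => by
    have := hvor (p k) k
    rw [dist_self] at this
    exact (hp (dist_le_zero.1 this)).symm
  have hseg : ∀ x, ∀ z ∈ S (p (vor x)) x, vor z = vor x := by
    intro x z hz
    have hd := hSd _ _ z hz
    rw [dist_comm _ z, dist_comm z x, dist_comm _ x] at hd
    have key : ∀ l, dist x (p l) - dist x z ≤ dist z (p l) := fun l => by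
      linarith [dist_triangle x z (p l)]
    have h1 := hvor z (vor x)
    refine le_antisymm (hvor' z _ ?_) (hvor' x _ ?_)
    · linarith [hvor x (vor z), key (vor z)]
    · linarith [key (vor z)]
  have hKv : ∀ k, ∀ z ∈ {p k} ∪ ⋃ x ∈ V ∩ vor ⁻¹' {k}, S (p k) x, vor z = k := by
    rintro k z (rfl | hz)
    · exact hself k
    · obtain ⟨x, ⟨-, rfl⟩, hz⟩ := mem_iUnion₂.1 hz
      exact hseg x z hz
  refine ⟨fun k => {p k} ∪ ⋃ x ∈ V ∩ vor ⁻¹' {k}, S (p k) x, fun k => ?_, fun k => ?_,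
    fun k l hkl => ?_, fun v hv => ⟨vor v, Or.inr ?_⟩, fun k x hx l => ?_⟩
  · exact isCompact_singleton.union ((hV.subset inter_subset_left).isCompact_biUnion
      fun x _ => hSc _ _)
  · refine isPreconnected_of_forall (p k) ?_
    rintro y (rfl | hy)
    · exact ⟨{p k}, subset_union_left, rfl, rfl, isPreconnected_singleton⟩
    · obtain ⟨x, hx, hy⟩ := mem_iUnion₂.1 hy
      exact ⟨S (p k) x, (subset_biUnion_of_mem (u := fun x => S (p k) x) hx).trans
        subset_union_right, hSx _ _, hy, hSp _ _⟩
  · rw [Set.disjoint_left]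
    intro z hz hz'
    exact hkl ((hKv k z hz).symm.trans (hKv l z hz'))
  · exact mem_iUnion₂.2 ⟨v, ⟨hv, rfl⟩, hSy _ _⟩
  · have := hvor x l
    rwa [hKv k x hx] at this

end Voronoi

section GridColoring

open Classical in
/-- Walk from a grid vertex towards the vertices divisible by `M` until `A` is met. -/
def gridDescend (A : ℕ × ℕ → Prop) (M : ℕ) (i j : ℕ) : ℕ × ℕ :=
  if A (i, j) then (i, j)
  else if i % M ≠ 0 then gridDescend A M (i - 1) j
  else if j % M ≠ 0 then gridDescend A M i (j - 1)
  else (i, j)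
termination_by i + j
decreasing_by
  · have : i ≠ 0 := by rintro rfl; simp_all
    omega
  · have : j ≠ 0 := by rintro rfl; simp_all
    omega

variable {A : ℕ × ℕ → Prop} {M : ℕ}

theorem gridDescend_of_mem {i j : ℕ} (h : A (i, j)) : gridDescend A M i j = (i, j) := by
  rw [gridDescend, if_pos h]

theorem gridDescend_pred_left {i j : ℕ} (h : ¬ A (i, j)) (hi : i % M ≠ 0) :
    gridDescend A M i j = gridDescend A M (i - 1) j := by
  rw [gridDescend, if_neg h, if_pos hi]

theorem gridDescend_pred_right {i j : ℕ} (h : ¬ A (i, j)) (hi : i % M = 0) (hj : j % M ≠ 0) :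
    gridDescend A M i j = gridDescend A M i (j - 1) := by
  rw [gridDescend, if_neg h, if_neg (not_not.2 hi), if_pos hj]

/-- Induction along `gridDescend`. -/
theorem gridDescend_induction {m : ℕ}
    (hA : ∀ i j, i ≤ m → j ≤ m → i % M = 0 → j % M = 0 → A (i, j))
    {motive : ℕ → ℕ → Prop} (base : ∀ i j, i ≤ m → j ≤ m → A (i, j) → motive i j)
    (left : ∀ i j, i + 1 ≤ m → j ≤ m → ¬ A (i + 1, j) → (i + 1) % M ≠ 0 → motive i j →
      motive (i + 1) j)
    (right : ∀ i j, i ≤ m → j + 1 ≤ m → ¬ A (i, j + 1) → i % M = 0 → (j + 1) % M ≠ 0 →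
      motive i j → motive i (j + 1)) :
    ∀ i j, i ≤ m → j ≤ m → motive i j := by
  suffices ∀ n i j, i + j = n → i ≤ m → j ≤ m → motive i j from
    fun i j hi hj => this _ i j rfl hi hj
  intro n
  induction n with
  | zero =>
    intro i j hij hi hj
    obtain rfl : i = 0 := by omega
    obtain rfl : j = 0 := by omega
    exact base 0 0 hi hj (hA 0 0 hi hj (Nat.zero_mod M) (Nat.zero_mod M))
  | succ n ih =>
    intro i j hij hi hj
    by_cases h : A (i, j)
    · exact base i j hi hj h
    by_cases hiM : i % M = 0
    · by_cases hjM : j % M = 0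
      · exact base i j hi hj (hA i j hi hj hiM hjM)
      · rcases j with _ | j
        · simp at hjM
        · exact right i j hi hj h hiM hjM (ih i j (by omega) hi (by omega))
    · rcases i with _ | i
      · simp at hiM
      · exact left i j hi hj h hiM (ih i j (by omega) (by omega) hj)

theorem gridDescend_spec {m : ℕ}
    (hA : ∀ i j, i ≤ m → j ≤ m → i % M = 0 → j % M = 0 → A (i, j)) :
    ∀ i j, i ≤ m → j ≤ m → A (gridDescend A M i j) ∧
      (i / M * M ≤ (gridDescend A M i j).1 ∧ (gridDescend A M i j).1 ≤ i) ∧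
      (j / M * M ≤ (gridDescend A M i j).2 ∧ (gridDescend A M i j).2 ≤ j) := by
  have hdiv : ∀ i, (i + 1) % M ≠ 0 → (i + 1) / M = i / M := fun i h => by
    rw [Nat.succ_div, if_neg (fun hd => h (Nat.mod_eq_zero_of_dvd hd)), add_zero]
  refine gridDescend_induction hA (fun i j hi hj h => ?_) (fun i j hi hj h hiM ih => ?_)
    fun i j hi hj h hiM hjM ih => ?_
  · rw [gridDescend_of_mem h]
    exact ⟨h, ⟨Nat.div_mul_le_self i M, le_rfl⟩, Nat.div_mul_le_self j M, le_rfl⟩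
  · rw [gridDescend_pred_left h hiM, Nat.add_sub_cancel, hdiv i hiM]
    exact ⟨ih.1, ⟨ih.2.1.1, by omega⟩, ih.2.2⟩
  · rw [gridDescend_pred_right h hiM hjM, Nat.add_sub_cancel, hdiv j hjM]
    exact ⟨ih.1, ih.2.1, ih.2.2.1, by omega⟩

/-- The grid vertices adjacent to a point of `m • K`. -/
def gridNear (m : ℕ) (K : Set (ℝ × ℝ)) (v : ℕ × ℕ) : Prop :=
  ∃ x ∈ K, abs ((v.1 : ℝ) - m * x.1) < 1 ∧ abs ((v.2 : ℝ) - m * x.2) < 1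

theorem eq_floor_or_of_abs_sub_lt {n : ℕ} {s : ℝ} (hs : 0 ≤ s) (h : abs ((n : ℝ) - s) < 1) :
    n = ⌊s⌋₊ ∨ n = ⌊s⌋₊ + 1 := by
  rw [abs_lt] at h
  have h1 : n < ⌊s⌋₊ + 2 := by
    have := Nat.lt_floor_add_one s
    have h3 : (n : ℝ) < ⌊s⌋₊ + 2 := by linarith
    exact_mod_cast h3
  have h2 : ⌊s⌋₊ < n + 1 := by
    rw [Nat.floor_lt hs]
    push_cast
    linarith
  omega

theorem abs_floor_sub_lt {s : ℝ} (hs : 0 ≤ s) : abs ((⌊s⌋₊ : ℝ) - s) < 1 := by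
  rw [abs_lt]
  constructor <;> linarith [Nat.floor_le hs, Nat.lt_floor_add_one s]

theorem gridNear_constant {m : ℕ} {K : Set (ℝ × ℝ)} (hKc : IsPreconnected K)
    (hK : K ⊆ Icc 0 1) (g : ℕ × ℕ → ZMod 2)
    (hh : ∀ i j, i < m → j ≤ m → gridNear m K (i, j) → gridNear m K (i + 1, j) →
      g (i, j) = g (i + 1, j))
    (hv : ∀ i j, i ≤ m → j < m → gridNear m K (i, j) → gridNear m K (i, j + 1) →
      g (i, j) = g (i, j + 1)) {v w : ℕ × ℕ} (hvK : gridNear m K v) (hwK : gridNear m K w) :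
    g v = g w := by
  set fl : ℝ × ℝ → ℕ × ℕ := fun x => (⌊m * x.1⌋₊, ⌊m * x.2⌋₊) with hfl
  have hnn : ∀ x ∈ K, 0 ≤ m * x.1 ∧ 0 ≤ m * x.2 := fun x hx =>
    ⟨mul_nonneg m.cast_nonneg (hK hx).1.1, mul_nonneg m.cast_nonneg (hK hx).1.2⟩
  have hlem : ∀ (n : ℕ) (y : ℝ), y ≤ 1 → abs ((n : ℝ) - m * y) < 1 → n ≤ m := fun n y hy h => by
    have h1 := (abs_lt.1 h).2
    have h2 : (m : ℝ) * y ≤ m := mul_le_of_le_one_right m.cast_nonneg hy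
    have h3 : (n : ℝ) < m + 1 := by linarith
    exact Nat.lt_succ_iff.1 (by exact_mod_cast h3)
  have hnear : ∀ x ∈ K, ∀ i j : ℕ, abs ((i : ℝ) - m * x.1) < 1 → abs ((j : ℝ) - m * x.2) < 1 →
      g (i, j) = g (fl x) := by
    intro x hx i j hi hj
    obtain ⟨h1, h2⟩ := hnn x hx
    have a1 := abs_floor_sub_lt h1
    have a2 := abs_floor_sub_lt h2
    have hi' := hlem i _ (hK hx).2.1 hi
    have hj' := hlem j _ (hK hx).2.2 hj
    have hf1 := hlem _ _ (hK hx).2.1 a1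
    have e1 : g (i, j) = g (⌊m * x.1⌋₊, j) := by
      rcases eq_floor_or_of_abs_sub_lt h1 hi with h | h
      · rw [h]
      · rw [h]
        rw [h] at hi hi'
        exact (hh _ _ (Nat.lt_of_succ_le hi') hj' ⟨x, hx, a1, hj⟩ ⟨x, hx, hi, hj⟩).symm
    have e2 : g (⌊m * x.1⌋₊, j) = g (⌊m * x.1⌋₊, ⌊m * x.2⌋₊) := by
      rcases eq_floor_or_of_abs_sub_lt h2 hj with h | h
      · rw [h]
      · rw [h]
        rw [h] at hj hj'
        exact (hv _ _ hf1 (Nat.lt_of_succ_le hj') ⟨x, hx, a1, a2⟩ ⟨x, hx, a1, hj⟩).symm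
    exact e1.trans e2
  obtain ⟨x, hx, hvx1, hvx2⟩ := hvK
  obtain ⟨y, hy, hwy1, hwy2⟩ := hwK
  rw [hnear x hx v.1 v.2 hvx1 hvx2, hnear y hy w.1 w.2 hwy1 hwy2]
  have hcont : ContinuousOn (fun z => decide (g (fl z) = g (fl x))) K := by
    intro z hz
    obtain ⟨h1, h2⟩ := hnn z hz
    have hev : ∀ᶠ z' : ℝ × ℝ in 𝓝 z, abs ((⌊m * z.1⌋₊ : ℝ) - m * z'.1) < 1 ∧
        abs ((⌊m * z.2⌋₊ : ℝ) - m * z'.2) < 1 := by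
      refine Filter.Eventually.and ?_ ?_
      · exact (by fun_prop : Continuous fun z' : ℝ × ℝ =>
          abs ((⌊m * z.1⌋₊ : ℝ) - m * z'.1)).continuousAt.eventually_lt
          continuousAt_const (abs_floor_sub_lt h1)
      · exact (by fun_prop : Continuous fun z' : ℝ × ℝ =>
          abs ((⌊m * z.2⌋₊ : ℝ) - m * z'.2)).continuousAt.eventually_lt
          continuousAt_const (abs_floor_sub_lt h2)
    refine (continuousWithinAt_const (b := decide (g (fl z) = g (fl x)))).congr_of_eventuallyEq
      ?_ rfl
    filter_upwards [nhdsWithin_le_nhds hev, self_mem_nhdsWithin] with z' hz' hz'K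
    rw [← hnear z' hz'K _ _ hz'.1 hz'.2]
  have := hKc.constant hcont hx hy
  exact Eq.symm (by simpa using this)

theorem exists_grid_coloring {N : ℕ} [NeZero N] {K : Fin N → Set (ℝ × ℝ)}
    (hKc : ∀ k, IsCompact (K k)) (hKp : ∀ k, IsPreconnected (K k))
    (hKd : ∀ k l, k ≠ l → Disjoint (K k) (K l)) (hK : ∀ k, K k ⊆ Icc 0 1) {n : ℕ} (hn : 0 < n)
    (hcov : ∀ a b : ℕ, a ≤ n → b ≤ n → ∃ k, ((a / n, b / n) : ℝ × ℝ) ∈ K k) (m₀ : ℕ) :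
    ∃ m, m₀ ≤ m ∧ 0 < m ∧ ∃ col : ℕ × ℕ → Fin N,
      (∀ g : ℕ × ℕ → ZMod 2,
        (∀ i j, i < m → j ≤ m → col (i, j) = col (i + 1, j) → g (i, j) = g (i + 1, j)) →
        (∀ i j, i ≤ m → j < m → col (i, j) = col (i, j + 1) → g (i, j) = g (i, j + 1)) →
        ∀ k, ∃ c, ∀ i j, i ≤ m → j ≤ m → col (i, j) = k → g (i, j) = c) ∧
      ∀ i j : ℕ, i ≤ m → j ≤ m →
        ∃ x ∈ K (col (i, j)), dist ((i / m, j / m) : ℝ × ℝ) x ≤ 2 / n := by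
  classical
  have hsep : ∀ k l, ∃ r : ℝ, 0 < r ∧ (k ≠ l → ∀ x ∈ K k, ∀ y ∈ K l, r ≤ dist x y) := by
    intro k l
    by_cases hkl : k = l
    · exact ⟨1, one_pos, fun h => absurd hkl h⟩
    · obtain ⟨r, hr, h⟩ := Metric.exists_pos_forall_lt_edist (hKc k) (hKc l).isClosed (hKd k l hkl)
      refine ⟨r, by exact_mod_cast hr, fun _ x hx y hy => ?_⟩
      have := h x hx y hy
      rw [edist_nndist, ENNReal.coe_lt_coe] at this
      exact_mod_cast this.le
  choose r hr hrs using hsep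
  obtain ⟨ρ, hρ, hρr⟩ : ∃ ρ : ℝ, 0 < ρ ∧ ∀ k l, ρ ≤ r k l := by
    obtain ⟨q, -, hq⟩ := Finset.exists_min_image (Finset.univ : Finset (Fin N × Fin N))
      (fun q => r q.1 q.2) ⟨(0, 0), Finset.mem_univ _⟩
    exact ⟨_, hr q.1 q.2, fun k l => hq (k, l) (Finset.mem_univ _)⟩
  obtain ⟨M₁, hM₁⟩ := exists_nat_gt (2 / ρ)
  set M := M₁ + m₀ + 1 with hMdef
  have hM : 0 < M := by omega
  set m := n * M with hm
  have hMm : M ≤ m := Nat.le_mul_of_pos_left _ hn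
  have hm0 : 0 < m := hM.trans_le hMm
  have hmR : (0 : ℝ) < m := by exact_mod_cast hm0
  have hnR : (0 : ℝ) < n := by exact_mod_cast hn
  have hMR : (0 : ℝ) < M := by exact_mod_cast hM
  have hmnM : (m : ℝ) = n * M := by rw [hm]; push_cast; ring
  have hmρ : 2 < m * ρ := by
    rw [div_lt_iff₀ hρ] at hM₁
    have : (M₁ : ℝ) ≤ m := by exact_mod_cast (show M₁ ≤ m by omega)
    nlinarith
  have huniq : ∀ k l v, gridNear m (K k) v → gridNear m (K l) v → k = l := by
    rintro k l v ⟨x, hx, hx1, hx2⟩ ⟨y, hy, hy1, hy2⟩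
    by_contra hkl
    have h1 := (hρr k l).trans (hrs k l hkl x hx y hy)
    have haux : ∀ a s t : ℝ, abs (a - m * s) < 1 → abs (a - m * t) < 1 → dist s t < ρ := by
      intro a s t hs ht
      rw [abs_lt] at hs ht
      rw [Real.dist_eq, abs_lt]
      constructor <;> nlinarith
    have h2 : dist x y < ρ := by
      rw [Prod.dist_eq]
      exact max_lt (haux _ _ _ hx1 hy1) (haux _ _ _ hx2 hy2)
    linarith
  set A : ℕ × ℕ → Prop := fun v => ∃ k, gridNear m (K k) v with hAdef
  have hA : ∀ i j, i ≤ m → j ≤ m → i % M = 0 → j % M = 0 → A (i, j) := by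
    intro i j hi hj hiM hjM
    obtain ⟨a, rfl⟩ := Nat.dvd_of_mod_eq_zero hiM
    obtain ⟨b, rfl⟩ := Nat.dvd_of_mod_eq_zero hjM
    rw [hm, mul_comm n M] at hi hj
    obtain ⟨k, hk⟩ := hcov a b (le_of_mul_le_mul_left hi hM) (le_of_mul_le_mul_left hj hM)
    refine ⟨k, _, hk, ?_, ?_⟩
    · have : ((M * a : ℕ) : ℝ) - m * (a / n) = 0 := by
        rw [hmnM]; push_cast; field_simp; ring
      rw [this]; simp
    · have : ((M * b : ℕ) : ℝ) - m * (b / n) = 0 := by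
        rw [hmnM]; push_cast; field_simp; ring
      rw [this]; simp
  have hspec := gridDescend_spec hA
  have hch : ∀ v, ∃ k, A v → gridNear m (K k) v := fun v => by
    by_cases h : A v
    · obtain ⟨k, hk⟩ := h
      exact ⟨k, fun _ => hk⟩
    · exact ⟨0, fun h' => absurd h' h⟩
  choose colA hcolA using hch
  refine ⟨m, by omega, hm0, fun v => colA (gridDescend A M v.1 v.2), fun g hgh hgv k => ?_,
    fun i j hi hj => ?_⟩
  · have hcolnear : ∀ k i j, gridNear m (K k) (i, j) → colA (gridDescend A M i j) = k := by
      intro k i j h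
      rw [gridDescend_of_mem (A := A) ⟨k, h⟩]
      exact huniq _ _ _ (hcolA _ ⟨k, h⟩) h
    have hgd : ∀ i j, i ≤ m → j ≤ m → g (i, j) = g (gridDescend A M i j) := by
      refine gridDescend_induction hA (fun i j hi hj h => ?_) (fun i j hi hj h hiM ih => ?_)
        fun i j hi hj h hiM hjM ih => ?_
      · rw [gridDescend_of_mem h]
      · have e := gridDescend_pred_left h hiM
        rw [Nat.add_sub_cancel] at e
        rw [e, ← ih]
        exact (hgh i j (by omega) hj (congrArg colA e).symm).symm
      · have e := gridDescend_pred_right h hiM hjM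
        rw [Nat.add_sub_cancel] at e
        rw [e, ← ih]
        exact (hgv i j hi (by omega) (congrArg colA e).symm).symm
    have hconst : ∀ v w, gridNear m (K k) v → gridNear m (K k) w → g v = g w := fun v w hv hw =>
      gridNear_constant (hKp k) (hK k) g
        (fun i j hi hj h h' => hgh i j hi hj ((hcolnear k _ _ h).trans (hcolnear k _ _ h').symm))
        (fun i j hi hj h h' => hgv i j hi hj ((hcolnear k _ _ h).trans
          (hcolnear k _ _ h').symm)) hv hw
    by_cases hk : ∃ v, gridNear m (K k) v
    · obtain ⟨v, hv⟩ := hk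
      refine ⟨g v, fun i j hi hj hij => ?_⟩
      rw [hgd i j hi hj]
      refine hconst _ _ ?_ hv
      have := hcolA _ (hspec i j hi hj).1
      change colA (gridDescend A M i j) = k at hij
      rwa [hij] at this
    · refine ⟨0, fun i j hi hj hij => absurd ⟨gridDescend A M i j, ?_⟩ hk⟩
      have := hcolA _ (hspec i j hi hj).1
      change colA (gridDescend A M i j) = k at hij
      rwa [hij] at this
  · obtain ⟨hAd, ⟨h1, h2⟩, h3, h4⟩ := hspec i j hi hj
    obtain ⟨x, hx, hx1, hx2⟩ := hcolA _ hAd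
    refine ⟨x, hx, ?_⟩
    have haux : ∀ (i i' : ℕ) (s : ℝ), i / M * M ≤ i' → i' ≤ i → abs ((i' : ℝ) - m * s) < 1 →
        dist ((i : ℝ) / m) s ≤ 2 / n := by
      intro i i' s hl hu hs
      have hlt : i < i' + M := by
        have := Nat.div_add_mod i M
        have := Nat.mod_lt i hM
        rw [mul_comm] at hl
        omega
      have hlt' : (i : ℝ) + 1 ≤ i' + M := by exact_mod_cast hlt
      have hu' : (i' : ℝ) ≤ i := by exact_mod_cast hu
      have hM1 : (1 : ℝ) ≤ M := by exact_mod_cast hM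
      rw [abs_lt] at hs
      have e : (i : ℝ) / m - s = (i - m * s) / m := by field_simp
      have e2 : (2 : ℝ) / n = 2 * M / m := by rw [hmnM]; field_simp
      rw [Real.dist_eq, e, abs_div, abs_of_pos hmR, e2]
      gcongr
      rw [abs_le]
      constructor <;> linarith
    rw [Prod.dist_eq]
    exact max_le (haux _ _ _ h1 h2 hx1) (haux _ _ _ h3 h4 hx2)

end GridColoring

theorem HasGeodesics.exists_nearest_coloring {X : Type*} [MetricSpace X] (hg : HasGeodesics X)
    {N : ℕ} [NeZero N] {p : Fin N → X} (hp : Function.Injective p) {Φ : ℝ × ℝ → X}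
    {Ψ : X → ℝ × ℝ} (hΦ : ContinuousOn Φ (Icc 0 1)) (hΨ : Continuous Ψ)
    (hΨI : ∀ x, Ψ x ∈ Icc 0 1) (hΦΨ : ∀ x, Φ (Ψ x) = x) (hΨΦ : ∀ u ∈ Icc 0 1, Ψ (Φ u) = u)
    {η : ℝ} (hη : 0 < η) (m₀ : ℕ) :
    ∃ m, m₀ ≤ m ∧ 0 < m ∧ ∃ col : ℕ × ℕ → Fin N,
      (∀ g : ℕ × ℕ → ZMod 2,
        (∀ i j, i < m → j ≤ m → col (i, j) = col (i + 1, j) → g (i, j) = g (i + 1, j)) →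
        (∀ i j, i ≤ m → j < m → col (i, j) = col (i, j + 1) → g (i, j) = g (i, j + 1)) →
        ∀ k, ∃ c, ∀ i j, i ≤ m → j ≤ m → col (i, j) = k → g (i, j) = c) ∧
      ∀ i j : ℕ, i ≤ m → j ≤ m →
        ∃ y, dist (Φ (i / m, j / m)) y ≤ η ∧ ∀ l, dist y (p (col (i, j))) ≤ dist y (p l) := by
  have hunif := isCompact_Icc.uniformContinuousOn_of_continuous hΦ
  obtain ⟨δ, hδ, hδΦ⟩ := Metric.uniformContinuousOn_iff.1 hunif η hη
  obtain ⟨n, hn⟩ := exists_nat_gt (2 / δ)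
  have hn0 : (0 : ℝ) < n := (by positivity : 0 < 2 / δ).trans hn
  have hnδ : 2 / (n : ℝ) < δ := by
    rw [div_lt_iff₀ hδ] at hn
    rw [div_lt_iff₀ hn0]
    linarith
  have hmem : ∀ {a b n : ℕ}, a ≤ n → b ≤ n → ((a / n, b / n) : ℝ × ℝ) ∈ Icc (0 : ℝ × ℝ) 1 := by
    intro a b n ha hb
    have h : ∀ {a : ℕ}, a ≤ n → (a : ℝ) / n ≤ 1 := fun h =>
      div_le_one_of_le₀ (by exact_mod_cast h) (Nat.cast_nonneg _)
    exact ⟨⟨by positivity, by positivity⟩, h ha, h hb⟩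
  set V : Set X := (fun q : ℕ × ℕ => Φ (q.1 / n, q.2 / n)) '' (Iic n ×ˢ Iic n)
  have hV : V.Finite := ((finite_Iic n).prod (finite_Iic n)).image _
  obtain ⟨K, hKc, hKp, hKd, hKV, hKn⟩ := hg.exists_voronoi_skeleton hp hV
  have hinj : Function.Injective Ψ := Function.LeftInverse.injective hΦΨ
  obtain ⟨m, hm₀, hm, col, hcol, hdist⟩ := exists_grid_coloring (K := fun k => Ψ '' K k)
    (fun k => (hKc k).image hΨ) (fun k => (hKp k).image _ hΨ.continuousOn)
    (fun k l hkl => (disjoint_image_iff hinj).2 (hKd k l hkl))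
    (fun k => image_subset_iff.2 fun x _ => hΨI x) (n := n) (by exact_mod_cast hn0)
    (fun a b ha hb => by
      obtain ⟨k, hk⟩ := hKV _ ⟨(a, b), ⟨ha, hb⟩, rfl⟩
      exact ⟨k, _, hk, hΨΦ _ (hmem ha hb)⟩) m₀
  refine ⟨m, hm₀, hm, col, hcol, fun i j hi hj => ?_⟩
  obtain ⟨_, ⟨y, hy, rfl⟩, hxy⟩ := hdist i j hi hj
  refine ⟨y, ?_, hKn _ y hy⟩
  have := hδΦ _ (hmem hi hj) _ (hΨI y) (hxy.trans_lt hnδ)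
  rw [hΦΨ] at this
  exact this.le

section Reparametrization

open intervalIntegral in
/-- A closed curve of finite length can be reparametrized to be Lipschitz. -/
theorem exists_lipschitz_reparametrization {X : Type*} [MetricSpace X] [MeasurableSpace X]
    [BorelSpace X] {f : ℝ → X} (hf : Continuous f) {a b : ℝ} (hab : a < b) {θ : X → ℝ}
    (hθ : Measurable θ) (hθf : ∀ t ∈ Ioc a b, θ (f t) = t)
    (hlen : μH[1] (f '' Ioc a b) ≠ ⊤) :
    ∃ τ : ℝ → ℝ, BijOn τ (Ioc a b) (Ioc a b) ∧ τ a = a ∧ τ b = b ∧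
      ∃ K : ℝ, 0 ≤ K ∧ ∀ s ∈ Icc a b, ∀ t ∈ Icc a b, s ≤ t →
        dist (f (τ s)) (f (τ t)) ≤ K * (t - s) := by
  have hna : NullSingletonClass (μH[1] : Measure X) :=
    Measure.nullSingletonClass_hausdorff X one_pos
  set ν : Measure ℝ := (μH[1].restrict (f '' Ioc a b)).map θ with hνdef
  have hν : ∀ A, MeasurableSet A → ν A = μH[1] (f '' (A ∩ Ioc a b)) := by
    intro A hA
    rw [hνdef, Measure.map_apply hθ hA, Measure.restrict_apply (hθ hA)]
    congr 1
    ext x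
    constructor
    · rintro ⟨hx, t, ht, rfl⟩
      rw [mem_preimage, hθf t ht] at hx
      exact ⟨t, ⟨hx, ht⟩, rfl⟩
    · rintro ⟨t, ⟨hx, ht⟩, rfl⟩
      refine ⟨?_, t, ht, rfl⟩
      rwa [mem_preimage, hθf t ht]
  have : IsFiniteMeasure ν := ⟨by
    rw [hν _ MeasurableSet.univ, univ_inter]
    exact hlen.lt_top⟩
  have : NullSingletonClass ν := ⟨fun t => by
    rw [hν _ (measurableSet_singleton t)]
    exact ((subsingleton_singleton.anti inter_subset_left).image f).measure_zero _⟩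
  set g : ℝ → ℝ := fun t => t + ∫ _ in a..t, (1 : ℝ) ∂ν with hg
  have hone : ∀ s t, IntervalIntegrable (fun _ => (1 : ℝ)) ν s t := fun s t =>
    intervalIntegrable_const
  have hgc : Continuous g := continuous_id.add (continuous_primitive hone a)
  have hgsub : ∀ s t, s ≤ t → g t - g s = t - s + ν.real (Ioc s t) := by
    intro s t hst
    have h1 := integral_interval_sub_left (hone a t) (hone a s)
    rw [intervalIntegral.integral_of_le hst] at h1
    simp only [hg]
    simp only [MeasureTheory.integral_const, smul_eq_mul, mul_one,
      measureReal_restrict_apply_univ] at h1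
    linarith
  have hmono : StrictMono g := fun s t hst => by
    have := hgsub s t hst.le
    have h2 : 0 ≤ ν.real (Ioc s t) := measureReal_nonneg
    linarith
  have hsurj : Function.Surjective g := by
    refine hgc.surjective ?_ ?_
    · refine tendsto_atTop_mono' atTop ?_ (tendsto_atTop_add_const_right _ (g a - a) tendsto_id)
      filter_upwards [eventually_ge_atTop a] with t ht
      have := hgsub a t ht
      have h2 : 0 ≤ ν.real (Ioc a t) := measureReal_nonneg
      simp only [id]
      linarith
    · refine tendsto_atBot_mono' atBot ?_ (tendsto_atBot_add_const_right _ (g a - a) tendsto_id)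
      filter_upwards [eventually_le_atBot a] with t ht
      have := hgsub t a ht
      have h2 : 0 ≤ ν.real (Ioc t a) := measureReal_nonneg
      simp only [id]
      linarith
  set G : ℝ ≃o ℝ := hmono.orderIsoOfSurjective g hsurj
  have hGg : ∀ t, G t = g t := fun t => rfl
  have hba : 0 < b - a := sub_pos.2 hab
  have hgab : 0 < g b - g a := sub_pos.2 (hmono hab)
  set Λ : ℝ := (g b - g a) / (b - a) with hΛ
  have hΛ0 : 0 < Λ := div_pos hgab hba
  set τ : ℝ → ℝ := fun s => G.symm (g a + Λ * (s - a)) with hτ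
  have hgτ : ∀ s, g (τ s) = g a + Λ * (s - a) := fun s => G.apply_symm_apply _
  have hτa : τ a = a := hmono.injective (by rw [hgτ]; ring)
  have hτb : τ b = b := hmono.injective (by
    rw [hgτ, hΛ, div_mul_cancel₀ _ hba.ne']; ring)
  have hτm : StrictMono τ := fun s t hst => by
    rw [← hmono.lt_iff_lt, hgτ, hgτ]
    have := mul_lt_mul_of_pos_left (sub_lt_sub_right hst a) hΛ0
    linarith
  refine ⟨τ, ⟨fun s hs => ?_, hτm.injective.injOn, fun t ht => ?_⟩, hτa, hτb, Λ, hΛ0.le, ?_⟩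
  · constructor
    · rw [← hτa]; exact hτm hs.1
    · rw [← hτb]; exact hτm.monotone hs.2
  · have hs : τ (a + (g t - g a) / Λ) = t := hmono.injective (by
      rw [hgτ, add_sub_cancel_left, mul_div_cancel₀ _ hΛ0.ne']; ring)
    refine ⟨_, ⟨?_, ?_⟩, hs⟩
    · rw [← hτm.lt_iff_lt, hs, hτa]; exact ht.1
    · rw [← hτm.le_iff_le, hs, hτb]; exact ht.2
  · intro s hs t ht hst
    have hst' := hτm.monotone hst
    have hsub : Ioc (τ s) (τ t) ⊆ Ioc a b := fun x hx => by
      refine ⟨lt_of_le_of_lt ?_ hx.1, hx.2.trans ?_⟩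
      · rw [← hτa]; exact hτm.monotone hs.1
      · rw [← hτb]; exact hτm.monotone ht.2
    have h1 := hgsub _ _ hst'
    rw [hgτ, hgτ] at h1
    suffices dist (f (τ s)) (f (τ t)) ≤ ν.real (Ioc (τ s) (τ t)) by
      linarith [sub_nonneg.2 hst', mul_sub Λ (t - a) (s - a)]
    have h2 := ofReal_le_hausdorffMeasure_of_isPreconnected
      (isPreconnected_Icc.image f hf.continuousOn) (mem_image_of_mem f (left_mem_Icc.2 hst'))
      (mem_image_of_mem f (right_mem_Icc.2 hst')) le_rfl
    have h3 : f '' Icc (τ s) (τ t) ⊆ {f (τ s)} ∪ f '' Ioc (τ s) (τ t) := by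
      rw [← image_singleton, ← image_union]
      refine image_mono fun x hx => ?_
      rcases hx.1.eq_or_lt with h | h
      · exact Or.inl h.symm
      · exact Or.inr ⟨h, hx.2⟩
    have h4 := h2.trans ((measure_mono (inter_subset_left.trans h3)).trans (measure_union_le _ _))
    rw [measure_singleton, zero_add] at h4
    rw [measureReal_def, hν _ measurableSet_Ioc, inter_eq_left.2 hsub]
    refine (ENNReal.ofReal_le_iff_le_toReal ?_).1 h4
    exact ne_top_of_le_ne_top hlen (measure_mono (image_mono hsub))

end Reparametrization

section Polar

/-- The point of the unit circle at angle `t`. -/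
def circlePoint (t : ℝ) : E2 := !₂[Real.cos t, Real.sin t]

/-- The argument of a point of the plane, in `(-π, π]`. -/
def planeArg (z : E2) : ℝ := Complex.arg ((z 0 : ℂ) + z 1 * Complex.I)

theorem norm_eq_norm_complex (z : E2) : ‖z‖ = ‖(z 0 : ℂ) + z 1 * Complex.I‖ := by
  rw [EuclideanSpace.norm_eq, Complex.norm_add_mul_I]
  simp [Fin.sum_univ_two]

theorem planeArg_mem (z : E2) : planeArg z ∈ Ioc (-Real.pi) Real.pi := Complex.arg_mem_Ioc _

theorem norm_circlePoint (t : ℝ) : ‖circlePoint t‖ = 1 := by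
  rw [EuclideanSpace.norm_eq]
  simp [circlePoint, Fin.sum_univ_two]

theorem continuous_circlePoint : Continuous circlePoint := by
  unfold circlePoint
  fun_prop

theorem planeArg_circlePoint {t : ℝ} (ht : t ∈ Ioc (-Real.pi) Real.pi) :
    planeArg (circlePoint t) = t := by
  have := Complex.arg_cos_add_sin_mul_I ht
  simpa [planeArg, circlePoint] using this

theorem planeArg_smul {r : ℝ} (hr : 0 < r) (z : E2) : planeArg (r • z) = planeArg z := by
  unfold planeArg
  rw [← Complex.arg_real_mul ((z 0 : ℂ) + z 1 * Complex.I) hr]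
  congr 1
  simp
  ring

theorem norm_smul_circlePoint_planeArg (z : E2) : ‖z‖ • circlePoint (planeArg z) = z := by
  have h := Complex.norm_mul_cos_add_sin_mul_I ((z 0 : ℂ) + z 1 * Complex.I)
  rw [← norm_eq_norm_complex] at h
  have hre := congrArg Complex.re h
  have him := congrArg Complex.im h
  simp only [Complex.mul_re, Complex.mul_im, Complex.add_re, Complex.add_im, Complex.ofReal_re,
    Complex.ofReal_im, Complex.I_re, Complex.I_im, Complex.cos_ofReal_re, Complex.cos_ofReal_im,
    Complex.sin_ofReal_re, Complex.sin_ofReal_im, mul_zero, mul_one, zero_mul, sub_zero, add_zero,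
    zero_add] at hre him
  ext i
  fin_cases i
  · simpa [circlePoint, planeArg] using hre
  · simpa [circlePoint, planeArg] using him

theorem measurable_planeArg : Measurable planeArg := by
  unfold planeArg
  refine Complex.measurable_arg.comp (Continuous.measurable ?_)
  fun_prop

theorem le_dist_circlePoint {s t : ℝ} (hst : s ≤ t) (ht : t ≤ s + 2 * Real.pi) :
    2 / Real.pi * min (t - s) (2 * Real.pi - (t - s)) ≤ dist (circlePoint s) (circlePoint t) := by
  have hd : dist (circlePoint s) (circlePoint t) ^ 2 = (2 * Real.sin ((t - s) / 2)) ^ 2 := by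
    rw [EuclideanSpace.dist_eq, Real.sq_sqrt (by positivity), mul_pow, Real.sin_sq_eq_half_sub,
      mul_div_cancel₀ (t - s) two_ne_zero, Real.cos_sub]
    simp only [circlePoint, Fin.sum_univ_two, Real.dist_eq, sq_abs]
    simp
    linarith [Real.sin_sq_add_cos_sq s, Real.sin_sq_add_cos_sq t]
  have hπ := Real.pi_pos
  have hsin : 2 / Real.pi * (min (t - s) (2 * Real.pi - (t - s)) / 2) ≤ Real.sin ((t - s) / 2) := by
    rcases le_total (t - s) (2 * Real.pi - (t - s)) with h | h
    · rw [min_eq_left h]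
      exact Real.mul_le_sin (by linarith) (by linarith)
    · rw [min_eq_right h, ← Real.sin_pi_sub]
      convert Real.mul_le_sin (x := Real.pi - (t - s) / 2) (by linarith) (by linarith) using 2
      ring
  have h0 : 0 ≤ 2 / Real.pi * (min (t - s) (2 * Real.pi - (t - s)) / 2) := by
    have : 0 ≤ min (t - s) (2 * Real.pi - (t - s)) := le_min (by linarith) (by linarith)
    positivity
  rw [sq_eq_sq₀ dist_nonneg (by linarith)] at hd
  rw [hd]
  linarith

end Polar

/-- The homeomorphism from the disc can be chosen Lipschitz on the unit circle. -/
theorem exists_homeomorph_lipschitz_on_circle {X : Type*} [MetricSpace X] [MeasurableSpace X]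
    [BorelSpace X] (φ : ↥unitClosedDisc ≃ₜ X) (hlen : μH[1] (discBoundary φ) ≠ ⊤) :
    ∃ φ' : ↥unitClosedDisc ≃ₜ X, discBoundary φ' = discBoundary φ ∧ ∃ K : ℝ, 0 ≤ K ∧
      ∀ z w : ↥unitClosedDisc, (z : E2) ∈ unitCircle → (w : E2) ∈ unitCircle →
        dist (φ' z) (φ' w) ≤ K * dist z w := by
  have hπ := Real.pi_pos
  have hmemC : ∀ t, circlePoint t ∈ unitClosedDisc := fun t => by
    simp [unitClosedDisc, norm_circlePoint]
  set f : ℝ → X := fun t => φ ⟨circlePoint t, hmemC t⟩ with hfdef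
  have hf : Continuous f := φ.continuous.comp (continuous_circlePoint.subtype_mk _)
  have hθ : Measurable fun x => planeArg (φ.symm x : E2) :=
    measurable_planeArg.comp (continuous_subtype_val.comp φ.symm.continuous).measurable
  have hθf : ∀ t ∈ Ioc (-Real.pi) Real.pi, planeArg (φ.symm (f t) : E2) = t := fun t ht => by
    rw [hfdef]
    simp only [Homeomorph.symm_apply_apply]
    exact planeArg_circlePoint ht
  have hfsub : f '' Ioc (-Real.pi) Real.pi ⊆ discBoundary φ := by
    rintro _ ⟨t, -, rfl⟩
    simp [discBoundary, hfdef, unitCircle, norm_circlePoint]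
  obtain ⟨τ, hτ, hτa, hτb, K, hK, hτK⟩ := exists_lipschitz_reparametrization hf
    (by linarith : -Real.pi < Real.pi) hθ hθf (ne_top_of_le_ne_top hlen (measure_mono hfsub))
  have hends : f (-Real.pi) = f Real.pi := by simp [hfdef, circlePoint]
  set S : E2 → E2 := fun z => ‖z‖ • circlePoint (τ (planeArg z)) with hS
  have hSn : ∀ z, ‖S z‖ = ‖z‖ := fun z => by
    rw [hS, norm_smul, norm_circlePoint, mul_one, norm_norm]
  have hScircle : ∀ z ∈ unitCircle, S z = circlePoint (τ (planeArg z)) := fun z hz => by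
    rw [hS]
    simp only
    rw [mem_sphere_zero_iff_norm.1 hz, one_smul]
  have hlip : ∀ z ∈ unitCircle, ∀ w ∈ unitCircle,
      dist (f (τ (planeArg z))) (f (τ (planeArg w))) ≤ K * (Real.pi / 2) * dist z w := by
    have key : ∀ s ∈ Ioc (-Real.pi) Real.pi, ∀ t ∈ Ioc (-Real.pi) Real.pi, s ≤ t →
        dist (f (τ s)) (f (τ t)) ≤ K * (Real.pi / 2) * dist (circlePoint s) (circlePoint t) := by
      intro s hs t ht hst
      have h1 := le_dist_circlePoint hst (by linarith [hs.1, ht.2])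
      have h2 : min (t - s) (2 * Real.pi - (t - s)) ≤
          Real.pi / 2 * dist (circlePoint s) (circlePoint t) := by
        calc _ = Real.pi / 2 * (2 / Real.pi * min (t - s) (2 * Real.pi - (t - s))) := by
              field_simp
          _ ≤ _ := by gcongr
      rw [mul_assoc]
      refine le_trans ?_ (mul_le_mul_of_nonneg_left h2 hK)
      rcases le_total (t - s) (2 * Real.pi - (t - s)) with h | h
      · rw [min_eq_left h]
        exact hτK s (Ioc_subset_Icc_self hs) t (Ioc_subset_Icc_self ht) hst
      · rw [min_eq_right h]
        have e1 := hτK (-Real.pi) (left_mem_Icc.2 (by linarith)) s (Ioc_subset_Icc_self hs) hs.1.le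
        have e2 := hτK t (Ioc_subset_Icc_self ht) Real.pi (right_mem_Icc.2 (by linarith)) ht.2
        rw [hτa, hends] at e1
        rw [hτb] at e2
        have e3 := dist_triangle (f (τ s)) (f Real.pi) (f (τ t))
        rw [dist_comm (f (τ s)) (f Real.pi), dist_comm (f Real.pi) (f (τ t))] at e3
        linarith [show K * (2 * Real.pi - (t - s)) = K * (s - -Real.pi) + K * (Real.pi - t) by ring]
    intro z hz w hw
    have hz' := norm_smul_circlePoint_planeArg z
    have hw' := norm_smul_circlePoint_planeArg w
    rw [mem_sphere_zero_iff_norm.1 hz, one_smul] at hz'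
    rw [mem_sphere_zero_iff_norm.1 hw, one_smul] at hw'
    rcases le_total (planeArg z) (planeArg w) with h | h
    · have := key _ (planeArg_mem z) _ (planeArg_mem w) h
      rwa [hz', hw'] at this
    · have := key _ (planeArg_mem w) _ (planeArg_mem z) h
      rw [hz', hw'] at this
      rwa [dist_comm, dist_comm z]
  have hfS : ∀ z, (φ.symm (f (τ (planeArg z))) : E2) = circlePoint (τ (planeArg z)) := fun z => by
    simp [hfdef]
  have hσ : ContinuousOn (fun z => circlePoint (τ (planeArg z))) unitCircle := by
    have hc : ContinuousOn (fun z => f (τ (planeArg z))) unitCircle :=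
      (LipschitzOnWith.of_dist_le_mul (K := (K * (Real.pi / 2)).toNNReal) fun z hz w hw => by
        rw [Real.coe_toNNReal _ (by positivity)]
        exact hlip z hz w hw).continuousOn
    have := (continuous_subtype_val.comp φ.symm.continuous).comp_continuousOn hc
    refine this.congr fun z _ => ?_
    exact (hfS z).symm
  have hScont : Continuous S := by
    rw [continuous_iff_continuousAt]
    intro z
    by_cases hz : z = 0
    · have h0 : S z = 0 := by rw [← norm_eq_zero, hSn, hz, norm_zero]
      rw [ContinuousAt, h0, tendsto_zero_iff_norm_tendsto_zero]
      simp only [hSn]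
      simpa [hz] using continuous_norm.tendsto z
    · have hn : ContinuousOn (fun z : E2 => ‖z‖⁻¹ • z) {0}ᶜ :=
        (continuous_norm.continuousOn.inv₀ fun z hz => norm_ne_zero_iff.2 hz).smul continuousOn_id
      have hmaps : MapsTo (fun z : E2 => ‖z‖⁻¹ • z) {0}ᶜ unitCircle := fun z hz => by
        rw [unitCircle, mem_sphere_zero_iff_norm, norm_smul, norm_inv, norm_norm,
          inv_mul_cancel₀ (norm_ne_zero_iff.2 hz)]
      have h1 := continuous_norm.continuousOn.smul (hσ.comp hn hmaps)
      refine (h1.congr fun w hw => ?_).continuousAt (isOpen_compl_singleton.mem_nhds hz)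
      change _ = ‖w‖ • circlePoint (τ (planeArg (‖w‖⁻¹ • w)))
      rw [planeArg_smul (inv_pos.2 (norm_pos_iff.2 hw))]
  have hSinj : Function.Injective S := by
    intro z w hzw
    have hn : ‖z‖ = ‖w‖ := by rw [← hSn z, hzw, hSn]
    by_cases hz : ‖z‖ = 0
    · rw [norm_eq_zero.1 hz, norm_eq_zero.1 (hn.symm.trans hz)]
    · have h1 : circlePoint (τ (planeArg z)) = circlePoint (τ (planeArg w)) := by
        simp only [hS, ← hn] at hzw
        exact (smul_right_inj hz).1 hzw
      have h2 := congrArg planeArg h1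
      rw [planeArg_circlePoint (hτ.mapsTo (planeArg_mem z)),
        planeArg_circlePoint (hτ.mapsTo (planeArg_mem w))] at h2
      rw [← norm_smul_circlePoint_planeArg z, ← norm_smul_circlePoint_planeArg w, hn,
        hτ.injOn (planeArg_mem z) (planeArg_mem w) h2]
  have hSsurj : Function.Surjective S := by
    intro w
    by_cases hw : ‖w‖ = 0
    · refine ⟨0, ?_⟩
      rw [norm_eq_zero.1 hw, ← norm_eq_zero, hSn, norm_zero]
    · obtain ⟨t, ht, htw⟩ := hτ.surjOn (planeArg_mem w)
      refine ⟨‖w‖ • circlePoint t, ?_⟩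
      simp only [hS]
      rw [planeArg_smul ((norm_nonneg w).lt_of_ne' hw), planeArg_circlePoint ht, htw, norm_smul,
        norm_circlePoint, mul_one, norm_norm, norm_smul_circlePoint_planeArg]
  have hSmem : ∀ z, z ∈ unitClosedDisc → S z ∈ unitClosedDisc := fun z hz => by
    rw [unitClosedDisc, mem_closedBall_zero_iff] at hz ⊢
    rwa [hSn]
  set T : ↥unitClosedDisc → ↥unitClosedDisc := fun z => ⟨S z, hSmem z z.2⟩
  have hT : Function.Bijective T := by
    refine ⟨fun z w h => Subtype.ext (hSinj (congrArg Subtype.val h)), fun w => ?_⟩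
    obtain ⟨z, hz⟩ := hSsurj w
    refine ⟨⟨z, ?_⟩, Subtype.ext hz⟩
    have := mem_closedBall_zero_iff.1 w.2
    refine mem_closedBall_zero_iff.2 ?_
    rwa [← hSn, hz]
  have hTc : Continuous T := (hScont.comp continuous_subtype_val).subtype_mk _
  have : CompactSpace ↥unitClosedDisc := isCompact_iff_compactSpace.1 (isCompact_closedBall _ _)
  set Th : ↥unitClosedDisc ≃ₜ ↥unitClosedDisc :=
    Continuous.homeoOfEquivCompactToT2 (f := Equiv.ofBijective T hT) hTc
  have hTh : ∀ z, (Th z : E2) = S z := fun z => rfl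
  refine ⟨Th.trans φ, ?_, K * (Real.pi / 2), by positivity, fun z w hz hw => ?_⟩
  · ext x
    have h := hTh (Th.symm (φ.symm x))
    rw [Homeomorph.apply_symm_apply] at h
    simp only [discBoundary, mem_ofPred_eq, unitCircle, mem_sphere_zero_iff_norm,
      Homeomorph.symm_trans_apply]
    rw [h, hSn]
  · have hφ : ∀ z : ↥unitClosedDisc, (z : E2) ∈ unitCircle →
        (Th.trans φ) z = f (τ (planeArg z)) := fun z hz => by
      rw [Homeomorph.trans_apply, hfdef]
      congr 1
      exact Subtype.ext ((hTh z).trans (hScircle z hz))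
    rw [hφ z hz, hφ w hw]
    exact hlip z hz w hw

section SquareDisc

/-- The center of the square `[0, m]²`. -/
def squareCenter (m : ℝ) : E2 := !₂[m / 2, m / 2]

theorem squareCenter_apply (m : ℝ) (i : Fin 2) : squareCenter m i = m / 2 := by
  fin_cases i <;> rfl

/-- The radial map from the unit disc onto the square with the center of `[0, m]²` and with
half side `r`. -/
def toSquare (m r : ℝ) (z : E2) : E2 := squareCenter m + r • radialMap (fun z => ‖z‖) supN z

/-- The inverse of `toSquare`. -/
def ofSquare (m r : ℝ) (z : E2) : E2 :=
  radialMap supN (fun z => ‖z‖) (r⁻¹ • (z - squareCenter m))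

theorem ofSquare_toSquare {m r : ℝ} (hr : r ≠ 0) (z : E2) : ofSquare m r (toSquare m r z) = z := by
  rw [ofSquare, toSquare, add_sub_cancel_left, inv_smul_smul₀ hr]
  exact normLike_norm.radialMap_apply_radialMap normLike_supN z

theorem toSquare_ofSquare {m r : ℝ} (hr : r ≠ 0) (z : E2) : toSquare m r (ofSquare m r z) = z := by
  rw [ofSquare, toSquare, normLike_supN.radialMap_apply_radialMap normLike_norm,
    smul_inv_smul₀ hr, add_sub_cancel]

theorem supN_toSquare_sub {m r : ℝ} (hr : 0 ≤ r) (z : E2) :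
    supN (toSquare m r z - squareCenter m) = r * ‖z‖ := by
  rw [toSquare, add_sub_cancel_left, normLike_supN.hom _ _ hr,
    normLike_norm.apply_radialMap normLike_supN]

theorem norm_ofSquare {m r : ℝ} (hr : 0 ≤ r) (z : E2) :
    ‖ofSquare m r z‖ = r⁻¹ * supN (z - squareCenter m) := by
  rw [ofSquare, normLike_supN.apply_radialMap normLike_norm,
    normLike_supN.hom _ _ (inv_nonneg.2 hr)]

theorem exists_lipschitzWith_toSquare (m r : ℝ) : ∃ K, LipschitzWith K (toSquare m r) :=
  ⟨_, (LipschitzWith.const (squareCenter m)).add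
    ((lipschitzWith_smul r).comp (normLike_norm.lipschitz_radialMap normLike_supN))⟩

theorem dist_ofSquare_le (m r m' r' : ℝ) (z w : E2) :
    dist (ofSquare m r z) (ofSquare m' r' w) ≤
      8 * ‖r⁻¹ • (z - squareCenter m) - r'⁻¹ • (w - squareCenter m')‖ := by
  rw [← dist_eq_norm]
  exact (normLike_supN.lipschitz_radialMap normLike_norm).dist_le_mul _ _

theorem lipschitzWith_ofSquare (m : ℝ) {r : ℝ} (hr : 0 ≤ r) :
    LipschitzWith (8 * r⁻¹).toNNReal (ofSquare m r) := by
  refine LipschitzWith.of_dist_le_mul fun z w => (dist_ofSquare_le m r m r z w).trans ?_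
  rw [← smul_sub, sub_sub_sub_cancel_right, norm_smul, Real.norm_of_nonneg (inv_nonneg.2 hr),
    Real.coe_toNNReal _ (by positivity), dist_eq_norm, mul_assoc]

theorem toSquare_mem_collarSquare {m : ℝ} (hm : 0 ≤ m) {z : E2} (hz : ‖z‖ < 1) :
    toSquare m ((m + 2) / 2) z ∈ collarSquare m := by
  intro i
  have h1 := abs_apply_le_supN (toSquare m ((m + 2) / 2) z - squareCenter m) i
  rw [supN_toSquare_sub (by linarith), PiLp.sub_apply, squareCenter_apply] at h1
  have h2 : (m + 2) / 2 * ‖z‖ < (m + 2) / 2 * 1 := mul_lt_mul_of_pos_left hz (by linarith)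
  have h3 := abs_lt.1 (h1.trans_lt h2)
  constructor <;> linarith [h3.1, h3.2]

theorem toSquare_mem_closed {m : ℝ} (hm : 0 ≤ m) {z : E2} (hz : ‖z‖ ≤ 1) (i : Fin 2) :
    -1 ≤ toSquare m ((m + 2) / 2) z i ∧ toSquare m ((m + 2) / 2) z i ≤ m + 1 := by
  have h1 := abs_apply_le_supN (toSquare m ((m + 2) / 2) z - squareCenter m) i
  rw [supN_toSquare_sub (by linarith), PiLp.sub_apply, squareCenter_apply] at h1
  have h2 : (m + 2) / 2 * ‖z‖ ≤ (m + 2) / 2 * 1 := mul_le_mul_of_nonneg_left hz (by linarith)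
  have h3 := abs_le.1 (h1.trans h2)
  constructor <;> linarith [h3.1, h3.2]

theorem collar_toSquare {m : ℝ} (hm : 0 ≤ m) {z : E2} (hz : ‖z‖ = 1) :
    collar m (toSquare m ((m + 2) / 2) z) = 1 := by
  refine le_antisymm (collar_le_one hm (toSquare_mem_closed hm hz.le)) ?_
  have h1 := supN_toSquare_sub (m := m) (r := (m + 2) / 2) (by linarith) z
  rw [hz, mul_one] at h1
  have key : ∀ s : ℝ, |s - m / 2| = (m + 2) / 2 → 1 ≤ |s - clampTo m s| := by
    intro s hs
    rcases (_root_.abs_eq (by linarith)).1 hs with h | h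
    · rw [clampTo_of_ge hm (by linarith), le_abs]
      left; linarith
    · rw [clampTo_of_nonpos (by linarith), le_abs]
      right; linarith
  rw [supN] at h1
  simp only [PiLp.sub_apply, squareCenter_apply] at h1
  rw [collar]
  rcases max_choice |toSquare m ((m + 2) / 2) z 0 - m / 2|
    |toSquare m ((m + 2) / 2) z 1 - m / 2| with h | h
  · exact le_max_of_le_left (key _ (h.symm.trans h1))
  · exact le_max_of_le_right (key _ (h.symm.trans h1))

theorem norm_smul_sub_smul_sub_le {m : ℝ} (hm : 0 < m) {z v : E2}
    (hz : ∀ i, -1 ≤ z i ∧ z i ≤ m + 1) (hv : ∀ i, 0 ≤ v i ∧ v i ≤ m)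
    (hzv : ∀ i, |clampTo m (z i) - v i| ≤ 1) :
    ‖((m + 2) / 2)⁻¹ • (z - squareCenter m) - (m / 2)⁻¹ • (v - squareCenter m)‖ ≤ 12 / m := by
  have key : ∀ i, |((m + 2) / 2)⁻¹ * (z i - m / 2) - (m / 2)⁻¹ * (v i - m / 2)| ≤ 6 / m := by
    intro i
    have h1 : |z i - v i| ≤ 2 := by
      have := abs_sub_clampTo_le hm.le (hz i).1 (hz i).2
      linarith [hzv i, abs_sub_le (z i) (clampTo m (z i)) (v i)]
    have h2 : |v i - m / 2| ≤ m / 2 := abs_le.2 ⟨by linarith [(hv i).1], by linarith [(hv i).2]⟩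
    have e : ((m + 2) / 2)⁻¹ * (z i - m / 2) - (m / 2)⁻¹ * (v i - m / 2) =
        (2 * (z i - v i) - 4 / m * (v i - m / 2)) / (m + 2) := by
      field_simp
      ring
    rw [e, abs_div, abs_of_pos (by linarith : 0 < m + 2)]
    have h3 : |2 * (z i - v i) - 4 / m * (v i - m / 2)| ≤ 6 := by
      refine (abs_sub _ _).trans ?_
      rw [abs_mul, abs_mul, abs_two, abs_of_pos (by positivity : 0 < 4 / m)]
      have : 4 / m * |v i - m / 2| ≤ 4 / m * (m / 2) := by gcongr
      have e2 : 4 / m * (m / 2) = 2 := by field_simp; norm_num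
      linarith
    gcongr
    linarith
  refine (norm_le_abs_add_abs _).trans ?_
  have h0 := key 0
  have h1 := key 1
  simp only [PiLp.sub_apply, PiLp.smul_apply, smul_eq_mul, squareCenter_apply]
  linarith [show (12 : ℝ) / m = 6 / m + 6 / m by ring]

end SquareDisc

section DiscExtend

variable {X : Type*} [MetricSpace X]

/-- Extension of a map on the closed disc to the plane, with an irrelevant value outside. -/
def discExtend (φ : ↥unitClosedDisc ≃ₜ X) (z : E2) : X :=
  Function.extend Subtype.val φ (fun _ => φ ⟨0, by simp [unitClosedDisc]⟩) z

theorem discExtend_coe (φ : ↥unitClosedDisc ≃ₜ X) (z : ↥unitClosedDisc) :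
    discExtend φ z = φ z :=
  Subtype.val_injective.extend_apply _ _ _

theorem discExtend_of_mem (φ : ↥unitClosedDisc ≃ₜ X) {z : E2} (hz : z ∈ unitClosedDisc) :
    discExtend φ z = φ ⟨z, hz⟩ :=
  discExtend_coe φ ⟨z, hz⟩

theorem continuousOn_discExtend (φ : ↥unitClosedDisc ≃ₜ X) :
    ContinuousOn (discExtend φ) unitClosedDisc := by
  rw [continuousOn_iff_continuous_domRestrict]
  convert φ.continuous using 1
  ext z
  exact discExtend_coe φ z

theorem unitCircle_subset_unitClosedDisc : unitCircle ⊆ unitClosedDisc := sphere_subset_closedBall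

theorem ofSquare_mem_unitClosedDisc {m : ℝ} (hm : 0 < m) {v : E2} (hv : ∀ i, 0 ≤ v i ∧ v i ≤ m) :
    ofSquare m (m / 2) v ∈ unitClosedDisc := by
  rw [unitClosedDisc, mem_closedBall_zero_iff, norm_ofSquare (by positivity),
    inv_mul_le_iff₀ (by positivity), mul_one]
  suffices h : ∀ i, |(v - squareCenter m) i| ≤ m / 2 from supN_le.2 ⟨h 0, h 1⟩
  intro i
  rw [PiLp.sub_apply, squareCenter_apply, abs_le]
  constructor <;> linarith [(hv i).1, (hv i).2]

theorem ofSquare_mem_unitCircle {m : ℝ} (hm : 0 < m) {v : E2} (hv : ∀ i, 0 ≤ v i ∧ v i ≤ m)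
    (hb : ∃ i, v i = 0 ∨ v i = m) : ofSquare m (m / 2) v ∈ unitCircle := by
  have h1 := ofSquare_mem_unitClosedDisc hm hv
  rw [unitClosedDisc, mem_closedBall_zero_iff] at h1
  rw [unitCircle, mem_sphere_zero_iff_norm]
  refine le_antisymm h1 ?_
  rw [norm_ofSquare (by positivity), le_inv_mul_iff₀ (by positivity), mul_one]
  obtain ⟨i, hi⟩ := hb
  refine le_trans ?_ (abs_apply_le_supN _ i)
  rw [PiLp.sub_apply, squareCenter_apply, le_abs]
  rcases hi with hi | hi <;> rw [hi]
  · right; linarith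
  · left; linarith

theorem ofSquare_unit_eq {m : ℝ} (hm : 0 < m) (s t : ℝ) :
    ofSquare 1 (1 / 2) !₂[s / m, t / m] = ofSquare m (m / 2) !₂[s, t] := by
  unfold ofSquare
  congr 1
  ext i
  fin_cases i <;> simp [squareCenter] <;> field_simp

theorem HasGeodesics.exists_nearest_square_coloring (hg : HasGeodesics X)
    (φ : ↥unitClosedDisc ≃ₜ X) {N : ℕ} [NeZero N] {p : Fin N → X} (hp : Function.Injective p)
    {η : ℝ} (hη : 0 < η) (m₀ : ℕ) :
    ∃ m, m₀ ≤ m ∧ 0 < m ∧ ∃ col : ℕ × ℕ → Fin N,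
      (∑ i ∈ Finset.range m, ∑ j ∈ Finset.range m, cellCount col i j +
        ∑ i ∈ Finset.range m,
          (bichromatic (col (i, 0)) (col (i + 1, 0)) + bichromatic (col (i, m)) (col (i + 1, m)) +
            bichromatic (col (0, i)) (col (0, i + 1)) + bichromatic (col (m, i)) (col (m, i + 1)))
        ≤ 2 * N) ∧
      ∀ i j : ℕ, i ≤ m → j ≤ m →
        ∃ y, dist (discExtend φ (ofSquare m (m / 2) !₂[(i : ℝ), (j : ℝ)])) y ≤ η ∧
          ∀ l, dist y (p (col (i, j))) ≤ dist y (p l) := by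
  have hmem : ∀ u : ℝ × ℝ, u ∈ Icc (0 : ℝ × ℝ) 1 →
      ofSquare 1 (1 / 2) !₂[u.1, u.2] ∈ unitClosedDisc := by
    intro u hu
    refine ofSquare_mem_unitClosedDisc one_pos fun i => ?_
    fin_cases i
    · exact ⟨hu.1.1, hu.2.1⟩
    · exact ⟨hu.1.2, hu.2.2⟩
  have hcont : Continuous fun u : ℝ × ℝ => ofSquare 1 (1 / 2) !₂[u.1, u.2] := by
    refine (lipschitzWith_ofSquare 1 (by norm_num)).continuous.comp ?_
    fun_prop
  have hΨ : Continuous fun x =>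
      (toSquare 1 (1 / 2) (φ.symm x) 0, toSquare 1 (1 / 2) (φ.symm x) 1) := by
    obtain ⟨K, hK⟩ := exists_lipschitzWith_toSquare 1 (1 / 2)
    have h : Continuous fun x => toSquare 1 (1 / 2) (φ.symm x : E2) :=
      hK.continuous.comp (continuous_subtype_val.comp φ.symm.continuous)
    fun_prop
  have hΨI : ∀ x, (toSquare 1 (1 / 2) (φ.symm x) 0, toSquare 1 (1 / 2) (φ.symm x) 1) ∈
      Icc (0 : ℝ × ℝ) 1 := by
    intro x
    have h1 := supN_toSquare_sub (m := 1) (r := 1 / 2) (by norm_num) (φ.symm x : E2)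
    have h2 : ‖(φ.symm x : E2)‖ ≤ 1 := mem_closedBall_zero_iff.1 (φ.symm x).2
    have h3 : ∀ i, 0 ≤ toSquare 1 (1 / 2) (φ.symm x : E2) i ∧
        toSquare 1 (1 / 2) (φ.symm x : E2) i ≤ 1 := by
      intro i
      have := (abs_apply_le_supN _ i).trans (h1.le.trans (by linarith : _ ≤ (1 / 2 : ℝ)))
      rw [PiLp.sub_apply, squareCenter_apply, abs_le] at this
      constructor <;> linarith [this.1, this.2]
    exact ⟨⟨(h3 0).1, (h3 1).1⟩, (h3 0).2, (h3 1).2⟩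
  have hΦΨ : ∀ x, discExtend φ (ofSquare 1 (1 / 2)
      !₂[toSquare 1 (1 / 2) (φ.symm x) 0, toSquare 1 (1 / 2) (φ.symm x) 1]) = x := by
    intro x
    have h : !₂[toSquare 1 (1 / 2) (φ.symm x : E2) 0, toSquare 1 (1 / 2) (φ.symm x : E2) 1] =
        toSquare 1 (1 / 2) (φ.symm x : E2) := by
      ext i; fin_cases i <;> rfl
    rw [h, ofSquare_toSquare (by norm_num), discExtend_coe, φ.apply_symm_apply]
  obtain ⟨m, hm, hm0, col, hcol, hnear⟩ := hg.exists_nearest_coloring hp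
    (Φ := fun u => discExtend φ (ofSquare 1 (1 / 2) !₂[u.1, u.2]))
    ((continuousOn_discExtend φ).comp hcont.continuousOn hmem) hΨ hΨI hΦΨ
    (fun u hu => by
      simp only [discExtend_of_mem φ (hmem u hu), φ.symm_apply_apply]
      rw [toSquare_ofSquare (by norm_num)]
      rfl) hη m₀
  refine ⟨m, hm, hm0, col, grid_trichromatic_add_boundary_le m N col hcol, fun i j hi hj => ?_⟩
  have := hnear i j hi hj
  rwa [ofSquare_unit_eq (by exact_mod_cast hm0)] at this

theorem exists_dist_discExtend_vertex_le (φ : ↥unitClosedDisc ≃ₜ X) {ε : ℝ} (hε : 0 < ε) :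
    ∃ m₀ : ℕ, ∀ m : ℕ, m₀ ≤ m → 0 < m → ∀ i j i' j' : ℕ, i' ≤ m → j' ≤ m →
      (i' = i ∨ i' = i + 1) → (j' = j ∨ j' = j + 1) →
      dist (discExtend φ (ofSquare m (m / 2) !₂[(i' : ℝ), (j' : ℝ)]))
        (discExtend φ (ofSquare m (m / 2) !₂[(i : ℝ), (j : ℝ)])) ≤ ε := by
  have hcomp : IsCompact unitClosedDisc := isCompact_closedBall 0 1
  have huc := hcomp.uniformContinuousOn_of_continuous (continuousOn_discExtend φ)
  obtain ⟨δ, hδ, hδ'⟩ := Metric.uniformContinuousOn_iff.1 huc ε hε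
  obtain ⟨m₀, hm₀⟩ := exists_nat_gt (32 / δ)
  refine ⟨m₀, fun m hm hm0 i j i' j' hi' hj' hii hjj => (hδ' _ ?_ _ ?_ ?_).le⟩
  · refine ofSquare_mem_unitClosedDisc (by exact_mod_cast hm0) fun q => ?_
    fin_cases q
    · exact ⟨Nat.cast_nonneg _, Nat.cast_le.2 hi'⟩
    · exact ⟨Nat.cast_nonneg _, Nat.cast_le.2 hj'⟩
  · refine ofSquare_mem_unitClosedDisc (by exact_mod_cast hm0) fun q => ?_
    fin_cases q
    · exact ⟨Nat.cast_nonneg _, Nat.cast_le.2 (by omega)⟩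
    · exact ⟨Nat.cast_nonneg _, Nat.cast_le.2 (by omega)⟩
  · have hm1 : (0 : ℝ) < m := by exact_mod_cast hm0
    refine (dist_ofSquare_le _ _ _ _ _ _).trans_lt ?_
    rw [← smul_sub, sub_sub_sub_cancel_right, norm_smul, Real.norm_of_nonneg (by positivity)]
    have h1 := norm_le_abs_add_abs (!₂[(i' : ℝ), (j' : ℝ)] - !₂[(i : ℝ), (j : ℝ)])
    have h2 : |(i' : ℝ) - i| ≤ 1 := by
      rcases hii with rfl | rfl <;> simp
    have h3 : |(j' : ℝ) - j| ≤ 1 := by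
      rcases hjj with rfl | rfl <;> simp
    have h4 : ‖!₂[(i' : ℝ), (j' : ℝ)] - !₂[(i : ℝ), (j : ℝ)]‖ ≤ 2 := by
      refine h1.trans ?_
      simp only [PiLp.sub_apply, Matrix.cons_val_zero, Matrix.cons_val_one]
      linarith
    have h5 : 32 / δ < m := hm₀.trans_le (by exact_mod_cast hm)
    rw [div_lt_iff₀ hδ] at h5
    calc 8 * ((m / 2 : ℝ)⁻¹ * ‖!₂[(i' : ℝ), (j' : ℝ)] - !₂[(i : ℝ), (j : ℝ)]‖)
        ≤ 8 * ((m / 2 : ℝ)⁻¹ * 2) := by gcongr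
      _ = 32 / m := by field_simp; norm_num
      _ < δ := by rw [div_lt_iff₀ hm1]; linarith

end DiscExtend

theorem HasGeodesics.exists_collarData {X : Type*} [MetricSpace X] (hg : HasGeodesics X)
    (φ : ↥unitClosedDisc ≃ₜ X) {B : Type*} [NormedAddCommGroup B] [NormedSpace ℝ B]
    {κ : X → B} (hκ : Isometry κ) {c : E2 → B} {K₁ : ℝ≥0} (hc : LipschitzWith K₁ c)
    (hcκ : ∀ z ∈ unitCircle, c z = κ (discExtend φ z)) {ε : ℝ} (hε : 0 < ε) {P : Finset X}
    (hP : P.Nonempty) (hPB : ∀ b ∈ discBoundary φ, ∃ p ∈ P, dist b p ≤ ε)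
    (hPP : ∀ y y', ∀ p ∈ P, ∀ p' ∈ P, dist y y' ≤ ε → (∀ q ∈ P, dist y p ≤ dist y q) →
      (∀ q ∈ P, dist y' p' ≤ dist y' q) → dist p p' ≤ 10 * ε) :
    ∃ (m : ℕ) (p : Fin P.card → X) (col : ℕ × ℕ → Fin P.card) (K : ℝ≥0),
      (∑ i ∈ Finset.range m, ∑ j ∈ Finset.range m, cellCount col i j +
        ∑ i ∈ Finset.range m,
          (bichromatic (col (i, 0)) (col (i + 1, 0)) + bichromatic (col (i, m)) (col (i + 1, m)) +
            bichromatic (col (0, i)) (col (0, i + 1)) + bichromatic (col (m, i)) (col (m, i + 1)))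
        ≤ 2 * P.card) ∧
      CollarData m P.card col (fun k => κ (p k)) (fun z => c (ofSquare m ((m + 2) / 2) z)) K
        (3 * ε) (10 * ε) ∧ (K : ℝ) ≤ ε ∧ m * (K : ℝ) ≤ 16 * K₁ := by
  have hN : NeZero P.card := ⟨hP.card_pos.ne'⟩
  set p : Fin P.card → X := fun k => (P.equivFin.symm k : X) with hpdef
  have hpinj : Function.Injective p :=
    Subtype.val_injective.comp P.equivFin.symm.injective
  have hpP : ∀ k, p k ∈ P := fun k => (P.equivFin.symm k).2
  have hPp : ∀ q ∈ P, ∃ k, p k = q := fun q hq =>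
    ⟨P.equivFin ⟨q, hq⟩, by simp [hpdef]⟩
  obtain ⟨m₁, hm₁⟩ := exists_dist_discExtend_vertex_le φ (half_pos hε)
  obtain ⟨m₂, hm₂⟩ := exists_nat_ge (96 * K₁ / ε)
  obtain ⟨m, hm, hm0, col, hcol, hnear⟩ := hg.exists_nearest_square_coloring φ hpinj
    (by positivity : 0 < ε / 4) (max m₁ m₂)
  have hm1 : (0 : ℝ) < m := by exact_mod_cast hm0
  have hmK : 96 * (K₁ : ℝ) ≤ m * ε := by
    rw [← div_le_iff₀ hε]
    exact hm₂.trans (by exact_mod_cast (le_max_right _ _).trans hm)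
  have hr : (0 : ℝ) ≤ (m + 2) / 2 := by positivity
  have hK : ((K₁ * (8 * ((m + 2) / 2 : ℝ)⁻¹).toNNReal : ℝ≥0) : ℝ) = 16 * K₁ / (m + 2) := by
    rw [NNReal.coe_mul, Real.coe_toNNReal _ (by positivity)]
    field_simp
    ring
  refine ⟨m, p, col, K₁ * (8 * ((m + 2) / 2 : ℝ)⁻¹).toNNReal, hcol, ?_, ?_, ?_⟩
  · refine ⟨hm0, hc.comp (lipschitzWith_ofSquare m hr), by positivity, by positivity, ?_, ?_⟩
    · intro i j i' j' hi' hj' hii hjj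
      obtain ⟨y, hy, hyn⟩ := hnear i j (by omega) (by omega)
      obtain ⟨y', hy', hyn'⟩ := hnear i' j' hi' hj'
      have hd := hm₁ m ((le_max_left _ _).trans hm) hm0 i j i' j' hi' hj' hii hjj
      rw [← dist_eq_norm, hκ.dist_eq]
      refine hPP y' y _ (hpP _) _ (hpP _) ?_ ?_ ?_
      · have h1 := dist_triangle4 y' (discExtend φ (ofSquare m (m / 2) !₂[(i' : ℝ), (j' : ℝ)]))
          (discExtend φ (ofSquare m (m / 2) !₂[(i : ℝ), (j : ℝ)])) y
        rw [dist_comm] at hy'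
        linarith
      · intro q hq
        obtain ⟨k, rfl⟩ := hPp q hq
        exact hyn' k
      · intro q hq
        obtain ⟨k, rfl⟩ := hPp q hq
        exact hyn k
    · intro z hz i j hi hj hij hi1 hj1
      have hv : ∀ q, 0 ≤ (!₂[(i : ℝ), (j : ℝ)] : E2) q ∧ (!₂[(i : ℝ), (j : ℝ)] : E2) q ≤ m := by
        intro q
        fin_cases q
        · exact ⟨Nat.cast_nonneg _, Nat.cast_le.2 hi⟩
        · exact ⟨Nat.cast_nonneg _, Nat.cast_le.2 hj⟩
      have hzv : ∀ q, |clampTo m (z q) - (!₂[(i : ℝ), (j : ℝ)] : E2) q| ≤ 1 := by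
        intro q
        fin_cases q
        · exact hi1
        · exact hj1
      have hcirc : ofSquare m (m / 2) !₂[(i : ℝ), (j : ℝ)] ∈ unitCircle := by
        refine ofSquare_mem_unitCircle hm1 hv ?_
        rcases hij with rfl | rfl | rfl | rfl
        · exact ⟨0, Or.inl (by simp)⟩
        · exact ⟨0, Or.inr (by simp)⟩
        · exact ⟨1, Or.inl (by simp)⟩
        · exact ⟨1, Or.inr (by simp)⟩
      set u := ofSquare m (m / 2) !₂[(i : ℝ), (j : ℝ)] with hu
      have h1 : ‖c (ofSquare m ((m + 2) / 2) z) - c u‖ ≤ ε := by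
        rw [← dist_eq_norm]
        calc dist (c (ofSquare m ((m + 2) / 2) z)) (c u)
            ≤ K₁ * dist (ofSquare m ((m + 2) / 2) z) u := hc.dist_le_mul _ _
          _ ≤ K₁ * (8 * (12 / m)) := by
            gcongr
            refine (dist_ofSquare_le _ _ _ _ _ _).trans ?_
            gcongr
            exact norm_smul_sub_smul_sub_le hm1 hz hv hzv
          _ = 96 * K₁ / m := by ring
          _ ≤ ε := by rw [div_le_iff₀ hm1]; linarith
      have hbd : discExtend φ u ∈ discBoundary φ := by
        rw [discExtend_of_mem φ (unitCircle_subset_unitClosedDisc hcirc)]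
        simpa [discBoundary] using hcirc
      obtain ⟨q, hq, hqd⟩ := hPB _ hbd
      obtain ⟨k, rfl⟩ := hPp q hq
      obtain ⟨y, hy, hyn⟩ := hnear i j hi hj
      have h2 : ‖c u - κ (p (col (i, j)))‖ ≤ 2 * ε := by
        rw [hcκ u hcirc, ← dist_eq_norm, hκ.dist_eq]
        have h3 := dist_triangle (discExtend φ u) y (p (col (i, j)))
        have h4 := dist_triangle_left y (p k) (discExtend φ u)
        have h5 := hyn k
        linarith
      calc ‖c (ofSquare m ((m + 2) / 2) z) - κ (p (col (i, j)))‖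
          ≤ ‖c (ofSquare m ((m + 2) / 2) z) - c u‖ + ‖c u - κ (p (col (i, j)))‖ :=
            norm_sub_le_norm_sub_add_norm_sub _ _ _
        _ ≤ 3 * ε := by linarith
  · rw [hK, div_le_iff₀ (by positivity)]
    nlinarith [K₁.coe_nonneg]
  · rw [hK, ← mul_div_assoc, div_le_iff₀ (by positivity)]
    nlinarith [K₁.coe_nonneg]

/-- The area bound for the maps obtained from collar data. -/
theorem CollarData.parametrizedArea_le {Y B : Type*} [MetricSpace Y] [NormedAddCommGroup B]
    [NormedSpace ℝ B] {m N : ℕ} {col : ℕ × ℕ → Fin N} {pt : Fin N → B} {C : E2 → B} {K : ℝ≥0}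
    {a b : ℝ} (D : CollarData m N col pt C K a b) {R : B → Y} (hR : LipschitzWith 1 R)
    (hcol : ∑ i ∈ Finset.range m, ∑ j ∈ Finset.range m, cellCount col i j +
        ∑ i ∈ Finset.range m,
          (bichromatic (col (i, 0)) (col (i + 1, 0)) + bichromatic (col (i, m)) (col (i + 1, m)) +
            bichromatic (col (0, i)) (col (0, i + 1)) + bichromatic (col (m, i)) (col (m, i + 1)))
        ≤ 2 * N) :
    parametrizedArea
        (fun z => R (collarMap m (fun k => pt (col k)) C (toSquare m ((m + 2) / 2) z))) ≤
      ENNReal.ofReal (4 * (2 * N * b ^ 2 + 2 * N * b * (a + K) + 4 * m * K * (a + K) +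
        4 * (a + K) ^ 2)) := by
  obtain ⟨K', hK'⟩ := exists_lipschitzWith_toSquare m ((m + 2) / 2)
  have hr : ((m : ℝ) + 2) / 2 ≠ 0 := by positivity
  have hinj : Function.Injective (toSquare (m : ℝ) ((m + 2) / 2)) :=
    Function.LeftInverse.injective fun z => ofSquare_toSquare hr z
  have h := parametrizedArea_le_lintegral hK' hinj.injOn (S := collarSquare m)
    (fun z hz => toSquare_mem_collarSquare (Nat.cast_nonneg m) (mem_ball_zero_iff.1 hz))
    (v := fun z => R (collarMap m (fun k => pt (col k)) C (toSquare m ((m + 2) / 2) z)))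
    (W := collarMap m (fun k => pt (col k)) C)
    (fun y z => by simpa using hR.dist_le_mul _ _) (fun z hz => D.exists_bound hz)
  refine h.trans ?_
  rw [ENNReal.ofReal_mul (by norm_num), ENNReal.ofReal_ofNat]
  gcongr
  exact (setLIntegral_le_lintegral _ _).trans (lintegral_collarWeight_le D.b_nonneg K.coe_nonneg
    (add_nonneg D.a_nonneg K.coe_nonneg) hcol)

theorem exists_homeomorph_circle {X E : Type*} [MetricSpace X] [MetricSpace E]
    (φ : ↥unitClosedDisc ≃ₜ X) {ι : X → E} (hι : Isometry ι) :
    ∃ h : ↥unitCircle ≃ₜ ↥(ι '' discBoundary φ), ∀ v : ↥unitCircle,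
      ((h v : ↥(ι '' discBoundary φ)) : E) = ι (discExtend φ v) := by
  have hcomp : CompactSpace ↥unitCircle := isCompact_iff_compactSpace.1 (isCompact_sphere 0 1)
  have hmem : ∀ v : ↥unitCircle, ι (discExtend φ v) ∈ ι '' discBoundary φ := fun v =>
    mem_image_of_mem ι (by
      rw [discExtend_of_mem φ (unitCircle_subset_unitClosedDisc v.2)]
      simp [discBoundary])
  set f : ↥unitCircle → ↥(ι '' discBoundary φ) := fun v => ⟨ι (discExtend φ v), hmem v⟩
  have hf : Continuous f := by
    refine Continuous.subtype_mk (hι.continuous.comp ?_) _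
    exact continuousOn_iff_continuous_domRestrict.1
      ((continuousOn_discExtend φ).mono unitCircle_subset_unitClosedDisc)
  have hbij : Function.Bijective f := by
    constructor
    · intro v w hvw
      have h1 := hι.injective (Subtype.ext_iff.1 hvw)
      rw [discExtend_of_mem φ (unitCircle_subset_unitClosedDisc v.2),
        discExtend_of_mem φ (unitCircle_subset_unitClosedDisc w.2)] at h1
      exact Subtype.ext (Subtype.mk.inj (φ.injective h1))
    · rintro ⟨_, x, hx, rfl⟩
      refine ⟨⟨_, hx⟩, Subtype.ext (congrArg ι ?_)⟩
      exact (discExtend_coe φ (φ.symm x)).trans (φ.apply_symm_apply x)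
  exact ⟨Continuous.homeoOfEquivCompactToT2 (f := Equiv.ofBijective f hbij) hf, fun v => rfl⟩

theorem discBoundary_eq_image {X : Type*} [MetricSpace X] (φ : ↥unitClosedDisc ≃ₜ X) :
    discBoundary φ = discExtend φ '' unitCircle := by
  ext x
  constructor
  · intro hx
    exact ⟨φ.symm x, hx, (discExtend_coe φ _).trans (φ.apply_symm_apply x)⟩
  · rintro ⟨z, hz, rfl⟩
    rw [discExtend_of_mem φ (unitCircle_subset_unitClosedDisc hz)]
    simpa [discBoundary] using hz

theorem isCompact_discBoundary {X : Type*} [MetricSpace X] (φ : ↥unitClosedDisc ≃ₜ X) :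
    IsCompact (discBoundary φ) := by
  rw [discBoundary_eq_image]
  exact (isCompact_sphere 0 1).image_of_continuousOn
    ((continuousOn_discExtend φ).mono unitCircle_subset_unitClosedDisc)

theorem isConnected_discBoundary {X : Type*} [MetricSpace X] (φ : ↥unitClosedDisc ≃ₜ X) :
    IsConnected (discBoundary φ) := by
  have hconn : IsConnected unitCircle := by
    refine isConnected_sphere ?_ 0 zero_le_one
    rw [← Module.finrank_eq_rank, finrank_euclideanSpace_fin]
    exact_mod_cast one_lt_two
  rw [discBoundary_eq_image]
  exact hconn.image _ ((continuousOn_discExtend φ).mono unitCircle_subset_unitClosedDisc)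

theorem IsInjectiveMetricSpace.exists_extension {X B E : Type} [MetricSpace X] [MetricSpace B]
    [MetricSpace E] (hE : IsInjectiveMetricSpace E) {κ : X → B} (hκ : Isometry κ) {ι : X → E}
    (hι : Isometry ι) : ∃ R : B → E, LipschitzWith 1 R ∧ ∀ x, R (κ x) = ι x := by
  set e := Equiv.ofInjective κ hκ.injective
  have he : ∀ y, κ (e.symm y) = y := fun y => Equiv.apply_ofInjective_symm hκ.injective y
  obtain ⟨R, hR, hRe⟩ := hE B (range κ) (fun y => ι (e.symm y)) <|
    LipschitzWith.of_dist_le_mul fun y z => by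
      rw [hι.dist_eq, ← hκ.dist_eq, he, he, NNReal.coe_one, one_mul]
      rfl
  refine ⟨R, hR, fun x => ?_⟩
  rw [hRe ⟨κ x, mem_range_self x⟩]
  exact congrArg ι (Equiv.ofInjective_symm_apply hκ.injective x)

theorem exists_lipschitz_approx_of_lipschitz_on_circle {X : Type} [MetricSpace X]
    [MeasurableSpace X] [BorelSpace X] (hg : HasGeodesics X) (φ : ↥unitClosedDisc ≃ₜ X)
    (hfin : μH[2] (univ : Set X) ≠ ⊤) (hbd : μH[1] (discBoundary φ) ≠ ⊤) {K₁ : ℝ}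
    (hK₁ : 0 ≤ K₁)
    (hφ : ∀ z w : ↥unitClosedDisc, (z : E2) ∈ unitCircle → (w : E2) ∈ unitCircle →
      dist (φ z) (φ w) ≤ K₁ * dist z w)
    {E : Type} [MetricSpace E] (hE : IsInjectiveMetricSpace E) {ι : X → E} (hι : Isometry ι) :
    ∃ M : ℝ≥0∞, 0 < M ∧ M ≠ ⊤ ∧ ∀ ε : ℝ, 0 < ε →
      ∃ v : E2 → E, (∃ Kl : ℝ≥0, LipschitzOnWith Kl v unitClosedDisc) ∧
        parametrizedArea v ≤ M ∧ IsWeaklyMonotoneParam v (ι '' discBoundary φ) ∧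
        ∀ z ∈ unitClosedDisc, v z ∈ thickening ε (range ι) := by
  have hdisc : CompactSpace ↥unitClosedDisc :=
    isCompact_iff_compactSpace.1 (isCompact_closedBall 0 1)
  have hX : CompactSpace X := φ.compactSpace
  have hconn := isConnected_discBoundary φ
  obtain ⟨M₀, hM₀, hnet⟩ := hg.exists_finset_net (isCompact_discBoundary φ)
    hconn.nonempty hconn.isPreconnected
    (fun A C => isPreconnected_inter_of_homeomorph_disc φ) hfin hbd
  have hκ := kuratowskiEmbedding.isometry X
  set κ := kuratowskiEmbedding X
  obtain ⟨R, hR, hRκ⟩ := hE.exists_extension hκ hι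
  have hcirc : LipschitzOnWith K₁.toNNReal (fun z => κ (discExtend φ z)) unitCircle := by
    refine LipschitzOnWith.of_dist_le_mul fun z hz w hw => ?_
    rw [hκ.dist_eq, discExtend_of_mem φ (unitCircle_subset_unitClosedDisc hz),
      discExtend_of_mem φ (unitCircle_subset_unitClosedDisc hw), Real.coe_toNNReal _ hK₁]
    exact hφ _ _ hz hw
  obtain ⟨c, hc, hcκ⟩ := hcirc.extend_lp_infty
  refine ⟨ENNReal.ofReal (4 * (280 * M₀ + 256 * K₁ + 64)), ?_, ENNReal.ofReal_ne_top,
    fun ε hε => ?_⟩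
  · exact ENNReal.ofReal_pos.2 (by positivity)
  set δ := min ε 1 / 24 with hδ
  have hδ0 : 0 < δ := by positivity
  have hδ1 : δ ≤ 1 := by linarith [min_le_right ε 1]
  have hδε : 23 * δ < ε := by linarith [min_le_left ε 1]
  obtain ⟨P, hP, hPM, hPB, hPP⟩ := hnet δ hδ0 hδ1
  obtain ⟨m, p, col, K, hcol, D, hKδ, hmK⟩ := hg.exists_collarData φ hκ hc
    (fun z hz => (hcκ hz).symm) hδ0 hP hPB (fun y y' p hp p' hp' => hPP y y' p hp p' hp')
  rw [Real.coe_toNNReal _ hK₁] at hmK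
  have hm : (0 : ℝ) ≤ m := Nat.cast_nonneg m
  have hr : ((m : ℝ) + 2) / 2 ≠ 0 := by positivity
  set W := collarMap m (fun k => κ (p (col k))) (fun z => c (ofSquare m ((m + 2) / 2) z)) with hW
  have hsq : ∀ z ∈ unitClosedDisc, ∀ i, -1 ≤ toSquare m ((m + 2) / 2) z i ∧
      toSquare m ((m + 2) / 2) z i ≤ (m : ℝ) + 1 := fun z hz i =>
    toSquare_mem_closed hm (mem_closedBall_zero_iff.1 hz) i
  set v : E2 → E := fun z => R (W (toSquare m ((m + 2) / 2) z)) with hv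
  have hvLip : ∃ Kl : ℝ≥0, LipschitzOnWith Kl v unitClosedDisc := by
    obtain ⟨K₂, hK₂⟩ := D.lipschitzOnWith
    obtain ⟨K₃, hK₃⟩ := exists_lipschitzWith_toSquare m ((m + 2) / 2)
    exact ⟨_, hR.comp_lipschitzOnWith (hK₂.comp hK₃.lipschitzOnWith hsq)⟩
  have hvcirc : ∀ z ∈ unitCircle, v z = ι (discExtend φ z) := by
    intro z hz
    have h1 := collar_toSquare hm (mem_sphere_zero_iff_norm.1 hz)
    simp only [hv, hW]
    rw [CollarData.collarMap_eq_of_boundary h1, ofSquare_toSquare hr, ← hcκ hz, hRκ]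
  refine ⟨v, hvLip, ?_, ⟨?_, ?_, ?_⟩, ?_⟩
  · refine (D.parametrizedArea_le hR hcol).trans (ENNReal.ofReal_le_ofReal ?_)
    have hK0 := K.coe_nonneg
    have hN : (0 : ℝ) ≤ P.card := Nat.cast_nonneg _
    have h1 : 3 * δ + K ≤ 4 * δ := by linarith
    have h2 : (P.card : ℝ) * δ * (3 * δ + K) ≤ P.card * δ * (4 * δ) := by gcongr
    have h3 : m * K * (3 * δ + K) ≤ 16 * K₁ * 4 := by
      have : 3 * δ + K ≤ 4 := by linarith
      gcongr
    have h4 : (3 * δ + K) ^ 2 ≤ 4 ^ 2 := by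
      gcongr
      linarith
    nlinarith
  · exact hvLip.choose_spec.continuousOn.mono unitCircle_subset_unitClosedDisc
  · intro z hz
    rw [hvcirc z hz]
    exact mem_image_of_mem ι (discBoundary_eq_image φ ▸ mem_image_of_mem _ hz)
  · intro η hη
    obtain ⟨h, hh⟩ := exists_homeomorph_circle φ hι
    refine ⟨h, fun z => ?_⟩
    rw [hh, hvcirc z z.2, dist_self]
    exact hη
  · intro z hz
    obtain ⟨k, hk⟩ := D.exists_norm_collarMap_sub_le (hsq z hz)
    refine mem_thickening_iff.2 ⟨ι (p k), mem_range_self _, ?_⟩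
    rw [← hRκ]
    refine (hR.dist_le_mul _ _).trans_lt ?_
    rw [NNReal.coe_one, one_mul, dist_eq_norm]
    exact hk.trans_lt (by linarith)

end Construction

/-- Proposition 5.1: Lipschitz discs of uniformly bounded area spanning the
boundary circle in any neighborhood of `X` inside an injective metric space containing `X`
(such as the injective hull `E(X)`). -/
theorem lipschitz_approx_in_injective_hull
    {X : Type} [MetricSpace X] [MeasurableSpace X] [BorelSpace X]
    (hgeo : IsGeodesicSpace X) (φ : ↥unitClosedDisc ≃ₜ X)
    (hfin : μH[2] (Set.univ : Set X) ≠ ⊤)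
    (hbd : HasFiniteLength (discBoundary φ))
    (E : Type) [MetricSpace E] (hE : IsInjectiveMetricSpace E)
    (ι : X → E) (hι : Isometry ι) :
    ∃ M : ℝ≥0∞, 0 < M ∧ M ≠ ⊤ ∧ ∀ ε : ℝ, 0 < ε →
      ∃ v : E2 → E, (∃ Kl : ℝ≥0, LipschitzOnWith Kl v unitClosedDisc) ∧
        parametrizedArea v ≤ M ∧
        IsWeaklyMonotoneParam v (ι '' discBoundary φ) ∧
        ∀ z ∈ unitClosedDisc, v z ∈ Metric.thickening ε (Set.range ι) := by
  have hlen := hbd.hausdorffMeasure_ne_top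
  obtain ⟨φ', hφ', K, hK, hLip⟩ := exists_homeomorph_lipschitz_on_circle φ hlen
  rw [← hφ'] at hlen ⊢
  exact exists_lipschitz_approx_of_lipschitz_on_circle hgeo.hasGeodesics φ' hfin hlen hK hLip hE hι

end
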